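/- Let L = (V,E) be one of the square, triangular, or hexagonal lattices embedded in the plane, let p = (p_e : e ∈ E) ∈ [0,1]^E, and let P_p be the product measure under which edge e is open with probability p_e. Suppose P_p has the box-crossing property. Then: (a) there exist a, b > 0 and M ∈ ℕ such that for every vertex v ∈ V there exists a vertex w = w(v) ∈ V with |v − w| ≤ M and P_p(rad(C_w) ≥ k) ≥ a·k^{−b} for all k ≥ 1; (b) for every ν > 0 there exist α > 0 and M ∈ ℕ such that for every v ∈ V there exists w = w(v) ∈ V with |v − w| ≤ M and \overline{P}_{p+ν}(w ↔ ∞) > α; moreover \overline{P}_{p+ν}-almost surely there exists a unique infinite open cluster. -/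

import Mathlib

open MeasureTheory Set

set_option linter.unusedVariables false

namespace Perc

/-- Points of the plane. -/
abbrev Pt := ℝ × ℝ

/-- A lattice embedded in the plane, with edges indexed by `E`;
each edge is embedded as the segment between the two endpoints given by `ends`. -/
structure LatticeOn (E : Type) where
  ends : E → Pt × Pt

/-- Bond configurations. -/
abbrev Config (E : Type) := E → Bool

/-- `P` is the Bernoulli bond-percolation product measure in which edge `e`
is open with probability `p e`, independently over edges. -/
def IsBernoulliProduct {E : Type} (p : E → ℝ) (P : Measure (Config E)) : Prop :=
  IsProbabilityMeasure P ∧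
    ∀ (s : Finset E) (f : E → Bool),
      P {ω | ∀ e ∈ s, ω e = f e} =
        ∏ e ∈ s, ENNReal.ofReal (if f e then p e else 1 - p e)

/-- The union of the closed segments of the open edges. -/
def openEdgeSet {E : Type} (L : LatticeOn E) (ω : Config E) : Set Pt :=
  ⋃ e ∈ {e : E | ω e = true}, segment ℝ (L.ends e).1 (L.ends e).2

/-- There is an arc, contained in `S` and in the union of the open edges,
with one endpoint in `A` and the other in `B`. -/
def CrossingIn {E : Type} (L : LatticeOn E) (ω : Config E) (S A B : Set Pt) : Prop :=
  ∃ γ : ℝ → Pt, ContinuousOn γ (Icc 0 1) ∧ γ 0 ∈ A ∧ γ 1 ∈ B ∧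
    ∀ t ∈ Icc (0:ℝ) 1, γ t ∈ S ∩ openEdgeSet L ω

/-- Rotation of the plane by angle `θ`. -/
noncomputable def rot (θ : ℝ) (z : Pt) : Pt :=
  (Real.cos θ * z.1 - Real.sin θ * z.2, Real.sin θ * z.1 + Real.cos θ * z.2)

/-- `f` comprises a rotation and a translation. -/
def IsRotTrans (f : Pt → Pt) : Prop := ∃ θ : ℝ, ∃ t : Pt, f = fun z => rot θ z + t

def stdRect (h l : ℝ) : Set Pt := {z | 0 ≤ z.1 ∧ z.1 ≤ h ∧ 0 ≤ z.2 ∧ z.2 ≤ l}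
def leftSide (h l : ℝ) : Set Pt := {z | z.1 = 0 ∧ 0 ≤ z.2 ∧ z.2 ≤ l}
def rightSide (h l : ℝ) : Set Pt := {z | z.1 = h ∧ 0 ≤ z.2 ∧ z.2 ≤ l}
def bottomSide (h l : ℝ) : Set Pt := {z | z.2 = 0 ∧ 0 ≤ z.1 ∧ z.1 ≤ h}
def topSide (h l : ℝ) : Set Pt := {z | z.2 = l ∧ 0 ≤ z.1 ∧ z.1 ≤ h}

/-- The box `f(stdRect h l)` (where `f` is a rotation plus translation) possesses
open crossings in both directions. -/
def HasBoxCrossings {E : Type} (L : LatticeOn E) (ω : Config E) (h l : ℝ) (f : Pt → Pt) : Prop :=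
  CrossingIn L ω (f '' stdRect h l) (f '' leftSide h l) (f '' rightSide h l) ∧
  CrossingIn L ω (f '' stdRect h l) (f '' bottomSide h l) (f '' topSide h l)

/-- The box-crossing property: for every `α > 0` there is `δ > 0` such that every box
of size `αN × N` (any position and orientation) possesses open crossings with
probability at least `δ`, for all large `N`. -/
def BoxCrossingProperty {E : Type} (L : LatticeOn E) (P : Measure (Config E)) : Prop :=
  ∀ α : ℝ, 0 < α → ∃ δ : ℝ, 0 < δ ∧ ∃ N₀ : ℕ, ∀ N : ℕ, N₀ ≤ N →
    ∀ f : Pt → Pt, IsRotTrans f →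
      ENNReal.ofReal δ ≤ P {ω | HasBoxCrossings L ω (α * N) N f}

/-- Horizontal-crossing event of the box `[-m,m] × [0,n]`. -/
def Ch {E : Type} (L : LatticeOn E) (m n : ℝ) (ω : Config E) : Prop :=
  CrossingIn L ω {z | -m ≤ z.1 ∧ z.1 ≤ m ∧ 0 ≤ z.2 ∧ z.2 ≤ n}
    {z | z.1 = -m ∧ 0 ≤ z.2 ∧ z.2 ≤ n} {z | z.1 = m ∧ 0 ≤ z.2 ∧ z.2 ≤ n}

/-- Vertical-crossing event of the box `[-m,m] × [0,n]`. -/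
def Cv {E : Type} (L : LatticeOn E) (m n : ℝ) (ω : Config E) : Prop :=
  CrossingIn L ω {z | -m ≤ z.1 ∧ z.1 ≤ m ∧ 0 ≤ z.2 ∧ z.2 ≤ n}
    {z | z.2 = 0 ∧ -m ≤ z.1 ∧ z.1 ≤ m} {z | z.2 = n ∧ -m ≤ z.1 ∧ z.1 ≤ m}

/-- `u` and `v` are the endpoints of some open edge. -/
def openAdj {E : Type} (L : LatticeOn E) (ω : Config E) (u v : Pt) : Prop :=
  ∃ e, ω e = true ∧ (L.ends e = (u, v) ∨ L.ends e = (v, u))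

/-- `u` and `v` are joined by a path of open edges. -/
def openConn {E : Type} (L : LatticeOn E) (ω : Config E) : Pt → Pt → Prop :=
  Relation.ReflTransGen (openAdj L ω)

/-- The open cluster at `v`. -/
def cluster {E : Type} (L : LatticeOn E) (ω : Config E) (v : Pt) : Set Pt :=
  {u | openConn L ω v u}

/-- The vertex set of the lattice. -/
def vertexSet {E : Type} (L : LatticeOn E) : Set Pt :=
  ⋃ e : E, {(L.ends e).1, (L.ends e).2}

/-- `v` is the endpoint of an infinite open self-avoiding path. -/
def ConnToInfinity {E : Type} (L : LatticeOn E) (ω : Config E) (v : Pt) : Prop :=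
  ∃ γ : ℕ → Pt, γ 0 = v ∧ Function.Injective γ ∧ ∀ n, openAdj L ω (γ n) (γ (n + 1))

/-- Euclidean distance on the plane. -/
noncomputable def edist2 (u v : Pt) : ℝ := Real.sqrt ((u.1 - v.1) ^ 2 + (u.2 - v.2) ^ 2)

/-- `rad (C_v) ≥ r`, where `rad (C_v)` is the supremum of all `x` such that `C_v`
meets the complement of the open Euclidean ball `v + S_x`. -/
def RadiusGE {E : Type} (L : LatticeOn E) (ω : Config E) (v : Pt) (r : ℝ) : Prop :=
  ∀ x : ℝ, x < r → ∃ u ∈ cluster L ω v, x ≤ edist2 v u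

/-- `κ_□`. -/
def kappaS (a b : ℝ) : ℝ := a + b - 1
/-- `κ_△`. -/
def kappaT (a b c : ℝ) : ℝ := a + b + c - a * b * c - 1
/-- `κ_⬡`. -/
def kappaH (a b c : ℝ) : ℝ := -kappaT (1 - a) (1 - b) (1 - c)

/-- Edges of a square-type lattice: `(a, b, true)` is the `horizontal`-class edge
at `(a,b)` and `(a, b, false)` the `vertical`-class edge at `(a,b)`. -/
abbrev SqE := ℤ × ℤ × Bool
/-- Edges of the triangular lattice (also indexing the dual hexagonal edges):
`(a, b, i)` with `i = 0` horizontal, `i = 1` the right edge of an upwards pointing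
triangle, `i = 2` the left edge of an upwards pointing triangle, in row `b`. -/
abbrev TriE := ℤ × ℤ × Fin 3

/-- The unit square lattice, with vertex set `ℤ²`. -/
noncomputable def sqLattice : LatticeOn SqE :=
  ⟨fun e =>
    if e.2.2 then (((e.1 : ℝ), (e.2.1 : ℝ)), ((e.1 : ℝ) + 1, (e.2.1 : ℝ)))
    else (((e.1 : ℝ), (e.2.1 : ℝ)), ((e.1 : ℝ), (e.2.1 : ℝ) + 1))⟩

/-- The dual of the unit square lattice (shifted by `(1/2, 1/2)`), with each dual edge
indexed by the primal edge it crosses. -/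
noncomputable def sqDualLattice : LatticeOn SqE :=
  ⟨fun e =>
    if e.2.2 then
      (((e.1 : ℝ) + 1 / 2, (e.2.1 : ℝ) - 1 / 2), ((e.1 : ℝ) + 1 / 2, (e.2.1 : ℝ) + 1 / 2))
    else
      (((e.1 : ℝ) - 1 / 2, (e.2.1 : ℝ) + 1 / 2), ((e.1 : ℝ) + 1 / 2, (e.2.1 : ℝ) + 1 / 2))⟩

/-- Vertices of the triangular lattice (equilateral triangles of side `√3`,
one family of edges horizontal). -/
noncomputable def tv (a b : ℤ) : Pt :=
  (Real.sqrt 3 * ((a : ℝ) + (b : ℝ) / 2), 3 / 2 * (b : ℝ))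

/-- The triangular lattice. -/
noncomputable def triLattice : LatticeOn TriE :=
  ⟨fun e =>
    if e.2.2 = 0 then (tv e.1 e.2.1, tv (e.1 + 1) e.2.1)
    else if e.2.2 = 1 then (tv (e.1 + 1) e.2.1, tv e.1 (e.2.1 + 1))
    else (tv e.1 e.2.1, tv e.1 (e.2.1 + 1))⟩

/-- Circumcentre of the upwards pointing triangle with base vertex `tv a b`. -/
noncomputable def hup (a b : ℤ) : Pt :=
  (Real.sqrt 3 * ((a : ℝ) + ((b : ℝ) + 1) / 2), 3 / 2 * (b : ℝ) + 1 / 2)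

/-- Circumcentre of the downwards pointing triangle below the edge `tv a b – tv (a+1) b`. -/
noncomputable def hdown (a b : ℤ) : Pt :=
  (Real.sqrt 3 * ((a : ℝ) + ((b : ℝ) + 1) / 2), 3 / 2 * (b : ℝ) - 1 / 2)

/-- The hexagonal lattice, the planar dual of `triLattice`, with vertices at the
circumcentres of the triangles; each hexagonal edge is indexed by the triangular
edge it crosses. -/
noncomputable def hexLattice : LatticeOn TriE :=
  ⟨fun e =>
    if e.2.2 = 0 then (hdown e.1 e.2.1, hup e.1 e.2.1)
    else if e.2.2 = 1 then (hup e.1 e.2.1, hdown e.1 (e.2.1 + 1))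
    else (hup e.1 e.2.1, hdown (e.1 - 1) (e.2.1 + 1))⟩

/-- The square lattice with horizontal edges of length `√3` and vertical edges of
length `1` (as in the mixed lattices). -/
noncomputable def sqStretch : LatticeOn SqE :=
  ⟨fun e =>
    if e.2.2 then
      ((Real.sqrt 3 * (e.1 : ℝ), (e.2.1 : ℝ)), (Real.sqrt 3 * ((e.1 : ℝ) + 1), (e.2.1 : ℝ)))
    else ((Real.sqrt 3 * (e.1 : ℝ), (e.2.1 : ℝ)), (Real.sqrt 3 * (e.1 : ℝ), (e.2.1 : ℝ) + 1))⟩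

/-- Vertices of the square lattice rotated by `π/4`. -/
noncomputable def rv (a b : ℤ) : Pt :=
  (((a : ℝ) - (b : ℝ)) / Real.sqrt 2, ((a : ℝ) + (b : ℝ)) / Real.sqrt 2)

/-- The square lattice rotated by `π/4`: edges `(a,b,true)` are inclined at angle `π/4`
and edges `(a,b,false)` at angle `3π/4`; the row (height) of such an edge is `a + b`. -/
noncomputable def rsqLattice : LatticeOn SqE :=
  ⟨fun e =>
    if e.2.2 then (rv e.1 e.2.1, rv (e.1 + 1) e.2.1)
    else (rv e.1 e.2.1, rv e.1 (e.2.1 + 1))⟩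

/-- Inhomogeneous intensities on the square lattice: `ph` on horizontal edges,
`pv` on vertical ones. -/
def sqInt (ph pv : ℝ) : SqE → ℝ := fun e => if e.2.2 then ph else pv

/-- Inhomogeneous intensities on the triangular (or hexagonal) lattice:
`p0` on class-0 edges, `p1` on class-1, `p2` on class-2. -/
def triInt (p0 p1 p2 : ℝ) : TriE → ℝ := fun e => ![p0, p1, p2] e.2.2

/-- Highly inhomogeneous intensities on the triangular (or hexagonal) lattice:
`p` on horizontal-class edges, `q n` on right edges of upwards pointing triangles at
height `n`, `q' n` on left edges of upwards pointing triangles at height `n`. -/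
def triHI (p : ℝ) (q q' : ℤ → ℝ) : TriE → ℝ := fun e =>
  if e.2.2 = 0 then p else if e.2.2 = 1 then q e.2.1 else q' e.2.1

/-- Highly inhomogeneous intensities on the rotated square lattice: `q n` on edges
inclined at `π/4` at height `n`, `q' n` on edges inclined at `3π/4` at height `n`. -/
def rsqHI (q q' : ℤ → ℝ) : SqE → ℝ := fun e =>
  if e.2.2 then q (e.1 + e.2.1) else q' (e.1 + e.2.1)


/-- Super-criticality consequences of the box-crossing property for a lattice `L`. -/
def SupercriticalityViaBXP {E : Type} (L : LatticeOn E) : Prop :=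
  ∀ p : E → ℝ, (∀ e, p e ∈ Set.Icc (0 : ℝ) 1) →
  ∀ P : Measure (Config E), IsBernoulliProduct p P → BoxCrossingProperty L P →
    -- (a) polynomial lower bound on the radius, near every vertex
    ((∃ a : ℝ, 0 < a ∧ ∃ b : ℝ, 0 < b ∧ ∃ M : ℕ,
        ∀ v ∈ vertexSet L, ∃ w ∈ vertexSet L, edist2 v w ≤ M ∧
          ∀ k : ℕ, 1 ≤ k →
            ENNReal.ofReal (a * (k : ℝ) ^ (-b)) ≤ P {ω | RadiusGE L ω w k}) ∧
    -- (b) uniform percolation and uniqueness for the enhanced intensities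
     (∀ ν : ℝ, 0 < ν → ∃ α : ℝ, 0 < α ∧ ∃ M : ℕ,
        ∀ Po : Measure (Config E),
          IsBernoulliProduct (fun e => if p e = 0 then 0 else min (p e + ν) 1) Po →
          (∀ v ∈ vertexSet L, ∃ w ∈ vertexSet L, edist2 v w ≤ M ∧
              ENNReal.ofReal α < Po {ω | ConnToInfinity L ω w}) ∧
          Po {ω | ∃ v ∈ vertexSet L, (cluster L ω v).Infinite ∧
              ∀ u ∈ vertexSet L, (cluster L ω u).Infinite →
                cluster L ω u = cluster L ω v} = 1))

section FiniteExpectation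

variable {E : Type} [DecidableEq E]

/-- Average of `f` over the state of the edge `e`, open with probability `p e`. -/
def ave (p : E → ℝ) (e : E) (f : Config E → ℝ) : Config E → ℝ := fun ω =>
  p e * f (Function.update ω e true) + (1 - p e) * f (Function.update ω e false)

lemma ave_comm (p : E → ℝ) (e e' : E) (f : Config E → ℝ) :
    ave p e (ave p e' f) = ave p e' (ave p e f) := by
  by_cases h : e = e'
  · subst h; rfl
  · funext ω
    simp only [ave, Function.update_comm h]
    ring

instance (p : E → ℝ) : LeftCommutative (ave p) := ⟨ave_comm p⟩

/-- Expectation of `f` over the states of the edges in `F`, the other edges being frozen. -/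
def Ex (p : E → ℝ) (F : Finset E) (f : Config E → ℝ) : Config E → ℝ :=
  F.val.foldr (ave p) f

@[simp] lemma Ex_empty (p : E → ℝ) (f : Config E → ℝ) : Ex p ∅ f = f := rfl

lemma Ex_insert (p : E → ℝ) {F : Finset E} {e : E} (h : e ∉ F) (f : Config E → ℝ) :
    Ex p (insert e F) f = ave p e (Ex p F f) := by
  simp [Ex, Finset.insert_val_of_notMem h]

lemma ave_Ex (p : E → ℝ) (F : Finset E) (e : E) (f : Config E → ℝ) :
    ave p e (Ex p F f) = Ex p F (ave p e f) := by
  induction F using Finset.induction_on with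
  | empty => rfl
  | insert a s ha ih => rw [Ex_insert p ha, ave_comm, ih, Ex_insert p ha]

lemma ave_ave (p : E → ℝ) (e : E) (f : Config E → ℝ) :
    ave p e (ave p e f) = ave p e f := by
  funext ω; simp [ave]; ring

lemma Ex_insert' (p : E → ℝ) {F : Finset E} {e : E} (h : e ∉ F) (f : Config E → ℝ) :
    Ex p (insert e F) f = Ex p F (ave p e f) := by
  rw [Ex_insert p h, ave_Ex]

lemma Ex_ave_of_mem (p : E → ℝ) {F : Finset E} {e : E} (h : e ∈ F) (f : Config E → ℝ) :
    Ex p F (ave p e f) = Ex p F f := by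
  obtain ⟨s, hs, rfl⟩ : ∃ s, e ∉ s ∧ F = insert e s :=
    ⟨F.erase e, F.notMem_erase e, (Finset.insert_erase h).symm⟩
  rw [Ex_insert' p hs, ave_ave, Ex_insert' p hs]

lemma Ex_add (p : E → ℝ) (F : Finset E) (f g : Config E → ℝ) (ω : Config E) :
    Ex p F (fun ω => f ω + g ω) ω = Ex p F f ω + Ex p F g ω := by
  induction F using Finset.induction_on generalizing ω with
  | empty => rfl
  | insert a s ha ih => simp only [Ex_insert p ha, ave, ih]; ring

lemma Ex_const_mul (p : E → ℝ) (F : Finset E) (c : ℝ) (f : Config E → ℝ) (ω : Config E) :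
    Ex p F (fun ω => c * f ω) ω = c * Ex p F f ω := by
  induction F using Finset.induction_on generalizing ω with
  | empty => rfl
  | insert a s ha ih => simp only [Ex_insert p ha, ave, ih]; ring

lemma Ex_const (p : E → ℝ) (F : Finset E) (c : ℝ) (ω : Config E) :
    Ex p F (fun _ => c) ω = c := by
  induction F using Finset.induction_on generalizing ω with
  | empty => rfl
  | insert a s ha ih => simp only [Ex_insert p ha, ave, ih]; ring

lemma Ex_sub (p : E → ℝ) (F : Finset E) (f g : Config E → ℝ) (ω : Config E) :
    Ex p F (fun ω => f ω - g ω) ω = Ex p F f ω - Ex p F g ω := by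
  have h := Ex_add p F f (fun ω => (-1) * g ω) ω
  rw [Ex_const_mul] at h
  rw [show (fun ω => f ω - g ω) = fun ω => f ω + (-1) * g ω by funext; ring, h]
  ring

variable {p : E → ℝ}

lemma ave_mono (hp : ∀ e, p e ∈ Icc (0 : ℝ) 1) (e : E) {f g : Config E → ℝ} (h : ∀ ω, f ω ≤ g ω)
    (ω : Config E) : ave p e f ω ≤ ave p e g ω := by
  have h0 := (hp e).1
  have h1 : 0 ≤ 1 - p e := by linarith [(hp e).2]
  exact add_le_add (mul_le_mul_of_nonneg_left (h _) h0) (mul_le_mul_of_nonneg_left (h _) h1)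

lemma Ex_mono (hp : ∀ e, p e ∈ Icc (0 : ℝ) 1) (F : Finset E) {f g : Config E → ℝ}
    (h : ∀ ω, f ω ≤ g ω) (ω : Config E) : Ex p F f ω ≤ Ex p F g ω := by
  induction F using Finset.induction_on generalizing ω with
  | empty => exact h ω
  | insert a s ha ih => rw [Ex_insert p ha, Ex_insert p ha]; exact ave_mono hp a ih ω

lemma Ex_nonneg (hp : ∀ e, p e ∈ Icc (0 : ℝ) 1) (F : Finset E) {f : Config E → ℝ}
    (h : ∀ ω, 0 ≤ f ω) (ω : Config E) : 0 ≤ Ex p F f ω := by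
  have := Ex_mono hp F h ω
  rwa [Ex_const] at this

/-- Expectation only sees the configurations agreeing with the frozen one off `F`. -/
lemma Ex_congr (F : Finset E) {f g : Config E → ℝ} {ω : Config E}
    (h : ∀ ω', (∀ e, e ∉ F → ω' e = ω e) → f ω' = g ω') : Ex p F f ω = Ex p F g ω := by
  induction F using Finset.induction_on generalizing ω with
  | empty => exact h ω (fun _ _ => rfl)
  | insert a s ha ih =>
    have key : ∀ b, Ex p s f (Function.update ω a b) = Ex p s g (Function.update ω a b) := by
      intro b
      apply ih
      intro ω' hω'
      apply h
      intro e he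
      simp only [Finset.mem_insert, not_or] at he
      rw [hω' e he.2, Function.update_of_ne he.1]
    simp only [Ex_insert p ha, ave, key]

/-- A factor not depending on `F` may be taken out. -/
lemma Ex_mul_left (F : Finset E) {f : Config E → ℝ} (g : Config E → ℝ) {ω : Config E}
    (h : ∀ ω', (∀ e, e ∉ F → ω' e = ω e) → f ω' = f ω) :
    Ex p F (fun ω => f ω * g ω) ω = f ω * Ex p F g ω := by
  rw [← Ex_const_mul]
  exact Ex_congr F fun ω' h' => by rw [h ω' h']

lemma Ex_union {F G : Finset E} (h : Disjoint F G) (f : Config E → ℝ) :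
    Ex p (F ∪ G) f = Ex p F (Ex p G f) := by
  induction F using Finset.induction_on with
  | empty => simp
  | insert a s ha ih =>
    rw [Finset.disjoint_insert_left] at h
    rw [Finset.insert_union, Ex_insert p (by simp [ha, h.1]), ih h.2, Ex_insert p ha]

/-- Harris' inequality. -/
lemma Ex_harris (hp : ∀ e, p e ∈ Icc (0 : ℝ) 1) (F : Finset E) {f g : Config E → ℝ}
    (hf : Monotone f) (hg : Monotone g) (ω : Config E) :
    Ex p F f ω * Ex p F g ω ≤ Ex p F (fun ω => f ω * g ω) ω := by
  have mono : ∀ (s : Finset E) {f : Config E → ℝ}, Monotone f → Monotone (Ex p s f) := by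
    intro s f hf
    induction s using Finset.induction_on with
    | empty => exact hf
    | insert a s ha ih =>
      intro ω ω' h
      rw [Ex_insert p ha]
      have h0 := (hp a).1
      have h1 : 0 ≤ 1 - p a := by linarith [(hp a).2]
      exact add_le_add (mul_le_mul_of_nonneg_left (ih (update_le_update_iff.2
        ⟨le_rfl, fun _ _ => h _⟩)) h0) (mul_le_mul_of_nonneg_left
        (ih (update_le_update_iff.2 ⟨le_rfl, fun _ _ => h _⟩)) h1)
  induction F using Finset.induction_on generalizing ω with
  | empty => exact le_rfl
  | insert a s ha ih =>
    simp only [Ex_insert p ha, ave]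
    have h0 := (hp a).1
    have h1 : 0 ≤ 1 - p a := by linarith [(hp a).2]
    have hle : Function.update ω a false ≤ Function.update ω a true :=
      update_le_update_iff.2 ⟨Bool.false_le _, fun _ _ => le_rfl⟩
    have A := ih (Function.update ω a true)
    have B := ih (Function.update ω a false)
    have C := mul_nonneg (sub_nonneg.2 (mono s hf hle)) (sub_nonneg.2 (mono s hg hle))
    have D := mul_nonneg (mul_nonneg h0 h1) C
    have A' := mul_le_mul_of_nonneg_left A h0
    have B' := mul_le_mul_of_nonneg_left B h1
    nlinarith

/-- Expectations of decreasing functions decrease with the intensities. -/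
lemma Ex_anti_param {q : E → ℝ} (hp : ∀ e, p e ∈ Icc (0 : ℝ) 1) (hpq : ∀ e, p e ≤ q e)
    (hq : ∀ e, q e ∈ Icc (0 : ℝ) 1) (F : Finset E) {f : Config E → ℝ} (hf : Antitone f)
    (ω : Config E) : Ex q F f ω ≤ Ex p F f ω := by
  have key : Ex q F f ω ≤ Ex p F f ω ∧ Antitone (Ex q F f) := by
    induction F using Finset.induction_on generalizing ω with
    | empty => exact ⟨le_rfl, hf⟩
    | insert a s ha ih =>
      have anti := (ih ω).2
      have h0 := (hp a).1
      have h1 : 0 ≤ 1 - p a := by linarith [(hp a).2]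
      have h0' := (hq a).1
      have h1' : 0 ≤ 1 - q a := by linarith [(hq a).2]
      constructor
      · simp only [Ex_insert _ ha, ave]
        have hle : Function.update ω a false ≤ Function.update ω a true :=
          update_le_update_iff.2 ⟨Bool.false_le _, fun _ _ => le_rfl⟩
        have A := mul_le_mul_of_nonneg_left (ih (Function.update ω a true)).1 h0
        have B := mul_le_mul_of_nonneg_left (ih (Function.update ω a false)).1 h1
        have C := mul_nonneg (sub_nonneg.2 (hpq a)) (sub_nonneg.2 (anti hle))
        nlinarith
      · intro ω₁ ω₂ h
        rw [Ex_insert _ ha]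
        exact add_le_add (mul_le_mul_of_nonneg_left (anti (update_le_update_iff.2
          ⟨le_rfl, fun _ _ => h _⟩)) h0') (mul_le_mul_of_nonneg_left
          (anti (update_le_update_iff.2 ⟨le_rfl, fun _ _ => h _⟩)) h1')
  exact key.1

lemma Ex_comp_update {F : Finset E} {a : E} (ha : a ∉ F) (b : Bool) (f : Config E → ℝ)
    (ω : Config E) :
    Ex p F (fun ω => f (Function.update ω a b)) ω = Ex p F f (Function.update ω a b) := by
  induction F using Finset.induction_on generalizing ω with
  | empty => rfl
  | insert x s hx ih =>
    simp only [Finset.mem_insert, not_or] at ha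
    simp only [Ex_insert _ hx, ave]
    rw [ih ha.2, ih ha.2, Function.update_comm (Ne.symm ha.1), Function.update_comm (Ne.symm ha.1)]

/-- Russo's formula along a differentiable curve of intensities. -/
lemma hasDerivAt_Ex (F : Finset E) (f : Config E → ℝ) (q : ℝ → E → ℝ) (d : E → ℝ) (t : ℝ)
    (hq : ∀ e, HasDerivAt (fun s => q s e) (d e) t) (ω : Config E) :
    HasDerivAt (fun s => Ex (q s) F f ω) (∑ e ∈ F, d e * Ex (q t) F (fun ω =>
      f (Function.update ω e true) - f (Function.update ω e false)) ω) t := by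
  induction F using Finset.induction_on generalizing ω with
  | empty => simpa using hasDerivAt_const t (f ω)
  | insert a s ha ih =>
    have h1 := (hq a).mul (ih (Function.update ω a true))
    have h2 := ((hq a).const_sub 1).mul (ih (Function.update ω a false))
    have h3 := h1.add h2
    have e1 : Ex (q t) (insert a s) (fun ω => f (Function.update ω a true) -
        f (Function.update ω a false)) ω =
        Ex (q t) s f (Function.update ω a true) - Ex (q t) s f (Function.update ω a false) := by
      rw [Ex_insert _ ha, ave, Ex_sub, Ex_sub, Ex_comp_update ha, Ex_comp_update ha,
        Ex_comp_update ha, Ex_comp_update ha]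
      simp only [Function.update_idem]
      ring
    refine (h3.congr_deriv ?_).congr_of_eventuallyEq ?_
    · rw [Finset.sum_insert ha, e1]
      have e2 : ∑ x ∈ s, d x * Ex (q t) (insert a s) (fun ω => f (Function.update ω x true) -
        f (Function.update ω x false)) ω = q t a * ∑ x ∈ s, d x * Ex (q t) s (fun ω =>
        f (Function.update ω x true) - f (Function.update ω x false)) (Function.update ω a true) +
        (1 - q t a) * ∑ x ∈ s, d x * Ex (q t) s (fun ω => f (Function.update ω x true) -
        f (Function.update ω x false)) (Function.update ω a false) := by
        rw [Finset.mul_sum, Finset.mul_sum, ← Finset.sum_add_distrib]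
        refine Finset.sum_congr rfl fun x hx => ?_
        rw [Ex_insert _ ha, ave]
        ring
      rw [e2]
      ring
    · filter_upwards with s'
      simp [Ex_insert _ ha, ave]

end FiniteExpectation

section FiniteSupport

variable {E : Type} [DecidableEq E] {p : E → ℝ} {P : Measure (Config E)}

/-- The event `A` is determined by the states of the edges in `F`. -/
def Supp (A : Set (Config E)) (F : Finset E) : Prop :=
  ∀ ω ω' : Config E, (∀ e ∈ F, ω e = ω' e) → ω ∈ A → ω' ∈ A

/-- The event `A` is increasing. -/
def Incr (A : Set (Config E)) : Prop := ∀ ω ω' : Config E, ω ≤ ω' → ω ∈ A → ω' ∈ A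

omit [DecidableEq E] in
lemma Supp.mono {A : Set (Config E)} {F G : Finset E} (h : Supp A F) (hFG : F ⊆ G) : Supp A G :=
  fun ω ω' h' => h ω ω' fun e he => h' e (hFG he)

omit [DecidableEq E] in
lemma Supp.inter {A B : Set (Config E)} {F : Finset E} (hA : Supp A F) (hB : Supp B F) :
    Supp (A ∩ B) F := fun ω ω' h hω => ⟨hA ω ω' h hω.1, hB ω ω' h hω.2⟩

omit [DecidableEq E] in
lemma Supp.compl {A : Set (Config E)} {F : Finset E} (hA : Supp A F) : Supp Aᶜ F :=
  fun ω ω' h hω hω' => hω (hA ω' ω (fun e he => (h e he).symm) hω')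

omit [DecidableEq E] in
lemma Incr.inter {A B : Set (Config E)} (hA : Incr A) (hB : Incr B) : Incr (A ∩ B) :=
  fun ω ω' h hω => ⟨hA ω ω' h hω.1, hB ω ω' h hω.2⟩

/-- Real-valued indicator function of an event. -/
noncomputable def ind (A : Set (Config E)) : Config E → ℝ := A.indicator 1

omit [DecidableEq E] in
lemma ind_of_mem {A : Set (Config E)} {ω : Config E} (h : ω ∈ A) : ind A ω = 1 := by
  simp [ind, h]

omit [DecidableEq E] in
lemma ind_of_notMem {A : Set (Config E)} {ω : Config E} (h : ω ∉ A) : ind A ω = 0 := by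
  simp [ind, h]

omit [DecidableEq E] in
lemma ind_mem_Icc (A : Set (Config E)) (ω : Config E) : ind A ω ∈ Icc (0 : ℝ) 1 := by
  by_cases h : ω ∈ A
  · simp [ind_of_mem h]
  · simp [ind_of_notMem h]

omit [DecidableEq E] in
lemma Incr.monotone_ind {A : Set (Config E)} (h : Incr A) : Monotone (ind A) := by
  intro ω ω' hle
  by_cases hω : ω ∈ A
  · rw [ind_of_mem hω, ind_of_mem (h _ _ hle hω)]
  · rw [ind_of_notMem hω]; exact (ind_mem_Icc A ω').1

omit [DecidableEq E] in
lemma ind_compl (A : Set (Config E)) (ω : Config E) : ind Aᶜ ω = 1 - ind A ω := by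
  by_cases h : ω ∈ A
  · rw [ind_of_mem h, ind_of_notMem (by simpa using h)]; ring
  · rw [ind_of_notMem h, ind_of_mem (by simpa using h)]; ring

omit [DecidableEq E] in
lemma ind_inter (A B : Set (Config E)) (ω : Config E) : ind (A ∩ B) ω = ind A ω * ind B ω := by
  simp [ind, Set.inter_indicator_one]

omit [DecidableEq E] in
lemma Supp.ind_congr {A : Set (Config E)} {F : Finset E} (h : Supp A F) {ω ω' : Config E}
    (h' : ∀ e ∈ F, ω e = ω' e) : ind A ω = ind A ω' := by
  by_cases hω : ω ∈ A
  · rw [ind_of_mem hω, ind_of_mem (h ω ω' h' hω)]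
  · rw [ind_of_notMem hω, ind_of_notMem fun h2 => hω (h ω' ω (fun e he => (h' e he).symm) h2)]

/-- Expectation of a function of the edges in `G` does not see the frozen edges off `G`. -/
lemma Ex_congr_base_of_dep (F G : Finset E) {f : Config E → ℝ}
    (hf : ∀ ω ω' : Config E, (∀ e ∈ G, ω e = ω' e) → f ω = f ω') {ω ω' : Config E}
    (h : ∀ e ∈ G, e ∉ F → ω e = ω' e) : Ex p F f ω = Ex p F f ω' := by
  induction F using Finset.induction_on generalizing ω ω' with
  | empty => exact hf _ _ fun e he => h e he (by simp)
  | insert a s ha ih =>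
    have key : ∀ b, Ex p s f (Function.update ω a b) = Ex p s f (Function.update ω' a b) := by
      intro b
      apply ih
      intro e he hes
      by_cases hea : e = a
      · subst hea; simp
      · simp [hea, h e he (by simp [hea, hes])]
    simp only [Ex_insert p ha, ave, key]

lemma prob_cylinder_inter (hp : ∀ e, p e ∈ Icc (0 : ℝ) 1) (hP : IsBernoulliProduct p P)
    {A : Set (Config E)} (F G : Finset E) (hFG : Disjoint F G) (hA : Supp A (F ∪ G))
    (ω : Config E) :
    P {ω' | ω' ∈ A ∧ ∀ e ∈ G, ω' e = ω e} =
      (∏ e ∈ G, ENNReal.ofReal (if ω e then p e else 1 - p e)) *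
        ENNReal.ofReal (Ex p F (ind A) ω) := by
  induction F using Finset.induction_on generalizing ω G with
  | empty =>
    by_cases h : ω ∈ A
    · have : {ω' | ω' ∈ A ∧ ∀ e ∈ G, ω' e = ω e} = {ω' | ∀ e ∈ G, ω' e = ω e} := by
        ext ω'
        simp only [mem_ofPred_eq, and_iff_right_iff_imp]
        intro h'
        exact hA ω ω' (fun e he => (h' e (by simpa using he)).symm) h
      rw [this, hP.2, Ex_empty, ind_of_mem h]
      simp
    · have : {ω' | ω' ∈ A ∧ ∀ e ∈ G, ω' e = ω e} = ∅ := by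
        ext ω'
        simp only [mem_ofPred_eq, mem_empty_iff_false, iff_false, not_and]
        intro h1 h2
        exact h (hA ω' ω (fun e he => h2 e (by simpa using he)) h1)
      rw [this, Ex_empty, ind_of_notMem h]
      simp
  | insert a s ha ih =>
    rw [Finset.disjoint_insert_left] at hFG
    have hm : MeasurableSet {ω : Config E | ω a = true} :=
      measurableSet_eq_fun (measurable_pi_apply a) measurable_const
    rw [← measure_inter_add_sdiff _ hm]
    have key : ∀ b : Bool, P {ω' | ω' ∈ A ∧ ∀ e ∈ insert a G, ω' e = Function.update ω a b e} =
        (∏ e ∈ G, ENNReal.ofReal (if ω e then p e else 1 - p e)) *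
        (ENNReal.ofReal (if b then p a else 1 - p a) *
        ENNReal.ofReal (Ex p s (ind A) (Function.update ω a b))) := by
      intro b
      rw [ih (insert a G) (by simp [ha, hFG.2]) (by simpa using hA), Finset.prod_insert hFG.1,
        Function.update_self, mul_comm (ENNReal.ofReal (if b = true then p a else 1 - p a)),
        mul_assoc]
      congr 1
      refine Finset.prod_congr rfl fun e he => ?_
      rw [Function.update_of_ne (ne_of_mem_of_not_mem he hFG.1)]
    have e1 : {ω' | ω' ∈ A ∧ ∀ e ∈ G, ω' e = ω e} ∩ {ω | ω a = true} =
        {ω' | ω' ∈ A ∧ ∀ e ∈ insert a G, ω' e = Function.update ω a true e} := by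
      ext ω'
      simp only [mem_inter_iff, mem_ofPred_eq, Finset.forall_mem_insert, Function.update_self]
      constructor
      · rintro ⟨⟨h1, h2⟩, h3⟩
        refine ⟨h1, h3, fun e he => ?_⟩
        rw [Function.update_of_ne (ne_of_mem_of_not_mem he hFG.1), h2 e he]
      · rintro ⟨h1, h3, h2⟩
        refine ⟨⟨h1, fun e he => ?_⟩, h3⟩
        rw [h2 e he, Function.update_of_ne (ne_of_mem_of_not_mem he hFG.1)]
    have e2 : {ω' | ω' ∈ A ∧ ∀ e ∈ G, ω' e = ω e} \ {ω | ω a = true} =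
        {ω' | ω' ∈ A ∧ ∀ e ∈ insert a G, ω' e = Function.update ω a false e} := by
      ext ω'
      simp only [mem_sdiff, mem_ofPred_eq, Finset.forall_mem_insert, Function.update_self,
        Bool.not_eq_true]
      constructor
      · rintro ⟨⟨h1, h2⟩, h3⟩
        refine ⟨h1, h3, fun e he => ?_⟩
        rw [Function.update_of_ne (ne_of_mem_of_not_mem he hFG.1), h2 e he]
      · rintro ⟨h1, h3, h2⟩
        refine ⟨⟨h1, fun e he => ?_⟩, h3⟩
        rw [h2 e he, Function.update_of_ne (ne_of_mem_of_not_mem he hFG.1)]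
    have nn : ∀ b, 0 ≤ Ex p s (ind A) (Function.update ω a b) := fun b =>
      Ex_nonneg hp s (fun ω => (ind_mem_Icc A ω).1) _
    have h0 := (hp a).1
    have h1 : 0 ≤ 1 - p a := by linarith [(hp a).2]
    rw [e1, e2, key, key, ← mul_add, ← ENNReal.ofReal_mul (by simpa using h0),
      ← ENNReal.ofReal_mul (by simpa using h1), ← ENNReal.ofReal_add
        (mul_nonneg (by simpa using h0) (nn _)) (mul_nonneg (by simpa using h1) (nn _)),
      Ex_insert p ha]
    simp [ave]

/-- The probability of an event determined by finitely many edges. -/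
lemma prob_eq (hp : ∀ e, p e ∈ Icc (0 : ℝ) 1) (hP : IsBernoulliProduct p P)
    {A : Set (Config E)} {F : Finset E} (hA : Supp A F) (ω : Config E) :
    P A = ENNReal.ofReal (Ex p F (ind A) ω) := by
  simpa using prob_cylinder_inter hp hP F ∅ (by simp) (by simpa using hA) ω

lemma prob_harris (hp : ∀ e, p e ∈ Icc (0 : ℝ) 1) (hP : IsBernoulliProduct p P)
    {A B : Set (Config E)} {F : Finset E} (hA : Supp A F) (hB : Supp B F) (iA : Incr A)
    (iB : Incr B) : P A * P B ≤ P (A ∩ B) := by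
  have ω : Config E := fun _ => true
  rw [prob_eq hp hP hA ω, prob_eq hp hP hB ω, prob_eq hp hP (hA.inter hB) ω,
    ← ENNReal.ofReal_mul (Ex_nonneg hp F (fun ω => (ind_mem_Icc A ω).1) _)]
  apply ENNReal.ofReal_le_ofReal
  refine (Ex_harris hp F iA.monotone_ind iB.monotone_ind ω).trans (le_of_eq ?_)
  congr 1
  funext ω
  exact (ind_inter A B ω).symm

lemma prob_indep (hp : ∀ e, p e ∈ Icc (0 : ℝ) 1) (hP : IsBernoulliProduct p P)
    {A B : Set (Config E)} {F G : Finset E} (hA : Supp A F) (hB : Supp B G)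
    (hFG : Disjoint F G) : P (A ∩ B) = P A * P B := by
  have ω : Config E := fun _ => true
  have hA' := hA.mono (Finset.subset_union_left (s₂ := G))
  have hB' := hB.mono (Finset.subset_union_right (s₁ := F))
  rw [prob_eq hp hP (hA'.inter hB') ω, prob_eq hp hP hA ω, prob_eq hp hP hB ω,
    ← ENNReal.ofReal_mul (Ex_nonneg hp F (fun ω => (ind_mem_Icc A ω).1) _)]
  congr 1
  rw [show ind (A ∩ B) = fun ω => ind A ω * ind B ω from funext (ind_inter A B), Ex_union hFG]
  have hG : ∀ ω', Ex p G (fun ω => ind A ω * ind B ω) ω' = Ex p G (ind B) ω * ind A ω' := by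
    intro ω'
    rw [Ex_mul_left G _ (fun ω'' h => hA.ind_congr fun e he =>
      h e (Finset.disjoint_left.1 hFG he)), mul_comm]
    rw [Ex_congr_base_of_dep G G (fun _ _ => hB.ind_congr) fun e he hne => absurd he hne]
  rw [show Ex p G (fun ω => ind A ω * ind B ω) = fun ω' => Ex p G (ind B) ω * ind A ω' from
    funext hG, Ex_const_mul, mul_comm]

end FiniteSupport

section OSSS

variable {E V : Type} [DecidableEq E] {p : E → ℝ}

/-- Adjacency through a closed edge of `F`, in the graph with edge-endpoints `fe`. -/
def CAdj (fe : E → V × V) (F : Finset E) (ω : Config E) (u v : V) : Prop :=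
  ∃ e ∈ F, ω e = false ∧ (fe e = (u, v) ∨ fe e = (v, u))

/-- Vertices joined to `A` by closed edges of `F`. -/
def Reach (fe : E → V × V) (F : Finset E) (ω : Config E) (A : Set V) : Set V :=
  {v | ∃ a ∈ A, Relation.ReflTransGen (CAdj fe F ω) a v}

/-- The exploration of the closed clusters meeting `A` inspects the edge `e`. -/
def Touched (fe : E → V × V) (F : Finset E) (A : Set V) (e : E) : Set (Config E) :=
  {ω | (fe e).1 ∈ Reach fe F ω A ∨ (fe e).2 ∈ Reach fe F ω A}

omit [DecidableEq E] in
lemma Reach_subset {fe : E → V × V} {F : Finset E} {ω : Config E} {A B : Set V} (hAB : A ⊆ B)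
    (h : ∀ u v, u ∈ B → CAdj fe F ω u v → v ∈ B) : Reach fe F ω A ⊆ B := by
  rintro v ⟨a, ha, hv⟩
  induction hv with
  | refl => exact hAB ha
  | tail _ h2 ih => exact h _ _ ih h2

omit [DecidableEq E] in
lemma subset_Reach (fe : E → V × V) (F : Finset E) (ω : Config E) (A : Set V) :
    A ⊆ Reach fe F ω A := fun a ha => ⟨a, ha, .refl⟩

omit [DecidableEq E] in
lemma Reach_step {fe : E → V × V} {F : Finset E} {ω : Config E} {A : Set V} {u v : V}
    (hu : u ∈ Reach fe F ω A) (h : CAdj fe F ω u v) : v ∈ Reach fe F ω A := by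
  obtain ⟨a, ha, hau⟩ := hu
  exact ⟨a, ha, hau.tail h⟩

/-- The part of the vertex set known to be reached after inspecting `e`. -/
def grow (fe : E → V × V) (A : Set V) (e : E) (b : Bool) : Set V :=
  if b then A else A ∪ {(fe e).1, (fe e).2}

lemma Reach_grow {fe : E → V × V} {F : Finset E} {A : Set V} {e : E} (heF : e ∈ F)
    (hA : (fe e).1 ∈ A ∨ (fe e).2 ∈ A) (ω : Config E) (b : Bool) :
    Reach fe F (Function.update ω e b) A = Reach fe (F.erase e) ω (grow fe A e b) := by
  apply Subset.antisymm
  · apply Reach_subset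
    · refine Subset.trans ?_ (subset_Reach _ _ _ _)
      cases b
      · exact subset_union_left
      · exact subset_rfl
    · rintro u v hu ⟨e', he', hc, hends⟩
      by_cases h : e' = e
      · subst h
        rw [Function.update_self] at hc
        subst hc
        apply subset_Reach
        rcases hends with h | h <;> simp [grow, h]
      · rw [Function.update_of_ne h] at hc
        exact Reach_step hu ⟨e', Finset.mem_erase.2 ⟨h, he'⟩, hc, hends⟩
  · apply Reach_subset
    · cases b
      · simp only [grow, Bool.false_eq_true, if_false]
        apply union_subset (subset_Reach _ _ _ _)
        have h12 : CAdj fe F (Function.update ω e false) (fe e).1 (fe e).2 :=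
          ⟨e, heF, by simp, by simp⟩
        have h21 : CAdj fe F (Function.update ω e false) (fe e).2 (fe e).1 :=
          ⟨e, heF, by simp, by simp⟩
        rintro x (rfl | rfl)
        · rcases hA with h | h
          · exact subset_Reach _ _ _ _ h
          · exact Reach_step (subset_Reach _ _ _ _ h) h21
        · rcases hA with h | h
          · exact Reach_step (subset_Reach _ _ _ _ h) h12
          · exact subset_Reach _ _ _ _ h
      · simpa [grow] using subset_Reach _ _ _ _
    · rintro u v hu ⟨e', he', hc, hends⟩
      rw [Finset.mem_erase] at he'
      exact Reach_step hu ⟨e', he'.2, by rwa [Function.update_of_ne he'.1], hends⟩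

lemma abs_Ex_le (hp : ∀ e, p e ∈ Icc (0 : ℝ) 1) (F : Finset E) (f : Config E → ℝ)
    (ω : Config E) : |Ex p F f ω| ≤ Ex p F (fun ω => |f ω|) ω := by
  rw [abs_le]
  constructor
  · have := Ex_mono hp F (f := fun ω => (-1) * |f ω|) (g := f)
      (fun ω => by linarith [neg_abs_le (f ω)]) ω
    rw [Ex_const_mul] at this
    linarith
  · exact Ex_mono hp F (fun ω => le_abs_self _) ω

lemma abs_ave_le (hp : ∀ e, p e ∈ Icc (0 : ℝ) 1) (e : E) (f : Config E → ℝ)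
    (ω : Config E) : |ave p e f ω| ≤ ave p e (fun ω => |f ω|) ω := by
  simpa [Ex] using abs_Ex_le hp {e} f ω

lemma ave_sub (e : E) (f g : Config E → ℝ) :
    ave p e (fun ω => f ω - g ω) = fun ω => ave p e f ω - ave p e g ω := by
  funext ω; simp only [ave]; ring

lemma update_eq_of_agree {e : E} {b : Bool} {ω' ω : Config E} {F : Finset E} (heF : e ∉ F)
    (h : ∀ x, x ∉ F → ω' x = Function.update ω e b x) : Function.update ω' e b = ω' := by
  have := h e heF
  rw [Function.update_self] at this
  rw [← this, Function.update_eq_self]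

/-- The O'Donnell–Saks–Schramm–Servedio inequality for cluster explorations. -/
theorem osss (hp : ∀ e, p e ∈ Icc (0 : ℝ) 1) (fe : E → V × V) (n : ℕ) :
    ∀ (F : Finset E), F.card = n → ∀ (A : Set V) (f g : Config E → ℝ) (ω₀ : Config E),
      (∀ ω, f ω ∈ Icc (0 : ℝ) 1) →
      (∀ ω ω', (∀ e ∈ F, ω ∈ Touched fe F A e → ω e = ω' e) →
        (∀ e, e ∉ F → ω e = ω' e) → f ω = f ω') →
      |Ex p F (fun ω => f ω * g ω) ω₀ - Ex p F f ω₀ * Ex p F g ω₀| ≤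
        ∑ e ∈ F, Ex p F (ind (Touched fe F A e)) ω₀ *
          Ex p F (fun ω => |g ω - ave p e g ω|) ω₀ := by
  induction n with
  | zero =>
    intro F hF A f g ω₀ _ _
    rw [Finset.card_eq_zero] at hF
    subst hF
    simp
  | succ n ih =>
    intro F hF A f g ω₀ hf01 hf
    have Inn : ∀ e, 0 ≤ Ex p F (fun ω => |g ω - ave p e g ω|) ω₀ :=
      fun e => Ex_nonneg hp F (fun ω => abs_nonneg _) _
    by_cases hA : ∃ e ∈ F, (fe e).1 ∈ A ∨ (fe e).2 ∈ A
    · obtain ⟨e, heF, heA⟩ := hA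
      set F' := F.erase e with hF'
      have heF' : e ∉ F' := F.notMem_erase e
      have hins : insert e F' = F := Finset.insert_erase heF
      have hcard : F'.card = n := by rw [hF', Finset.card_erase_of_mem heF, hF]; rfl
      set g' := ave p e g with hg'
      have split : ∀ h : Config E → ℝ, Ex p F h ω₀ = p e * Ex p F' h (Function.update ω₀ e true) +
          (1 - p e) * Ex p F' h (Function.update ω₀ e false) := by
        intro h; rw [← hins, Ex_insert p heF']; rfl
      have g'base : ∀ ω b, g' (Function.update ω e b) = g' ω := by
        intro ω b; simp [hg', ave]
      have base : ∀ (h : Config E → ℝ), (∀ ω b, h (Function.update ω e b) = h ω) → ∀ b,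
          Ex p F' h (Function.update ω₀ e b) = Ex p F h ω₀ := by
        intro h hh b
        have : ∀ b, Ex p F' h (Function.update ω₀ e b) = Ex p F' h ω₀ := by
          intro b
          rw [← Ex_comp_update heF' b h ω₀]
          simp only [hh]
        rw [split, this true, this false, this b]; ring
      -- the conditioned functions
      have step : ∀ b, |Ex p F' (fun ω => f ω * g' ω) (Function.update ω₀ e b) -
          Ex p F' f (Function.update ω₀ e b) * Ex p F g ω₀| ≤ ∑ e' ∈ F',
          Ex p F' (ind (Touched fe F A e')) (Function.update ω₀ e b) *
          Ex p F (fun ω => |g ω - ave p e' g ω|) ω₀ := by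
        intro b
        have := ih F' hcard (grow fe A e b) (fun ω => f (Function.update ω e b)) g'
          (Function.update ω₀ e b) (fun ω => hf01 _) (by
            intro ω ω' h1 h2
            apply hf
            · intro e' he' ht
              by_cases h : e' = e
              · subst h; simp
              · rw [Function.update_of_ne h, Function.update_of_ne h]
                refine h1 e' (Finset.mem_erase.2 ⟨h, he'⟩) ?_
                simpa only [Touched, mem_ofPred_eq, Reach_grow heF heA] using ht
            · intro e' he'
              have h : e' ≠ e := fun h => he' (h ▸ heF)
              rw [Function.update_of_ne h, Function.update_of_ne h]
              exact h2 e' (fun h => he' (Finset.mem_of_mem_erase h)))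
        have c1 : Ex p F' (fun ω => f (Function.update ω e b) * g' ω) (Function.update ω₀ e b) =
            Ex p F' (fun ω => f ω * g' ω) (Function.update ω₀ e b) :=
          Ex_congr F' fun ω' h => by rw [update_eq_of_agree heF' h]
        have c2 : Ex p F' (fun ω => f (Function.update ω e b)) (Function.update ω₀ e b) =
            Ex p F' f (Function.update ω₀ e b) :=
          Ex_congr F' fun ω' h => by rw [update_eq_of_agree heF' h]
        have c3 : Ex p F' g' (Function.update ω₀ e b) = Ex p F g ω₀ := by
          rw [base g' g'base, hg', Ex_ave_of_mem p heF]
        rw [c1, c2, c3] at this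
        refine this.trans (Finset.sum_le_sum fun e' he' => ?_)
        have c4 : Ex p F' (ind (Touched fe F' (grow fe A e b) e')) (Function.update ω₀ e b) =
            Ex p F' (ind (Touched fe F A e')) (Function.update ω₀ e b) := by
          refine Ex_congr F' fun ω' h => ?_
          have : ω' ∈ Touched fe F' (grow fe A e b) e' ↔ ω' ∈ Touched fe F A e' := by
            have h5 := Reach_grow heF heA ω' b
            rw [update_eq_of_agree heF' h] at h5
            simp only [Touched, mem_ofPred_eq, h5, hF']
          by_cases h6 : ω' ∈ Touched fe F A e'
          · rw [ind_of_mem h6, ind_of_mem (this.2 h6)]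
          · rw [ind_of_notMem h6, ind_of_notMem (fun h7 => h6 (this.1 h7))]
        rw [c4]
        apply mul_le_mul_of_nonneg_left _ (Ex_nonneg hp F' (fun ω => (ind_mem_Icc _ ω).1) _)
        rw [base _ (fun ω b => by rw [g'base, hg', ave_comm]; simp [ave])]
        have c5 : ∀ ω, |g' ω - ave p e' g' ω| ≤ ave p e (fun ω => |g ω - ave p e' g ω|) ω := by
          intro ω
          refine le_trans (le_of_eq ?_) (abs_ave_le hp e _ ω)
          rw [ave_sub, hg', ave_comm]
        refine (Ex_mono hp F c5 ω₀).trans ?_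
        rw [Ex_ave_of_mem p heF]
      have h0 := (hp e).1
      have h1 : 0 ≤ 1 - p e := by linarith [(hp e).2]
      have first : |Ex p F (fun ω => f ω * g ω) ω₀ - Ex p F (fun ω => f ω * g' ω) ω₀| ≤
          Ex p F (fun ω => |g ω - g' ω|) ω₀ := by
        rw [← Ex_sub]
        refine (abs_Ex_le hp F _ ω₀).trans (Ex_mono hp F (fun ω => ?_) ω₀)
        rw [← mul_sub, abs_mul, abs_of_nonneg (hf01 ω).1]
        exact mul_le_of_le_one_left (abs_nonneg _) (hf01 ω).2
      have second : |Ex p F (fun ω => f ω * g' ω) ω₀ - Ex p F f ω₀ * Ex p F g ω₀| ≤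
          ∑ e' ∈ F', Ex p F (ind (Touched fe F A e')) ω₀ *
          Ex p F (fun ω => |g ω - ave p e' g ω|) ω₀ := by
        have st := mul_le_mul_of_nonneg_left (step true) h0
        have sf := mul_le_mul_of_nonneg_left (step false) h1
        have e1 : ∑ e' ∈ F', Ex p F (ind (Touched fe F A e')) ω₀ *
          Ex p F (fun ω => |g ω - ave p e' g ω|) ω₀ = p e * ∑ e' ∈ F',
          Ex p F' (ind (Touched fe F A e')) (Function.update ω₀ e true) *
          Ex p F (fun ω => |g ω - ave p e' g ω|) ω₀ + (1 - p e) * ∑ e' ∈ F',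
          Ex p F' (ind (Touched fe F A e')) (Function.update ω₀ e false) *
          Ex p F (fun ω => |g ω - ave p e' g ω|) ω₀ := by
          rw [Finset.mul_sum, Finset.mul_sum, ← Finset.sum_add_distrib]
          refine Finset.sum_congr rfl fun e' he' => ?_
          rw [split (ind (Touched fe F A e'))]
          ring
        rw [e1]
        refine le_trans ?_ (add_le_add st sf)
        have e2 : Ex p F (fun ω => f ω * g' ω) ω₀ - Ex p F f ω₀ * Ex p F g ω₀ =
            p e * (Ex p F' (fun ω => f ω * g' ω) (Function.update ω₀ e true) -
              Ex p F' f (Function.update ω₀ e true) * Ex p F g ω₀) +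
            (1 - p e) * (Ex p F' (fun ω => f ω * g' ω) (Function.update ω₀ e false) -
              Ex p F' f (Function.update ω₀ e false) * Ex p F g ω₀) := by
          rw [split (fun ω => f ω * g' ω), split f]
          ring
        rw [e2]
        refine (abs_add_le _ _).trans (le_of_eq ?_)
        rw [abs_mul, abs_mul, abs_of_nonneg h0, abs_of_nonneg h1]
      rw [← Finset.add_sum_erase F _ heF]
      have hone : Ex p F (ind (Touched fe F A e)) ω₀ = 1 := by
        rw [← Ex_const p F 1 ω₀]
        congr 1
        funext ω
        refine ind_of_mem ?_
        exact heA.imp (fun h => subset_Reach _ _ _ _ h) (fun h => subset_Reach _ _ _ _ h)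
      rw [hone, one_mul]
      calc _ ≤ |Ex p F (fun ω => f ω * g ω) ω₀ - Ex p F (fun ω => f ω * g' ω) ω₀| +
            |Ex p F (fun ω => f ω * g' ω) ω₀ - Ex p F f ω₀ * Ex p F g ω₀| := abs_sub_le _ _ _
        _ ≤ _ := add_le_add first second
    · push Not at hA
      have hR : ∀ ω, Reach fe F ω A = A := by
        intro ω
        apply Subset.antisymm _ (subset_Reach _ _ _ _)
        apply Reach_subset subset_rfl
        rintro u v hu ⟨e, he, -, h⟩
        rcases h with h | h
        · exact absurd hu (by simpa [h] using (hA e he).1)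
        · exact absurd hu (by simpa [h] using (hA e he).2)
      have hc : ∀ ω, (∀ e, e ∉ F → ω e = ω₀ e) → f ω = f ω₀ := by
        intro ω h
        refine hf ω ω₀ (fun e he ht => ?_) h
        simp only [Touched, mem_ofPred_eq, hR] at ht
        exact absurd ht (not_or.2 (hA e he))
      rw [Ex_mul_left F g hc, Ex_congr F (g := fun _ => f ω₀) hc, Ex_const, sub_self, abs_zero]
      exact Finset.sum_nonneg fun e _ => mul_nonneg
        (Ex_nonneg hp F (fun ω => (ind_mem_Icc _ ω).1) _) (Inn e)

end OSSS

/-- Vertices of the triangular lattice in integer coordinates. -/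
abbrev Vtx := ℤ × ℤ
/-- Faces of the triangular lattice: `(a, b, true)` has corners `(a,b), (a+1,b), (a,b+1)`
and `(a, b, false)` has corners `(a+1,b), (a,b+1), (a+1,b+1)`. -/
abbrev Face := ℤ × ℤ × Bool

/-- Endpoints of an edge. -/
def te (e : TriE) : Vtx × Vtx :=
  if e.2.2 = 0 then ((e.1, e.2.1), (e.1 + 1, e.2.1))
  else if e.2.2 = 1 then ((e.1 + 1, e.2.1), (e.1, e.2.1 + 1))
  else ((e.1, e.2.1), (e.1, e.2.1 + 1))

/-- The two faces adjacent to an edge. -/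
def fe (e : TriE) : Face × Face :=
  if e.2.2 = 0 then ((e.1, e.2.1, true), (e.1, e.2.1 - 1, false))
  else if e.2.2 = 1 then ((e.1, e.2.1, true), (e.1, e.2.1, false))
  else ((e.1, e.2.1, true), (e.1 - 1, e.2.1, false))

@[simp] lemma te_zero (a b : ℤ) : te (a, b, 0) = ((a, b), (a + 1, b)) := rfl
@[simp] lemma te_one (a b : ℤ) : te (a, b, 1) = ((a + 1, b), (a, b + 1)) := rfl
@[simp] lemma te_two (a b : ℤ) : te (a, b, 2) = ((a, b), (a, b + 1)) := rfl
@[simp] lemma fe_zero (a b : ℤ) : fe (a, b, 0) = ((a, b, true), (a, b - 1, false)) := rfl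
@[simp] lemma fe_one (a b : ℤ) : fe (a, b, 1) = ((a, b, true), (a, b, false)) := rfl
@[simp] lemma fe_two (a b : ℤ) : fe (a, b, 2) = ((a, b, true), (a - 1, b, false)) := rfl

lemma TriE.cases {motive : TriE → Prop} (h0 : ∀ a b, motive (a, b, 0))
    (h1 : ∀ a b, motive (a, b, 1)) (h2 : ∀ a b, motive (a, b, 2)) (e : TriE) : motive e := by
  obtain ⟨a, b, i⟩ := e
  fin_cases i
  exacts [h0 a b, h1 a b, h2 a b]

/-- Adjacency through an open edge. -/
def TA (ω : Config TriE) (u v : Vtx) : Prop := ∃ e, ω e = true ∧ (te e = (u, v) ∨ te e = (v, u))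

/-- Adjacency of faces through a closed edge. -/
def DA (ω : Config TriE) (F G : Face) : Prop := ∃ e, ω e = false ∧ (fe e = (F, G) ∨ fe e = (G, F))

lemma TA.symm {ω : Config TriE} {u v : Vtx} (h : TA ω u v) : TA ω v u := by
  obtain ⟨e, h1, h2⟩ := h; exact ⟨e, h1, h2.symm⟩

lemma DA.symm {ω : Config TriE} {u v : Face} (h : DA ω u v) : DA ω v u := by
  obtain ⟨e, h1, h2⟩ := h; exact ⟨e, h1, h2.symm⟩

section Paths

variable {V W : Type} {R : V → V → Prop} {S T : Set V} {u v w : V}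

/-- `u` and `v` are joined by an `R`-path with all vertices in `S`. -/
def PathIn (R : V → V → Prop) (S : Set V) (u v : V) : Prop :=
  u ∈ S ∧ Relation.ReflTransGen (fun x y => R x y ∧ y ∈ S) u v

lemma PathIn.refl (h : u ∈ S) : PathIn R S u u := ⟨h, .refl⟩

lemma PathIn.right_mem (h : PathIn R S u v) : v ∈ S := by
  obtain ⟨h, h'⟩ := h
  cases h' with
  | refl => exact h
  | tail _ h2 => exact h2.2

lemma PathIn.step (h : PathIn R S u v) (hvw : R v w) (hw : w ∈ S) : PathIn R S u w :=
  ⟨h.1, h.2.tail ⟨hvw, hw⟩⟩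

lemma PathIn.trans (h : PathIn R S u v) (h' : PathIn R S v w) : PathIn R S u w :=
  ⟨h.1, h.2.trans h'.2⟩

@[elab_as_elim]
lemma PathIn.ind {motive : ∀ v, PathIn R S u v → Prop} (base : ∀ h, motive u (.refl h))
    (step : ∀ x y (h : PathIn R S u x) (hxy : R x y) (hy : y ∈ S), motive x h →
      motive y (h.step hxy hy)) {v : V} (h : PathIn R S u v) : motive v h := by
  obtain ⟨hu, h'⟩ := h
  induction h' with
  | refl => exact base hu
  | tail h3 h4 ih => exact step _ _ ⟨hu, h3⟩ h4.1 h4.2 ih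

lemma PathIn.symm (hR : ∀ x y, R x y → R y x) (h : PathIn R S u v) : PathIn R S v u := by
  induction h using PathIn.ind with
  | base h => exact .refl h
  | step x y hx hxy hy ih => exact ((PathIn.refl hy).step (hR _ _ hxy) hx.right_mem).trans ih

lemma PathIn.map {R' : W → W → Prop} {T : Set W} (f : V → W)
    (hR : ∀ x y, x ∈ S → y ∈ S → R x y → R' (f x) (f y)) (hS : ∀ x ∈ S, f x ∈ T)
    (h : PathIn R S u v) : PathIn R' T (f u) (f v) := by
  induction h using PathIn.ind with
  | base h => exact .refl (hS _ h)
  | step x y hx hxy hy ih => exact ih.step (hR _ _ hx.right_mem hy hxy) (hS _ hy)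

lemma PathIn.mono (hST : S ⊆ T) (h : PathIn R S u v) : PathIn R T u v :=
  h.map id (fun _ _ _ _ h => h) hST

/-- A path leaving `T` has a first exit. -/
lemma PathIn.exists_exit (h : PathIn R S u v) (hu : u ∈ T) (hv : v ∉ T) :
    ∃ x y, PathIn R (S ∩ T) u x ∧ R x y ∧ y ∈ S ∧ y ∉ T := by
  have : PathIn R (S ∩ T) u v ∨ ∃ x y, PathIn R (S ∩ T) u x ∧ R x y ∧ y ∈ S ∧ y ∉ T := by
    clear hv
    induction h using PathIn.ind with
    | base h => exact .inl (.refl ⟨h, hu⟩)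
    | step x y hx hxy hy ih =>
      rcases ih with ih | ih
      · by_cases hyT : y ∈ T
        · exact .inl (ih.step hxy ⟨hy, hyT⟩)
        · exact .inr ⟨x, y, ih, hxy, hy, hyT⟩
      · exact .inr ih
  rcases this with h | h
  · exact absurd h.right_mem.2 hv
  · exact h

end Paths

/-- Connection by open edges. -/
abbrev Conn (ω : Config TriE) : Vtx → Vtx → Prop := PathIn (TA ω) univ

lemma Conn.symm' {ω : Config TriE} {u v : Vtx} (h : Conn ω u v) : Conn ω v u :=
  h.symm fun _ _ => TA.symm

lemma PathIn.conn {ω : Config TriE} {S : Set Vtx} {u v : Vtx} (h : PathIn (TA ω) S u v) :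
    Conn ω u v := h.mono (subset_univ _)

section Blocking

/-- Number (mod 2) of edges `e` crossed by the upward vertical ray from a face `F`. -/
def rayPar (F : Face) (e : TriE) : ZMod 2 :=
  if e.1 = F.1 ∧ ((e.2.2 = 0 ∧ F.2.1 + 1 ≤ e.2.1) ∨
    (e.2.2 = 1 ∧ F.2.1 ≤ e.2.1 ∧ (F.2.2 = false → F.2.1 + 1 ≤ e.2.1))) then 1 else 0

lemma rayPar_spec {ω : Config TriE} {y0 y1 : ℤ} {e : TriE} (heo : ω e = true)
    (h1 : (te e).1 ∈ {z : Vtx | y0 ≤ z.2 ∧ z.2 ≤ y1})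
    (h2 : (te e).2 ∈ {z : Vtx | y0 ≤ z.2 ∧ z.2 ≤ y1}) :
    (∀ e', ω e' = false → e'.2.2 ≠ 2 → rayPar (fe e').1 e = rayPar (fe e').2 e) ∧
    (∀ a b, ω (a, b, 2) = false → rayPar (a, b, true) e + rayPar (a - 1, b, false) e =
      (if (te e).1.1 = a ∧ b + 1 ≤ (te e).1.2 then 1 else 0) +
      (if (te e).2.1 = a ∧ b + 1 ≤ (te e).2.2 then 1 else 0)) ∧
    (∀ F : Face, y1 ≤ F.2.1 → rayPar F e = 0) ∧
    (∀ F : Face, F.2.1 ≤ y0 - 1 → rayPar F e =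
      (if (te e).1.1 ≤ F.1 then 1 else 0) + (if (te e).2.1 ≤ F.1 then 1 else 0)) := by
  have two : (1 : ZMod 2) + 1 = 0 := by decide
  refine ⟨fun e' he' => ?_, fun a b hab => ?_, fun F hF => ?_, fun F hF => ?_⟩
  · have hne : e' ≠ e := fun h => by simp [h, heo] at he'
    induction e using TriE.cases <;> induction e' using TriE.cases <;>
      simp [rayPar] at hne ⊢ <;> congr 1 <;> grind
  · have hne : ((a, b, 2) : TriE) ≠ e := fun h => by simp [h, heo] at hab
    induction e using TriE.cases <;> simp [rayPar] at hne ⊢ <;> grind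
  · induction e using TriE.cases <;> simp [rayPar] at h1 h2 ⊢ <;> grind
  · induction e using TriE.cases <;> simp [rayPar] at h1 h2 ⊢ <;> grind

lemma exists_parity {ω : Config TriE} {y0 y1 : ℤ} {u w : Vtx}
    (h : PathIn (TA ω) {z | y0 ≤ z.2 ∧ z.2 ≤ y1} u w) :
    ∃ c : Face → ZMod 2,
      (∀ e, ω e = false → e.2.2 ≠ 2 → c (fe e).1 = c (fe e).2) ∧
      (∀ a b, ω (a, b, 2) = false → c (a, b, true) + c (a - 1, b, false) =
        (if u.1 = a ∧ b + 1 ≤ u.2 then 1 else 0) + (if w.1 = a ∧ b + 1 ≤ w.2 then 1 else 0)) ∧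
      (∀ F : Face, y1 ≤ F.2.1 → c F = 0) ∧
      (∀ F : Face, F.2.1 ≤ y0 - 1 →
        c F = (if u.1 ≤ F.1 then 1 else 0) + (if w.1 ≤ F.1 then 1 else 0)) := by
  have two : ∀ x : ZMod 2, x + x = 0 := by decide
  induction h using PathIn.ind with
  | base h => exact ⟨fun _ => 0, by simp, by simp [two], by simp, by simp [two]⟩
  | step x y hx hxy hy ih =>
    obtain ⟨c, c1, c2, c3, c4⟩ := ih
    obtain ⟨e, heo, hends⟩ := hxy
    have hxS := hx.right_mem
    have key : (∀ e', ω e' = false → e'.2.2 ≠ 2 → rayPar (fe e').1 e = rayPar (fe e').2 e) ∧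
        (∀ a b, ω (a, b, 2) = false → rayPar (a, b, true) e + rayPar (a - 1, b, false) e =
          (if x.1 = a ∧ b + 1 ≤ x.2 then 1 else 0) + (if y.1 = a ∧ b + 1 ≤ y.2 then 1 else 0)) ∧
        (∀ F : Face, y1 ≤ F.2.1 → rayPar F e = 0) ∧
        (∀ F : Face, F.2.1 ≤ y0 - 1 → rayPar F e =
          (if x.1 ≤ F.1 then 1 else 0) + (if y.1 ≤ F.1 then 1 else 0)) := by
      rcases hends with h | h
      · simpa only [h] using rayPar_spec heo (by rwa [h]) (by rwa [h])
      · have := rayPar_spec heo (y0 := y0) (y1 := y1) (by rwa [h]) (by rwa [h])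
        simp only [h] at this
        refine ⟨this.1, fun a b hab => ?_, this.2.2.1, fun F hF => ?_⟩
        · rw [this.2.1 a b hab, add_comm]
        · rw [this.2.2.2 F hF, add_comm]
    obtain ⟨k1, k2, k3, k4⟩ := key
    have arith : ∀ c d r s p q q' : ZMod 2, c + d = p + q → r + s = q + q' →
        c + r + (d + s) = p + q' := by decide
    have arith' : ∀ c r p q q' : ZMod 2, c = p + q → r = q + q' → c + r = p + q' := by decide
    refine ⟨fun F => c F + rayPar F e, fun e' h h' => ?_, fun a b h => ?_, fun F h => ?_,
      fun F h => ?_⟩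
    · simp only [c1 e' h h', k1 e' h h']
    · exact arith _ _ _ _ _ _ _ (c2 a b h) (k2 a b h)
    · simp [c3 F h, k3 F h]
    · exact arith' _ _ _ _ _ (c4 F h) (k4 F h)

/-- A horizontal open crossing of a strip blocks vertical closed dual crossings. -/
theorem not_dual_cross {ω : Config TriE} {y0 y1 x0 x1 : ℤ} {u w : Vtx}
    (h : PathIn (TA ω) {z | y0 ≤ z.2 ∧ z.2 ≤ y1} u w) (hu : u.1 ≤ x0) (hw : x1 ≤ w.1)
    {F G : Face} (hFG : PathIn (DA ω) {H | x0 ≤ H.1 ∧ H.1 ≤ x1 - 1} F G)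
    (hF : F.2.1 ≤ y0 - 1) (hG : y1 ≤ G.2.1) : False := by
  obtain ⟨c, c1, c2, c3, c4⟩ := exists_parity h
  have inv : c F = c G := by
    clear hG
    induction hFG using PathIn.ind with
    | base h => rfl
    | step x y hx hxy hy ih =>
      rw [ih]
      have hxS := hx.right_mem
      obtain ⟨e, hec, hends⟩ := hxy
      have : c (fe e).1 = c (fe e).2 := by
        by_cases he : e.2.2 = 2
        · obtain ⟨a, b, i⟩ := e
          obtain rfl : i = 2 := he
          have h2 := c2 a b hec
          have ha : x0 < a ∧ a < x1 := by
            rcases hends with h | h <;> simp at h <;>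
              simp [← h.1, ← h.2] at hxS hy <;> omega
          rw [if_neg (by omega), if_neg (by omega), add_zero] at h2
          have : ∀ x y : ZMod 2, x + y = 0 → x = y := by decide
          exact this _ _ h2
        · exact c1 e hec he
      rcases hends with h | h <;> rw [h] at this
      exacts [this, this.symm]
  have hFm := hFG.1
  simp only [mem_ofPred_eq] at hFm
  rw [c3 G hG, c4 F hF, if_pos (by omega), if_neg (by omega)] at inv
  simp at inv

/-- A horizontal open crossing and a vertical open crossing meet. -/
theorem cross_meet {ω : Config TriE} {y0 y1 x0 x1 : ℤ} {u w s t : Vtx}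
    (h : PathIn (TA ω) {z | y0 ≤ z.2 ∧ z.2 ≤ y1} u w) (hu : u.1 ≤ x0) (hw : x1 ≤ w.1)
    (hst : PathIn (TA ω) {z | x0 + 1 ≤ z.1 ∧ z.1 ≤ x1 - 1} s t)
    (hs : s.2 ≤ y0 - 1) (ht : y1 + 1 ≤ t.2) : Conn ω u s := by
  classical
  by_contra hcon
  set ω' : Config TriE := fun e => decide (ω e = true ∧ Conn ω u (te e).1) with hω'
  have hπ : PathIn (TA ω') {z | y0 ≤ z.2 ∧ z.2 ≤ y1} u w := by
    clear hw
    induction h using PathIn.ind with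
    | base h => exact .refl h
    | step x y hx hxy hy ih =>
      obtain ⟨e, heo, hends⟩ := hxy
      refine ih.step ⟨e, ?_, hends⟩ hy
      simp only [hω', decide_eq_true_eq]
      refine ⟨heo, ?_⟩
      rcases hends with h | h
      · rw [h]; exact hx.conn
      · rw [h]; exact hx.conn.step ⟨e, heo, .inr h⟩ trivial
  have hρ : ∀ z, Conn ω s z → ¬ Conn ω u z := fun z hz hz' => hcon (hz'.trans hz.symm')
  have hcl : ∀ e z, Conn ω s z → ((te e).1 = z ∨ (te e).2 = z) → ω' e = false := by
    intro e z hz hez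
    simp only [hω', decide_eq_false_iff_not, not_and]
    rintro heo hue
    rcases hez with rfl | rfl
    · exact hρ _ hz hue
    · exact hρ _ hz (hue.step ⟨e, heo, .inl rfl⟩ trivial)
  have hd : PathIn (DA ω') {H | x0 ≤ H.1 ∧ H.1 ≤ x1 - 1} (s.1, s.2, true) (t.1, t.2, true) := by
    clear ht
    induction hst using PathIn.ind with
    | base h => exact .refl (by simp at h ⊢; omega)
    | step x y hx hxy hy ih =>
      have hxS := hx.right_mem
      have cx := fun e => hcl e x hx.conn
      have cy := fun e => hcl e y (hx.step hxy hy).conn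
      have tri : ∀ z z' : Vtx, z ∈ {z : Vtx | x0 + 1 ≤ z.1 ∧ z.1 ≤ x1 - 1} →
          z' ∈ {z : Vtx | x0 + 1 ≤ z.1 ∧ z.1 ≤ x1 - 1} →
          (∀ e, (te e).1 = z ∨ (te e).2 = z → ω' e = false) →
          (∀ e, (te e).1 = z' ∨ (te e).2 = z' → ω' e = false) → (∃ e, te e = (z, z')) →
          PathIn (DA ω') {H | x0 ≤ H.1 ∧ H.1 ≤ x1 - 1} (z.1, z.2, true) (z'.1, z'.2, true) := by
        rintro z z' hz hz' c c' ⟨e, he⟩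
        induction e using TriE.cases with
        | h0 a b =>
          obtain ⟨rfl, rfl⟩ := Prod.mk.inj he
          simp only [mem_ofPred_eq] at hz hz'
          refine ((PathIn.refl (by simp; omega)).step (v := (a, b, true)) (w := (a, b, false))
            ⟨(a, b, 1), c' _ (by simp), by simp⟩ (by simp; omega)).step
            ⟨(a + 1, b, 2), c' _ (by simp), by simp⟩ (by simp; omega)
        | h1 a b =>
          obtain ⟨rfl, rfl⟩ := Prod.mk.inj he
          simp only [mem_ofPred_eq] at hz hz'
          refine ((PathIn.refl (by simp; omega)).step (v := (a + 1, b, true)) (w := (a, b, false))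
            ⟨(a + 1, b, 2), c _ (by simp), by simp⟩ (by simp; omega)).step
            ⟨(a, b + 1, 0), c' _ (by simp), by simp⟩ (by simp; omega)
        | h2 a b =>
          obtain ⟨rfl, rfl⟩ := Prod.mk.inj he
          simp only [mem_ofPred_eq] at hz hz'
          refine ((PathIn.refl (by simp; omega)).step (v := (a, b, true)) (w := (a, b, false))
            ⟨(a, b, 1), c' _ (by simp), by simp⟩ (by simp; omega)).step
            ⟨(a, b + 1, 0), c' _ (by simp), by simp⟩ (by simp; omega)
      refine ih.trans ?_
      obtain ⟨e, -, h | h⟩ := hxy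
      · exact tri x y hxS hy cx cy ⟨e, h⟩
      · exact (tri y x hy hxS cy cx ⟨e, h⟩).symm fun _ _ => DA.symm
  exact not_dual_cross hπ hu hw hd hs (by simp; omega)

end Blocking

section Swap

/-- The reflection exchanging the two coordinates, on edges. -/
def se (e : TriE) : TriE := (e.2.1, e.1, 2 - e.2.2)

/-- The reflection exchanging the two coordinates, on faces. -/
def sf (F : Face) : Face := (F.2.1, F.1, F.2.2)

lemma TA_swap {ω : Config TriE} {u v : Vtx} (h : TA ω u v) :
    TA (ω ∘ se) u.swap v.swap := by
  obtain ⟨e, h1, h2⟩ := h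
  refine ⟨se e, ?_, ?_⟩
  · induction e using TriE.cases <;> simpa [se] using h1
  · induction e using TriE.cases <;> rcases h2 with h | h <;>
      (obtain ⟨rfl, rfl⟩ := Prod.mk.inj h; simp [se])

lemma DA_swap {ω : Config TriE} {F G : Face} (h : DA ω F G) :
    DA (ω ∘ se) (sf F) (sf G) := by
  obtain ⟨e, h1, h2⟩ := h
  refine ⟨se e, ?_, ?_⟩
  · induction e using TriE.cases <;> simpa [se] using h1
  · induction e using TriE.cases <;> rcases h2 with h | h <;>
      (obtain ⟨rfl, rfl⟩ := Prod.mk.inj h; simp [se, sf])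

lemma se_se (e : TriE) : se (se e) = e := by
  induction e using TriE.cases <;> simp [se]

lemma comp_se_se (ω : Config TriE) : (ω ∘ se) ∘ se = ω := by
  funext e; simp [se_se]

/-- A vertical open crossing of a strip blocks horizontal closed dual crossings. -/
theorem not_dual_cross' {ω : Config TriE} {y0 y1 x0 x1 : ℤ} {u w : Vtx}
    (h : PathIn (TA ω) {z | x0 ≤ z.1 ∧ z.1 ≤ x1} u w) (hu : u.2 ≤ y0) (hw : y1 ≤ w.2)
    {F G : Face} (hFG : PathIn (DA ω) {H | y0 ≤ H.2.1 ∧ H.2.1 ≤ y1 - 1} F G)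
    (hF : F.1 ≤ x0 - 1) (hG : x1 ≤ G.1) : False :=
  not_dual_cross (ω := ω ∘ se) (h.map Prod.swap (fun _ _ _ _ => TA_swap) fun _ h => h) hu hw
    (hFG.map sf (fun _ _ _ _ => DA_swap) fun _ h => h) hF hG

/-- A vertical open crossing and a horizontal open crossing meet. -/
theorem cross_meet' {ω : Config TriE} {y0 y1 x0 x1 : ℤ} {u w s t : Vtx}
    (h : PathIn (TA ω) {z | x0 ≤ z.1 ∧ z.1 ≤ x1} u w) (hu : u.2 ≤ y0) (hw : y1 ≤ w.2)
    (hst : PathIn (TA ω) {z | y0 + 1 ≤ z.2 ∧ z.2 ≤ y1 - 1} s t)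
    (hs : s.1 ≤ x0 - 1) (ht : x1 + 1 ≤ t.1) : Conn ω u s := by
  have := cross_meet (ω := ω ∘ se) (h.map Prod.swap (fun _ _ _ _ => TA_swap) fun _ h => h) hu hw
    (hst.map Prod.swap (fun _ _ _ _ => TA_swap) fun _ h => h) hs ht
  have := this.map (T := univ) Prod.swap (fun _ _ _ _ => TA_swap) fun _ _ => trivial
  rw [comp_se_se] at this
  simpa using this

end Swap

section Rings

/-- Sup-distance in integer coordinates. -/
def dV (v z : Vtx) : ℤ := max (max (z.1 - v.1) (v.1 - z.1)) (max (z.2 - v.2) (v.2 - z.2))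

/-- Sup-distance of a face to a point, in integer coordinates. -/
def dF (v : Vtx) (F : Face) : ℤ := dV v (F.1, F.2.1)

lemma dV_step {ω : Config TriE} {v x y : Vtx} (h : TA ω x y) : dV v y ≤ dV v x + 1 := by
  obtain ⟨e, -, h2⟩ := h
  induction e using TriE.cases <;> rcases h2 with h | h <;>
      (obtain ⟨rfl, rfl⟩ := Prod.mk.inj h; simp only [dV]; omega)

lemma dF_fe (v : Vtx) (e : TriE) : dF v (fe e).1 ≤ dF v (fe e).2 + 1 ∧
    dF v (fe e).2 ≤ dF v (fe e).1 + 1 := by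
  induction e using TriE.cases <;> simp only [dF, dV, fe_zero, fe_one, fe_two] <;> omega

lemma dF_step {ω : Config TriE} {v : Vtx} {x y : Face} (h : DA ω x y) :
    dF v y ≤ dF v x + 1 := by
  obtain ⟨e, -, h2⟩ := h
  have := dF_fe v e
  rcases h2 with h | h <;> rw [h] at this
  exacts [this.2, this.1]

/-- A horizontal crossing, at scale `n`. -/
def HCross (ω : Config TriE) (x y n : ℤ) : Prop :=
  ∃ u w, PathIn (TA ω) {z | (y ≤ z.2 ∧ z.2 ≤ y + n) ∧ x - 5 * n ≤ z.1 ∧ z.1 ≤ x + 10 * n} u w ∧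
    u.1 ≤ x ∧ x + 5 * n ≤ w.1

/-- A vertical crossing, at scale `n`. -/
def VCross (ω : Config TriE) (x y n : ℤ) : Prop :=
  ∃ u w, PathIn (TA ω) {z | (x ≤ z.1 ∧ z.1 ≤ x + n) ∧ y - 5 * n ≤ z.2 ∧ z.2 ≤ y + 10 * n} u w ∧
    u.2 ≤ y ∧ y + 5 * n ≤ w.2

/-- Four crossings surrounding `v` at scale `n`. -/
def Ring (ω : Config TriE) (v : Vtx) (n : ℤ) : Prop :=
  (HCross ω (v.1 - 2 * n - 2) (v.2 + n) n ∧ HCross ω (v.1 - 2 * n - 2) (v.2 - 2 * n) n) ∧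
  VCross ω (v.1 + n) (v.2 - 2 * n - 2) n ∧ VCross ω (v.1 - 2 * n) (v.2 - 2 * n - 2) n

lemma ring_blocks {ω : Config TriE} {v : Vtx} {n : ℤ} (hn : 4 ≤ n) (hr : Ring ω v n) {F G : Face}
    (h : PathIn (DA ω) univ F G) (hF : dF v F < n) (hG : 2 * n < dF v G) : False := by
  obtain ⟨x, y, hxy, hst, -, hy⟩ := h.exists_exit (T := {H | dF v H ≤ 2 * n})
    (by simp; omega) (by simp; omega)
  have hx := hxy.right_mem.2
  have hy' := dF_step (v := v) hst
  simp only [mem_ofPred_eq, not_le] at hx hy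
  have hp : PathIn (DA ω) {H | dF v H ≤ 2 * n + 1} F y :=
    (hxy.mono fun z hz => by have := hz.2; simp at this ⊢; omega).step hst (by simp; omega)
  have hq := hp.symm fun _ _ => DA.symm
  obtain ⟨⟨⟨u1, w1, p1, a1, b1⟩, ⟨u2, w2, p2, a2, b2⟩⟩, ⟨u3, w3, p3, a3, b3⟩,
    ⟨u4, w4, p4, a4, b4⟩⟩ := hr
  have hcase : v.2 + 2 * n ≤ y.2.1 ∨ y.2.1 ≤ v.2 - 2 * n - 1 ∨ v.1 + 2 * n ≤ y.1 ∨
    y.1 ≤ v.1 - 2 * n - 1 := by simp only [dF, dV] at hy; omega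
  have hsub : {H : Face | dF v H ≤ 2 * n + 1} ⊆
      {H | v.1 - 2 * n - 2 ≤ H.1 ∧ H.1 ≤ v.1 + 2 * n + 2 - 1} := by
    intro H hH; simp only [dF, dV, mem_ofPred_eq] at hH ⊢; omega
  have hsub' : {H : Face | dF v H ≤ 2 * n + 1} ⊆
      {H | v.2 - 2 * n - 2 ≤ H.2.1 ∧ H.2.1 ≤ v.2 + 2 * n + 2 - 1} := by
    intro H hH; simp only [dF, dV, mem_ofPred_eq] at hH ⊢; omega
  simp only [dF, dV] at hF
  rcases hcase with h | h | h | h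
  · exact not_dual_cross (p1.mono fun _ h => h.1) a1 (by omega) (hp.mono hsub) (by omega) (by omega)
  · exact not_dual_cross (p2.mono fun _ h => h.1) a2 (by omega) (hq.mono hsub) (by omega) (by omega)
  · exact not_dual_cross' (p3.mono fun _ h => h.1) a3 (by omega) (hp.mono hsub') (by omega)
      (by omega)
  · exact not_dual_cross' (p4.mono fun _ h => h.1) a4 (by omega) (hq.mono hsub') (by omega)
      (by omega)

/-- All open paths crossing the annulus of a ring are in the same cluster. -/
lemma ring_meets {ω : Config TriE} {v : Vtx} {n : ℤ} (hn : 4 ≤ n) (hr : Ring ω v n) :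
    ∃ r, ∀ s t, Conn ω s t → dV v s < n → 2 * n < dV v t → Conn ω r s := by
  obtain ⟨⟨⟨u1, w1, p1, a1, b1⟩, ⟨u2, w2, p2, a2, b2⟩⟩, ⟨u3, w3, p3, a3, b3⟩,
    ⟨u4, w4, p4, a4, b4⟩⟩ := hr
  have q3 : PathIn (TA ω) {z | v.1 - 2 * n - 2 + 1 ≤ z.1 ∧ z.1 ≤ v.1 + 2 * n + 2 - 1} u3 w3 :=
    p3.mono fun z hz => by simp only [mem_ofPred_eq] at hz ⊢; omega
  have q4 : PathIn (TA ω) {z | v.1 - 2 * n - 2 + 1 ≤ z.1 ∧ z.1 ≤ v.1 + 2 * n + 2 - 1} u4 w4 :=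
    p4.mono fun z hz => by simp only [mem_ofPred_eq] at hz ⊢; omega
  have c13 : Conn ω u1 u3 := cross_meet (p1.mono fun _ h => h.1) a1 (by omega) q3 (by omega)
    (by omega)
  have c23 : Conn ω u2 u3 := cross_meet (p2.mono fun _ h => h.1) a2 (by omega) q3 (by omega)
    (by omega)
  have c14 : Conn ω u1 u4 := cross_meet (p1.mono fun _ h => h.1) a1 (by omega) q4 (by omega)
    (by omega)
  refine ⟨u1, fun s t h hs ht => ?_⟩
  obtain ⟨x, y, hxy, hst, -, hy⟩ := h.exists_exit (T := {H | dV v H ≤ 2 * n})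
    (by simp; omega) (by simp; omega)
  have hx := hxy.right_mem.2
  have hy' := dV_step (v := v) hst
  simp only [mem_ofPred_eq, not_le] at hx hy
  have hp : PathIn (TA ω) {H | dV v H ≤ 2 * n + 1} s y :=
    (hxy.mono fun z hz => by have := hz.2; simp at this ⊢; omega).step hst (by simp; omega)
  have hq := hp.symm fun _ _ => TA.symm
  have hcase : v.2 + 2 * n + 1 ≤ y.2 ∨ y.2 ≤ v.2 - 2 * n - 1 ∨ v.1 + 2 * n + 1 ≤ y.1 ∨
    y.1 ≤ v.1 - 2 * n - 1 := by simp only [dV] at hy; omega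
  have hsub : {H : Vtx | dV v H ≤ 2 * n + 1} ⊆
      {H | v.1 - 2 * n - 2 + 1 ≤ H.1 ∧ H.1 ≤ v.1 + 2 * n + 2 - 1} := by
    intro H hH; simp only [dV, mem_ofPred_eq] at hH ⊢; omega
  have hsub' : {H : Vtx | dV v H ≤ 2 * n + 1} ⊆
      {H | v.2 - 2 * n - 2 + 1 ≤ H.2 ∧ H.2 ≤ v.2 + 2 * n + 2 - 1} := by
    intro H hH; simp only [dV, mem_ofPred_eq] at hH ⊢; omega
  simp only [dV] at hs
  rcases hcase with h | h | h | h
  · exact cross_meet (p1.mono fun _ h => h.1) a1 (by omega) (hp.mono hsub) (by omega) (by omega)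
  · exact (c13.trans c23.symm').trans ((cross_meet (p2.mono fun _ h => h.1) a2 (by omega)
      (hq.mono hsub) (by omega) (by omega)).trans hq.conn)
  · exact c13.trans (cross_meet' (p3.mono fun _ h => h.1) a3 (by omega) (hp.mono hsub') (by omega)
      (by omega))
  · exact c14.trans ((cross_meet' (p4.mono fun _ h => h.1) a4 (by omega) (hq.mono hsub') (by omega)
      (by omega)).trans hq.conn)

end Rings

section Peierls

/-- An even subgraph of the dual lattice has an even number of edges crossing any row. -/
lemma finsum_row_eq_zero {d : TriE → ZMod 2} (hd : d.support.Finite)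
    (hup : ∀ a b, d (a, b, 0) + d (a, b, 1) + d (a, b, 2) = 0)
    (hdn : ∀ a b, d (a, b, 1) + d (a, b + 1, 0) + d (a + 1, b, 2) = 0) (b : ℤ) :
    ∑ᶠ a, d (a, b, 0) = 0 := by
  have fin : ∀ b i, (Function.support fun a => d (a, b, i)).Finite := fun b i =>
    (hd.preimage (f := fun a : ℤ => ((a, b, i) : TriE)) (by
      intro x _ y _ h; exact (Prod.mk.inj h).1)).subset fun a h => h
  have fin' : ∀ b i, (Function.support fun a => d (a + 1, b, i)).Finite := fun b i =>
    (hd.preimage (f := fun a : ℤ => ((a + 1, b, i) : TriE)) (by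
      intro x _ y _ h; have := (Prod.mk.inj h).1; omega)).subset fun a h => h
  have shift : ∀ b i, ∑ᶠ a, d (a + 1, b, i) = ∑ᶠ a, d (a, b, i) := fun b i =>
    finsum_comp_equiv (Equiv.addRight (1 : ℤ)) (f := fun a => d (a, b, i))
  have stp : ∀ b, ∑ᶠ a, d (a, b, 0) = ∑ᶠ a, d (a, b + 1, 0) := by
    intro b
    have h1 : ∑ᶠ a, (d (a, b, 0) + d (a, b, 1) + d (a, b, 2)) = 0 := by simp [hup]
    have h2 : ∑ᶠ a, (d (a, b, 1) + d (a, b + 1, 0) + d (a + 1, b, 2)) = 0 := by simp [hdn]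
    have s1 := (fin b 0).union (fin b 1)
    have s2 := (fin b 1).union (fin (b + 1) 0)
    rw [finsum_add_distrib (s1.subset (Function.support_add _ _)) (fin b 2),
      finsum_add_distrib (fin b 0) (fin b 1)] at h1
    rw [finsum_add_distrib (s2.subset (Function.support_add _ _)) (fin' b 2),
      finsum_add_distrib (fin b 1) (fin (b + 1) 0), shift] at h2
    have : ∀ x y z w : ZMod 2, x + y + z = 0 → y + w + z = 0 → x = w := by decide
    exact this _ _ _ _ h1 h2
  have stp' : ∀ k : ℕ, ∑ᶠ a, d (a, b, 0) = ∑ᶠ a, d (a, b + k, 0) := by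
    intro k
    induction k with
    | zero => simp
    | succ k ih => rw [ih, stp]; push_cast; rw [add_assoc]
  obtain ⟨B, hB⟩ := (hd.image (fun e : TriE => e.2.1)).bddAbove
  rw [stp' (B + 1 - b).toNat]
  apply finsum_eq_zero_of_forall_eq_zero
  intro a
  by_contra h
  have := hB ⟨_, h, rfl⟩
  simp only at this
  omega

/-- If a finite union of clusters contains a long segment, then some long closed dual path
starts from a face adjacent to the ray extending the segment. -/
theorem peierls {ω : Config TriE} {v : Vtx} {M : ℕ} {C : Set Vtx} (hfin : C.Finite)
    (hM : ∀ i : ℕ, i ≤ M → (v.1 + i, v.2) ∈ C)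
    (hcl : ∀ e, ω e = true → ((te e).1 ∈ C ↔ (te e).2 ∈ C)) :
    ∃ r : ℕ, M ≤ r ∧ ∃ G, PathIn (DA ω) univ (v.1 + r, v.2, true) G ∧
      r ≤ dF (v.1 + r, v.2) G := by
  classical
  set χ : Vtx → ZMod 2 := fun z => if z ∈ C then 1 else 0 with hχ
  have χ01 : ∀ z, χ z = if z ∈ C then 1 else 0 := fun z => rfl
  set δ : TriE → ZMod 2 := fun e => χ (te e).1 + χ (te e).2 with hδ
  have δcl : ∀ e, δ e ≠ 0 → ω e = false := by
    intro e he
    by_contra h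
    have := hcl e (by simpa using h)
    apply he
    simp only [hδ, hχ, this]
    split_ifs <;> decide
  obtain ⟨K, hK⟩ : ∃ K : Set Face, ∀ G, G ∈ K ↔ ∃ r : ℕ, δ (v.1 + r, v.2, 0) ≠ 0 ∧
    PathIn (DA ω) univ (v.1 + r, v.2, true) G := ⟨{G | _}, fun _ => Iff.rfl⟩
  have Kstep : ∀ F G, F ∈ K → DA ω F G → G ∈ K := by
    intro F G hF h
    obtain ⟨r, h1, h2⟩ := (hK F).1 hF
    exact (hK G).2 ⟨r, h1, h2.step h trivial⟩
  have Kiff : ∀ e, δ e ≠ 0 → ((fe e).1 ∈ K ↔ (fe e).2 ∈ K) := fun e he =>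
    ⟨fun h => Kstep _ _ h ⟨e, δcl e he, .inl rfl⟩, fun h => Kstep _ _ h ⟨e, δcl e he, .inr rfl⟩⟩
  obtain ⟨κ, κ1, κ0⟩ : ∃ κ : Face → ZMod 2, (∀ G ∈ K, κ G = 1) ∧ ∀ G ∉ K, κ G = 0 :=
    ⟨fun G => if G ∈ K then 1 else 0, fun G h => if_pos h, fun G h => if_neg h⟩
  set d : TriE → ZMod 2 := fun e => κ (fe e).1 * δ e with hd
  have d2 : ∀ e, d e = κ (fe e).2 * δ e := by
    intro e
    by_cases h : δ e = 0
    · simp [hd, h]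
    · by_cases hK' : (fe e).1 ∈ K
      · simp only [hd, κ1 _ hK', κ1 _ ((Kiff e h).1 hK')]
      · simp only [hd, κ0 _ hK', κ0 _ (fun h' => hK' ((Kiff e h).2 h'))]
  have two : ∀ x : ZMod 2, x + x = 0 := by decide
  have tri : ∀ k x y z : ZMod 2, k * (x + y) + k * (y + z) + k * (x + z) = 0 := by decide
  have hup : ∀ a b, d (a, b, 0) + d (a, b, 1) + d (a, b, 2) = 0 := by
    intro a b
    simp only [hd, fe_zero, fe_one, fe_two, hδ, te_zero, te_one, te_two]
    exact tri _ _ _ _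
  have hdn : ∀ a b, d (a, b, 1) + d (a, b + 1, 0) + d (a + 1, b, 2) = 0 := by
    intro a b
    simp only [d2, fe_zero, fe_one, fe_two, add_sub_cancel_right, hδ, te_zero, te_one, te_two]
    exact tri _ _ _ _
  have dfin : d.support.Finite := by
    have h1 : d.support ⊆ {e | (te e).1 ∈ C} ∪ {e | (te e).2 ∈ C} := by
      intro e he
      by_contra h
      simp only [mem_union, mem_ofPred_eq, not_or] at h
      apply he
      simp [hd, hδ, hχ, h.1, h.2]
    refine (Finite.union (((hfin.prod (finite_univ (α := Fin 3))).image fun z : Vtx × Fin 3 =>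
      ((z.1.1 - (if z.2 = 1 then 1 else 0), z.1.2, z.2) : TriE)).subset ?_)
      (((hfin.prod (finite_univ (α := Fin 3))).image fun z : Vtx × Fin 3 =>
      ((z.1.1 - (if z.2 = 0 then 1 else 0), z.1.2 - (if z.2 = 0 then 0 else 1), z.2) :
      TriE)).subset ?_)).subset h1
    · intro e he
      exact ⟨((te e).1, e.2.2), ⟨he, trivial⟩, by induction e using TriE.cases <;> simp⟩
    · intro e he
      exact ⟨((te e).2, e.2.2), ⟨he, trivial⟩, by induction e using TriE.cases <;> simp⟩
  have hrow := finsum_row_eq_zero dfin hup hdn v.2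
  by_contra hcon
  push Not at hcon
  have hleft : ∀ a, a < v.1 → d (a, v.2, 0) = 0 := by
    intro a ha
    simp only [hd, fe_zero]
    rw [κ0, zero_mul]
    rw [hK]
    rintro ⟨r, h1, h2⟩
    have hr : M ≤ r := by
      by_contra hr
      apply h1
      have e1 := hM r (by omega)
      have e2 := hM (r + 1) (by omega)
      simp only [hδ, te_zero]
      rw [χ01, χ01, if_pos e1, if_pos (by convert e2 using 2; push_cast; ring)]
      decide
    have := hcon r hr _ h2
    simp only [dF, dV] at this
    omega
  have hright : ∀ i : ℕ, d (v.1 + i, v.2, 0) = χ (v.1 + i, v.2) + χ (v.1 + (i + 1 : ℕ), v.2) := by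
    intro i
    have e : δ (v.1 + i, v.2, 0) = χ (v.1 + i, v.2) + χ (v.1 + (i + 1 : ℕ), v.2) := by
      simp [hδ, add_assoc]
    rw [← e]
    by_cases h : δ (v.1 + i, v.2, 0) = 0
    · simp [hd, h]
    · simp only [hd, fe_zero]
      rw [κ1 _ ((hK _).2 ⟨i, h, .refl trivial⟩), one_mul]
  obtain ⟨B, hB⟩ := (hfin.image (fun z : Vtx => z.1)).bddAbove
  have hχB : ∀ i : ℕ, B < v.1 + i → χ (v.1 + i, v.2) = 0 := by
    intro i hi
    rw [χ01, if_neg]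
    intro h
    have := hB ⟨_, h, rfl⟩
    simp only at this
    omega
  set n := (B + 1 - v.1).toNat with hn
  have hsum : ∑ᶠ a, d (a, v.2, 0) = ∑ i ∈ Finset.range n, d (v.1 + i, v.2, 0) := by
    rw [finsum_eq_sum_of_support_subset (s := (Finset.range n).image fun i : ℕ => v.1 + (i : ℤ)),
      Finset.sum_image (by intro x _ y _ h; simpa using h)]
    intro a ha
    have ha' : v.1 ≤ a := by
      by_contra h
      exact ha (hleft a (by omega))
    obtain ⟨i, rfl⟩ : ∃ i : ℕ, a = v.1 + i := ⟨(a - v.1).toNat, by omega⟩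
    simp only [Finset.coe_image, Finset.coe_range, mem_image, mem_Iio]
    refine ⟨i, ?_, rfl⟩
    by_contra h
    apply ha
    simp only
    rw [hright, hχB i (by omega), hχB (i + 1) (by push_cast; omega), add_zero]
  have htel : ∀ m : ℕ, ∑ i ∈ Finset.range m, d (v.1 + i, v.2, 0) =
      χ (v.1 + (0 : ℕ), v.2) + χ (v.1 + m, v.2) := by
    intro m
    induction m with
    | zero => simp [two]
    | succ m ih =>
      rw [Finset.sum_range_succ, ih, hright]
      have : ∀ x y z : ZMod 2, x + y + (y + z) = x + z := by decide
      exact this _ _ _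
  rw [hsum, htel, hχB n (by omega), χ01, if_pos (hM 0 (by omega))] at hrow
  simp at hrow

end Peierls

section RingEvents

lemma PathIn.of_open {ω ω' : Config TriE} {S : Set Vtx} {u v : Vtx} {F : Finset TriE}
    (hF : ∀ e, (te e).1 ∈ S → (te e).2 ∈ S → e ∈ F) (h : ∀ e ∈ F, ω e = true → ω' e = true)
    (hp : PathIn (TA ω) S u v) : PathIn (TA ω') S u v := by
  refine hp.map id (fun x y hx hy hxy => ?_) fun _ h => h
  obtain ⟨e, he, h1 | h1⟩ := hxy
  · exact ⟨e, h e (hF e (by rwa [h1]) (by rwa [h1])) he, .inl h1⟩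
  · exact ⟨e, h e (hF e (by rwa [h1]) (by rwa [h1])) he, .inr h1⟩

/-- Edges based in a rectangle. -/
noncomputable def rectE (x0 x1 y0 y1 : ℤ) : Finset TriE :=
  Finset.Icc x0 x1 ×ˢ Finset.Icc y0 y1 ×ˢ Finset.univ

lemma mem_rectE {x0 x1 y0 y1 : ℤ} {e : TriE} :
    e ∈ rectE x0 x1 y0 y1 ↔ (x0 ≤ e.1 ∧ e.1 ≤ x1) ∧ (y0 ≤ e.2.1 ∧ e.2.1 ≤ y1) := by
  simp [rectE]

lemma te_mem_rect {e : TriE} {x0 x1 y0 y1 : ℤ}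
    (h1 : (y0 ≤ (te e).1.2 ∧ (te e).1.2 ≤ y1) ∧ x0 ≤ (te e).1.1 ∧ (te e).1.1 ≤ x1)
    (h2 : (y0 ≤ (te e).2.2 ∧ (te e).2.2 ≤ y1) ∧ x0 ≤ (te e).2.1 ∧ (te e).2.1 ≤ x1) :
    e ∈ rectE x0 x1 y0 y1 := by
  rw [mem_rectE]
  induction e using TriE.cases <;> simp only [te_zero, te_one, te_two] at h1 h2 ⊢ <;> omega

lemma HCross.of_open {ω ω' : Config TriE} {x y n : ℤ}
    (h : ∀ e ∈ rectE (x - 5 * n) (x + 10 * n) y (y + n), ω e = true → ω' e = true)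
    (hc : HCross ω x y n) : HCross ω' x y n := by
  obtain ⟨u, w, h1, h2⟩ := hc
  exact ⟨u, w, h1.of_open (fun e => te_mem_rect) h, h2⟩

lemma VCross.of_open {ω ω' : Config TriE} {x y n : ℤ}
    (h : ∀ e ∈ rectE x (x + n) (y - 5 * n) (y + 10 * n), ω e = true → ω' e = true)
    (hc : VCross ω x y n) : VCross ω' x y n := by
  obtain ⟨u, w, h1, h2⟩ := hc
  exact ⟨u, w, h1.of_open (fun e h h' => te_mem_rect h.symm h'.symm) h, h2⟩

lemma supp_HCross (x y n : ℤ) :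
    Supp {ω | HCross ω x y n} (rectE (x - 5 * n) (x + 10 * n) y (y + n)) :=
  fun _ _ h hc => HCross.of_open (fun e he ho => by rw [← h e he, ho]) hc

lemma supp_VCross (x y n : ℤ) :
    Supp {ω | VCross ω x y n} (rectE x (x + n) (y - 5 * n) (y + 10 * n)) :=
  fun _ _ h hc => VCross.of_open (fun e he ho => by rw [← h e he, ho]) hc

lemma incr_HCross (x y n : ℤ) : Incr {ω | HCross ω x y n} :=
  fun _ _ h hc => HCross.of_open (fun e _ ho => by have := h e; rw [ho] at this; exact top_le_iff.1 this) hc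

lemma incr_VCross (x y n : ℤ) : Incr {ω | VCross ω x y n} :=
  fun _ _ h hc => VCross.of_open (fun e _ ho => by have := h e; rw [ho] at this; exact top_le_iff.1 this) hc

/-- Edges based in an annulus. -/
noncomputable def annE (v : Vtx) (n : ℤ) : Finset TriE :=
  (rectE (v.1 - 9 * n) (v.1 + 9 * n) (v.2 - 9 * n) (v.2 + 9 * n)).filter
    fun e => n ≤ dV v (e.1, e.2.1)

lemma supp_Ring (v : Vtx) {n : ℤ} (hn : 2 ≤ n) : Supp {ω | Ring ω v n} (annE v n) := by
  have hsub : ∀ x0 x1 y0 y1, (∀ e : TriE, (x0 ≤ e.1 ∧ e.1 ≤ x1) ∧ (y0 ≤ e.2.1 ∧ e.2.1 ≤ y1) →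
      ((v.1 - 9 * n ≤ e.1 ∧ e.1 ≤ v.1 + 9 * n) ∧ (v.2 - 9 * n ≤ e.2.1 ∧ e.2.1 ≤ v.2 + 9 * n)) ∧
      n ≤ dV v (e.1, e.2.1)) → rectE x0 x1 y0 y1 ⊆ annE v n := by
    intro x0 x1 y0 y1 h e he
    rw [mem_rectE] at he
    simpa only [annE, Finset.mem_filter, mem_rectE] using h e he
  refine Supp.inter (Supp.inter ((supp_HCross _ _ _).mono ?_) ((supp_HCross _ _ _).mono ?_))
    (Supp.inter ((supp_VCross _ _ _).mono ?_) ((supp_VCross _ _ _).mono ?_)) <;>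
  · refine hsub _ _ _ _ fun e he => ?_
    simp only [dV]
    omega

lemma incr_Ring (v : Vtx) (n : ℤ) : Incr {ω | Ring ω v n} :=
  Incr.inter (Incr.inter (incr_HCross _ _ _) (incr_HCross _ _ _))
    (Incr.inter (incr_VCross _ _ _) (incr_VCross _ _ _))

variable {p : TriE → ℝ} {P : Measure (Config TriE)}

/-- Uniform lower bound on the probabilities of crossings at large even scales. -/
def CrossBound (P : Measure (Config TriE)) (N₀ : ℤ) (δ : ℝ) : Prop :=
  ∀ m : ℤ, N₀ ≤ m → ∀ x y, ENNReal.ofReal δ ≤ P {ω | HCross ω x y (2 * m)} ∧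
    ENNReal.ofReal δ ≤ P {ω | VCross ω x y (2 * m)}

/-- Uniform lower bound on the probabilities of rings at large even scales. -/
def RingBound (P : Measure (Config TriE)) (N₀ : ℤ) (c : ℝ) : Prop :=
  ∀ m : ℤ, N₀ ≤ m → ∀ v, ENNReal.ofReal c ≤ P {ω | Ring ω v (2 * m)}

lemma CrossBound.ringBound (hp : ∀ e, p e ∈ Icc (0 : ℝ) 1) (hP : IsBernoulliProduct p P)
    {N₀ : ℤ} {δ : ℝ} (hδ : 0 ≤ δ) (h : CrossBound P N₀ δ) : RingBound P N₀ (δ ^ 4) := by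
  intro m hm v
  set n := 2 * m
  have s := fun x y => supp_HCross x y n
  set F := ((rectE (v.1 - 2 * n - 2 - 5 * n) (v.1 - 2 * n - 2 + 10 * n) (v.2 + n) (v.2 + n + n) ∪
    rectE (v.1 - 2 * n - 2 - 5 * n) (v.1 - 2 * n - 2 + 10 * n) (v.2 - 2 * n) (v.2 - 2 * n + n)) ∪
    (rectE (v.1 + n) (v.1 + n + n) (v.2 - 2 * n - 2 - 5 * n) (v.2 - 2 * n - 2 + 10 * n) ∪
    rectE (v.1 - 2 * n) (v.1 - 2 * n + n) (v.2 - 2 * n - 2 - 5 * n) (v.2 - 2 * n - 2 + 10 * n)))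
  have s1 : Supp {ω | HCross ω (v.1 - 2 * n - 2) (v.2 + n) n} F :=
    (supp_HCross _ _ _).mono (Finset.subset_union_left.trans Finset.subset_union_left)
  have s2 : Supp {ω | HCross ω (v.1 - 2 * n - 2) (v.2 - 2 * n) n} F :=
    (supp_HCross _ _ _).mono (Finset.subset_union_right.trans Finset.subset_union_left)
  have s3 : Supp {ω | VCross ω (v.1 + n) (v.2 - 2 * n - 2) n} F :=
    (supp_VCross _ _ _).mono (Finset.subset_union_left.trans Finset.subset_union_right)
  have s4 : Supp {ω | VCross ω (v.1 - 2 * n) (v.2 - 2 * n - 2) n} F :=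
    (supp_VCross _ _ _).mono (Finset.subset_union_right.trans Finset.subset_union_right)
  have i1 := incr_HCross (v.1 - 2 * n - 2) (v.2 + n) n
  have i2 := incr_HCross (v.1 - 2 * n - 2) (v.2 - 2 * n) n
  have i3 := incr_VCross (v.1 + n) (v.2 - 2 * n - 2) n
  have i4 := incr_VCross (v.1 - 2 * n) (v.2 - 2 * n - 2) n
  have h12 := prob_harris hp hP s1 s2 i1 i2
  have h34 := prob_harris hp hP s3 s4 i3 i4
  have h14 := prob_harris hp hP (s1.inter s2) (s3.inter s4) (i1.inter i2) (i3.inter i4)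
  refine le_trans ?_ h14
  refine le_trans ?_ (mul_le_mul' h12 h34)
  rw [show δ ^ 4 = (δ * δ) * (δ * δ) by ring, ENNReal.ofReal_mul (by positivity),
    ENNReal.ofReal_mul hδ]
  gcongr
  exacts [(h m hm _ _).1, (h m hm _ _).1, (h m hm _ _).2, (h m hm _ _).2]

/-- There is no ring around `v` at the scales `2 m 16 ^ j`, `j < J`. -/
def NoRing (v : Vtx) (m : ℤ) (J : ℕ) : Set (Config TriE) :=
  {ω | ∀ j < J, ¬ Ring ω v (2 * (m * 16 ^ j))}

lemma prob_noRing (hp : ∀ e, p e ∈ Icc (0 : ℝ) 1) (hP : IsBernoulliProduct p P) {N₀ m : ℤ} {c : ℝ}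
    (hc1 : c ≤ 1) (h : RingBound P N₀ c) (hm : N₀ ≤ m) (hm1 : 1 ≤ m) (v : Vtx)
    (J : ℕ) : P (NoRing v m J) ≤ ENNReal.ofReal ((1 - c) ^ J) := by
  have := hP.1
  have hpos : ∀ j : ℕ, m ≤ m * 16 ^ j := fun j => le_mul_of_one_le_right (by omega)
    (one_le_pow₀ (by norm_num))
  set F : ℕ → Finset TriE := fun J => (Finset.range J).biUnion fun j => annE v (2 * (m * 16 ^ j))
  have hs : ∀ J, Supp (NoRing v m J) (F J) := by
    intro J ω ω' hω h1 j hj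
    refine (supp_Ring v (by have := hpos j; omega)).compl ω ω' (fun e he => hω e ?_) (h1 j hj)
    exact Finset.mem_biUnion.2 ⟨j, by simpa using hj, he⟩
  induction J with
  | zero => simpa using prob_le_one
  | succ J ih =>
    have hsp : NoRing v m (J + 1) = NoRing v m J ∩ {ω | Ring ω v (2 * (m * 16 ^ J))}ᶜ := by
      ext ω
      simp only [NoRing, mem_ofPred_eq, mem_inter_iff, mem_compl_iff, Nat.forall_lt_succ_right]
    have hsR := supp_Ring v (n := 2 * (m * 16 ^ J)) (by have := hpos J; omega)
    have hdis : Disjoint (F J) (annE v (2 * (m * 16 ^ J))) := by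
      rw [Finset.disjoint_left]
      intro e he he'
      obtain ⟨j, hj, hej⟩ := Finset.mem_biUnion.1 he
      have hej' := Finset.mem_filter.1 hej
      have he'' := Finset.mem_filter.1 he'
      rw [mem_rectE] at hej' he''
      simp only [dV] at hej' he''
      have hj' : j + 1 ≤ J := by simpa using hj
      have h16 : (16 : ℤ) ^ (j + 1) ≤ 16 ^ J := pow_le_pow_right₀ (by norm_num) hj'
      have : m * 16 ^ j * 16 ≤ m * 16 ^ J := by
        rw [mul_assoc, ← pow_succ]; exact mul_le_mul_of_nonneg_left h16 (by omega)
      have := hpos j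
      omega
    rw [hsp, prob_indep hp hP (hs J) hsR.compl hdis, pow_succ,
      ENNReal.ofReal_mul (by have : 0 ≤ 1 - c := by linarith
                             positivity)]
    gcongr
    have ω : Config TriE := fun _ => true
    have hR := h (m * 16 ^ J) (by have := hpos J; omega) v
    rw [prob_eq hp hP hsR ω] at hR
    rw [prob_eq hp hP hsR.compl ω]
    have hnn := Ex_nonneg hp (annE v (2 * (m * 16 ^ J))) (fun ω =>
      (ind_mem_Icc {ω | Ring ω v (2 * (m * 16 ^ J))} ω).1) ω
    rw [ENNReal.ofReal_le_ofReal_iff hnn] at hR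
    apply ENNReal.ofReal_le_ofReal
    rw [show ind {ω | Ring ω v (2 * (m * 16 ^ J))}ᶜ = fun ω' => (fun _ => (1 : ℝ)) ω' -
      ind {ω | Ring ω v (2 * (m * 16 ^ J))} ω' from funext fun ω => ind_compl _ _, Ex_sub, Ex_const]
    linarith

/-- Rings keep their probability when intensities increase. -/
lemma RingBound.mono {p' : TriE → ℝ} {P' : Measure (Config TriE)} (hp : ∀ e, p e ∈ Icc (0 : ℝ) 1)
    (hp' : ∀ e, p' e ∈ Icc (0 : ℝ) 1) (hP : IsBernoulliProduct p P)
    (hP' : IsBernoulliProduct p' P') (hpp : ∀ e, p e ≤ p' e) {N₀ : ℤ} (hN : 1 ≤ N₀) {c : ℝ}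
    (h : RingBound P N₀ c) : RingBound P' N₀ c := by
  intro m hm v
  refine (h m hm v).trans ?_
  have hsR := supp_Ring v (n := 2 * m) (by omega)
  have ω : Config TriE := fun _ => true
  rw [prob_eq hp hP hsR ω, prob_eq hp' hP' hsR ω]
  apply ENNReal.ofReal_le_ofReal
  have := Ex_anti_param hp hpp hp' (annE v (2 * m)) (f := fun ω' => (-1) *
    ind {ω | Ring ω v (2 * m)} ω') (fun a b hab => by
      have := (incr_Ring v (2 * m)).monotone_ind hab
      simp only; linarith) ω
  rw [Ex_const_mul, Ex_const_mul] at this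
  linarith

end RingEvents

section Chain

/-- `u` is the left end of a horizontal crossing, at scale `n`. -/
def HFrom (ω : Config TriE) (x y n : ℤ) (u : Vtx) : Prop :=
  ∃ w, PathIn (TA ω) {z | (y ≤ z.2 ∧ z.2 ≤ y + n) ∧ x - 5 * n ≤ z.1 ∧ z.1 ≤ x + 10 * n} u w ∧
    u.1 ≤ x ∧ x + 5 * n ≤ w.1

lemma HFrom.of_open {ω ω' : Config TriE} {x y n : ℤ} {u : Vtx}
    (h : ∀ e ∈ rectE (x - 5 * n) (x + 10 * n) y (y + n), ω e = true → ω' e = true)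
    (hc : HFrom ω x y n u) : HFrom ω' x y n u := by
  obtain ⟨w, h1, h2⟩ := hc
  exact ⟨w, h1.of_open (fun e => te_mem_rect) h, h2⟩

lemma supp_HFrom (x y n : ℤ) (u : Vtx) :
    Supp {ω | HFrom ω x y n u} (rectE (x - 5 * n) (x + 10 * n) y (y + n)) :=
  fun _ _ h hc => HFrom.of_open (fun e he ho => by rw [← h e he, ho]) hc

lemma incr_HFrom (x y n : ℤ) (u : Vtx) : Incr {ω | HFrom ω x y n u} :=
  fun _ _ h hc => HFrom.of_open
    (fun e _ ho => by have := h e; rw [ho] at this; exact top_le_iff.1 this) hc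

/-- Crossings at geometrically growing scales, alternately vertical and horizontal, the first of
which starts at `u`. -/
def Chain (x y m : ℤ) (u : Vtx) : ℕ → Set (Config TriE)
  | 0 => {ω | HFrom ω x y (2 * m) u}
  | J + 1 => Chain x y m u J ∩ ({ω | VCross ω (x + 1) (y - 1) (2 * (m * 4 ^ J * 2))} ∩
      {ω | HCross ω x y (2 * (m * 4 ^ (J + 1)))})

lemma Chain.conn {x y m : ℤ} (hm : 1 ≤ m) {u : Vtx} {ω : Config TriE} {J : ℕ}
    (h : ω ∈ Chain x y m u J) : ∃ s, Conn ω u s ∧ HFrom ω x y (2 * (m * 4 ^ J)) s := by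
  induction J with
  | zero => exact ⟨u, .refl trivial, by simpa [Chain] using h⟩
  | succ J ih =>
    obtain ⟨h1, ⟨a, b, p1, hab⟩, ⟨c, d, p2, hcd⟩⟩ := h
    obtain ⟨s, hs, w, p0, hw⟩ := ih h1
    have hpos : 1 ≤ m * 4 ^ J := hm.trans (le_mul_of_one_le_right (by omega)
      (one_le_pow₀ (by norm_num)))
    have e4 : m * 4 ^ (J + 1) = 4 * (m * 4 ^ J) := by ring
    rw [e4] at p2 hcd ⊢
    generalize m * 4 ^ J = k at *
    have c1 : Conn ω s a := cross_meet (p0.mono fun _ h => h.1) hw.1 hw.2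
      (p1.mono fun z hz => by simp only [mem_ofPred_eq] at hz ⊢; omega) (by omega) (by omega)
    have c2 : Conn ω c a := cross_meet (p2.mono fun _ h => h.1) hcd.1 hcd.2
      (p1.mono fun z hz => by simp only [mem_ofPred_eq] at hz ⊢; omega) (by omega) (by omega)
    exact ⟨c, (hs.trans c1).trans c2.symm', d, p2, hcd⟩

lemma Chain.start {x y m : ℤ} {u : Vtx} {ω : Config TriE} {J : ℕ} (h : ω ∈ Chain x y m u J) :
    u.1 ≤ x := by
  induction J with
  | zero => exact h.choose_spec.2.1
  | succ J ih => exact ih h.1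

variable {p : TriE → ℝ} {P : Measure (Config TriE)}

lemma incr_Chain (x y m : ℤ) (u : Vtx) (J : ℕ) : Incr (Chain x y m u J) := by
  induction J with
  | zero => exact incr_HFrom _ _ _ _
  | succ J ih => exact ih.inter ((incr_VCross _ _ _).inter (incr_HCross _ _ _))

lemma prob_Chain (hp : ∀ e, p e ∈ Icc (0 : ℝ) 1) (hP : IsBernoulliProduct p P) {N₀ m : ℤ}
    {δ a : ℝ} (hδ : 0 ≤ δ) (ha : 0 ≤ a) (h : CrossBound P N₀ δ) (hm : N₀ ≤ m) (hm1 : 1 ≤ m)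
    (x y : ℤ) (u : Vtx) (h0 : ENNReal.ofReal a ≤ P {ω | HFrom ω x y (2 * m) u}) (J : ℕ) :
    ENNReal.ofReal (a * (δ * δ) ^ J) ≤ P (Chain x y m u J) := by
  suffices ∃ F, Supp (Chain x y m u J) F ∧ ENNReal.ofReal (a * (δ * δ) ^ J) ≤ P (Chain x y m u J)
    from this.choose_spec.2
  induction J with
  | zero => exact ⟨_, supp_HFrom _ _ _ _, by simpa [Chain] using h0⟩
  | succ J ih =>
    obtain ⟨F, hF, hle⟩ := ih
    have hpos : ∀ j : ℕ, m ≤ m * 4 ^ j := fun j => le_mul_of_one_le_right (by omega)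
      (one_le_pow₀ (by norm_num))
    have hV := (h (m * 4 ^ J * 2) (by have := hpos J; omega) (x + 1) (y - 1)).2
    have hH := (h (m * 4 ^ (J + 1)) (by have := hpos (J + 1); omega) x y).1
    have sV := supp_VCross (x + 1) (y - 1) (2 * (m * 4 ^ J * 2))
    have sH := supp_HCross x y (2 * (m * 4 ^ (J + 1)))
    have iV := incr_VCross (x + 1) (y - 1) (2 * (m * 4 ^ J * 2))
    have iH := incr_HCross x y (2 * (m * 4 ^ (J + 1)))
    set G := rectE (x + 1) (x + 1 + 2 * (m * 4 ^ J * 2)) (y - 1 - 5 * (2 * (m * 4 ^ J * 2)))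
      (y - 1 + 10 * (2 * (m * 4 ^ J * 2)))
    set H := rectE (x - 5 * (2 * (m * 4 ^ (J + 1)))) (x + 10 * (2 * (m * 4 ^ (J + 1)))) y
      (y + 2 * (m * 4 ^ (J + 1)))
    have hVH := prob_harris hp hP (sV.mono Finset.subset_union_left)
      (sH.mono (Finset.subset_union_right (s₁ := G))) iV iH
    have sVH := (sV.mono Finset.subset_union_left).inter
      (sH.mono (Finset.subset_union_right (s₁ := G)))
    have hall := prob_harris hp hP (hF.mono Finset.subset_union_left)
      (sVH.mono (Finset.subset_union_right (s₁ := F))) (incr_Chain x y m u J) (iV.inter iH)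
    refine ⟨_, (hF.mono Finset.subset_union_left).inter
      (sVH.mono (Finset.subset_union_right (s₁ := F))), le_trans ?_ hall⟩
    rw [pow_succ, ← mul_assoc, ENNReal.ofReal_mul (by positivity), ENNReal.ofReal_mul hδ]
    exact mul_le_mul' hle ((mul_le_mul' hV hH).trans hVH)

/-- Polynomial lower bound for the radius of the cluster of some vertex near any given one. -/
lemma CrossBound.radius (hp : ∀ e, p e ∈ Icc (0 : ℝ) 1) (hP : IsBernoulliProduct p P) {N₀ : ℤ}
    {δ : ℝ} (hδ : 0 < δ) (hδ1 : δ < 1) (h : CrossBound P N₀ δ) :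
    ∃ a : ℝ, 0 < a ∧ ∃ b : ℝ, 0 < b ∧ ∃ M : ℕ, ∀ v, ∃ w, dV v w ≤ M ∧ ∀ k : ℕ, 1 ≤ k →
      ENNReal.ofReal (a * (k : ℝ) ^ (-b)) ≤ P {ω | ∃ u, Conn ω w u ∧ (k : ℤ) ≤ dV w u} := by
  set m : ℤ := max N₀ 1
  have hm1 : 1 ≤ m := le_max_right _ _
  have hm0 : N₀ ≤ m := le_max_left _ _
  set n := 2 * m
  set B : Vtx → Finset Vtx := fun v =>
    Finset.Icc (v.1 - 5 * n) (v.1 + 10 * n) ×ˢ Finset.Icc v.2 (v.2 + n)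
  set c : ℕ := (15 * n + 1).toNat * (n + 1).toNat
  have hBc : ∀ v, (B v).card = c := by
    intro v
    simp only [B, Finset.card_product, Int.card_Icc, c]
    congr 2 <;> ring
  have hcpos : (0 : ℝ) < c := by
    have : 0 < c := Nat.mul_pos (by omega) (by omega)
    exact_mod_cast this
  have start : ∀ v, ∃ u ∈ B v, ENNReal.ofReal (δ / c) ≤ P {ω | HFrom ω v.1 v.2 n u} := by
    intro v
    by_contra! hcon
    have h1 := (h m hm0 v.1 v.2).1
    have hsub : {ω | HCross ω v.1 v.2 n} ⊆ ⋃ u ∈ B v, {ω | HFrom ω v.1 v.2 n u} := by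
      rintro ω ⟨u, w, hu⟩
      have := hu.1.1
      simp only [mem_ofPred_eq] at this
      refine mem_biUnion (x := u) ?_ ⟨w, hu⟩
      simp only [B, Finset.coe_product, Finset.coe_Icc, mem_prod, mem_Icc]
      omega
    have h2 : P {ω | HCross ω v.1 v.2 n} ≤ ∑ u ∈ B v, P {ω | HFrom ω v.1 v.2 n u} :=
      (measure_mono hsub).trans (measure_biUnion_finset_le _ _)
    have hne : (B v).Nonempty := Finset.card_pos.1 (by rw [hBc]; exact_mod_cast hcpos)
    have h3 : ∑ u ∈ B v, P {ω | HFrom ω v.1 v.2 n u} < ∑ u ∈ B v, ENNReal.ofReal (δ / c) :=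
      ENNReal.sum_lt_sum_of_nonempty hne fun u hu => hcon u hu
    rw [Finset.sum_const, hBc, nsmul_eq_mul, ← ENNReal.ofReal_natCast, ← ENNReal.ofReal_mul
      (by positivity), mul_div_cancel₀ _ hcpos.ne'] at h3
    exact absurd (h1.trans h2) (not_le.2 h3)
  set D := δ * δ
  have hD : 0 < D := by positivity
  have hD1 : D < 1 := by nlinarith
  have hlog : Real.log D < 0 := Real.log_neg hD hD1
  have h4 : 0 < Real.log 4 := Real.log_pos (by norm_num)
  refine ⟨δ / c * D, by positivity, - Real.log D / Real.log 4, div_pos (by linarith) h4,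
    (10 * n).toNat, fun v => ?_⟩
  obtain ⟨u, hu, hPu⟩ := start v
  refine ⟨u, ?_, fun k hk => ?_⟩
  · simp only [B, Finset.mem_product, Finset.mem_Icc] at hu
    simp only [dV]
    omega
  set J := Nat.log 4 k + 1
  have hk4 : (k : ℤ) ≤ 4 ^ J := by exact_mod_cast (Nat.lt_pow_succ_log_self (by norm_num) k).le
  have hJ := prob_Chain hp hP hδ.le (by positivity) h hm0 hm1 v.1 v.2 u hPu J
  refine le_trans (ENNReal.ofReal_le_ofReal ?_) (hJ.trans (measure_mono ?_))
  · rw [mul_assoc]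
    gcongr
    have hkpos : (0 : ℝ) < k := by exact_mod_cast hk
    have hl : (Nat.log 4 k : ℝ) * Real.log 4 ≤ Real.log k := by
      rw [← Real.log_pow]
      refine Real.log_le_log (by positivity) ?_
      exact_mod_cast Nat.pow_log_le_self 4 (by omega)
    rw [pow_succ']
    gcongr
    rw [Real.rpow_def_of_pos hkpos, ← Real.exp_log (pow_pos hD _), Real.log_pow]
    apply Real.exp_le_exp.2
    rw [neg_div, neg_neg]
    have : (Nat.log 4 k : ℝ) ≤ Real.log k / Real.log 4 := (le_div_iff₀ h4).2 hl
    calc Real.log k * (Real.log D / Real.log 4) = (Real.log k / Real.log 4) * Real.log D := by ring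
      _ ≤ _ := mul_le_mul_of_nonpos_right this hlog.le
  · intro ω hω
    obtain ⟨s, hs, w, hw, hw2⟩ := Chain.conn hm1 hω
    refine ⟨w, hs.trans hw.conn, hk4.trans ?_⟩
    have hle : (4 : ℤ) ^ J ≤ m * 4 ^ J := le_mul_of_one_le_left (by positivity) hm1
    have h0 := Chain.start hω
    have hpos : (0 : ℤ) ≤ 4 ^ J := by positivity
    simp only [dV]
    omega

end Chain

section Unique

lemma dV_self (v : Vtx) : dV v v = 0 := by simp [dV]

lemma dV_triangle (u v w : Vtx) : dV u w ≤ dV u v + dV v w := by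
  simp only [dV]; omega

lemma dV_comm (u v : Vtx) : dV u v = dV v u := by
  simp only [dV]; omega

lemma finite_dV_le (v : Vtx) (n : ℤ) : {z | dV v z ≤ n}.Finite := by
  refine ((finite_Icc (v.1 - n) (v.1 + n)).prod (finite_Icc (v.2 - n) (v.2 + n))).subset ?_
  intro z hz
  simp only [mem_ofPred_eq, dV] at hz
  simp only [mem_prod, mem_Icc]
  omega

/-- The open cluster in the triangular lattice. -/
def clus (ω : Config TriE) (v : Vtx) : Set Vtx := {u | Conn ω v u}

lemma exists_far {ω : Config TriE} {u : Vtx} (h : (clus ω u).Infinite) (v : Vtx) (n : ℤ) :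
    ∃ t, Conn ω u t ∧ n < dV v t := by
  by_contra! hcon
  exact h ((finite_dV_le v n).subset hcon)

variable {p : TriE → ℝ} {P : Measure (Config TriE)}

lemma RingBound.unique (hp : ∀ e, p e ∈ Icc (0 : ℝ) 1) (hP : IsBernoulliProduct p P) {N₀ : ℤ}
    {c : ℝ} (hc : 0 < c) (hc1 : c ≤ 1) (h : RingBound P N₀ c) :
    P {ω | ∀ u v, (clus ω u).Infinite → (clus ω v).Infinite → Conn ω u v}ᶜ = 0 := by
  have key : ∀ K : ℕ, P {ω | ∀ n : ℤ, K ≤ n → ¬ Ring ω (0, 0) n} = 0 := by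
    intro K
    set m : ℤ := max (max N₀ 1) K
    have hm : N₀ ≤ m := (le_max_left _ _).trans (le_max_left _ _)
    have hm1 : 1 ≤ m := (le_max_right _ _).trans (le_max_left _ _)
    have hmK : K ≤ m := le_max_right _ _
    have hle : ∀ J, P {ω | ∀ n : ℤ, K ≤ n → ¬ Ring ω (0, 0) n} ≤ ENNReal.ofReal ((1 - c) ^ J) := by
      intro J
      refine (measure_mono ?_).trans (prob_noRing hp hP hc1 h hm hm1 (0, 0) J)
      intro ω hω j _
      refine hω _ ?_
      have : m ≤ m * 16 ^ j := le_mul_of_one_le_right (by omega) (one_le_pow₀ (by norm_num))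
      omega
    have hlim := ENNReal.tendsto_ofReal
      (tendsto_pow_atTop_nhds_zero_of_lt_one (r := 1 - c) (by linarith) (by linarith))
    rw [ENNReal.ofReal_zero] at hlim
    exact le_antisymm (ge_of_tendsto' hlim hle) bot_le
  refine measure_mono_null ?_ (measure_iUnion_null key)
  intro ω hω
  rw [mem_compl_iff, mem_ofPred_eq] at hω
  push Not at hω
  obtain ⟨u, v, hu, hv, huv⟩ := hω
  rw [mem_iUnion]
  refine ⟨(max (max (dV (0, 0) u) (dV (0, 0) v)) 3).toNat + 1, fun n hn hr => huv ?_⟩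
  obtain ⟨r, hr⟩ := ring_meets (by omega) hr
  obtain ⟨s, hs, hs'⟩ := exists_far hu (0, 0) (2 * n)
  obtain ⟨t, ht, ht'⟩ := exists_far hv (0, 0) (2 * n)
  exact (hr u s hs (by omega) hs').symm'.trans (hr v t ht (by omega) ht')

end Unique

section Arms

/-- The base point of a face. -/
def cF (F : Face) : Vtx := (F.1, F.2.1)

/-- Edges whose dual edges lie within distance `N` of the face `F`. -/
noncomputable def FE (F : Face) (N : ℕ) : Finset TriE :=
  (rectE (F.1 - N) (F.1 + N) (F.2.1 - N) (F.2.1 + N)).filter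
    fun e => dF (cF F) (fe e).1 ≤ N ∧ dF (cF F) (fe e).2 ≤ N

lemma mem_FE {F : Face} {N : ℕ} {e : TriE} :
    e ∈ FE F N ↔ dF (cF F) (fe e).1 ≤ N ∧ dF (cF F) (fe e).2 ≤ N := by
  refine ⟨fun h => (Finset.mem_filter.1 h).2, fun h => Finset.mem_filter.2 ⟨?_, h⟩⟩
  rw [mem_rectE]
  have h1 := h.1
  have : (fe e).1 = (e.1, e.2.1, true) := by
    induction e using TriE.cases <;> rfl
  rw [this] at h1
  simp only [dF, dV, cF] at h1
  omega

/-- The closed dual cluster of `F` reaches distance `N`. -/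
def Arm (F : Face) (N : ℕ) : Set (Config TriE) :=
  {ω | ∃ G, Relation.ReflTransGen (CAdj fe (FE F N) ω) F G ∧ dF (cF F) G = N}

lemma CAdj.dual {S : Finset TriE} {ω : Config TriE} {F G : Face} (h : CAdj fe S ω F G) :
    DA ω F G := by
  obtain ⟨e, -, h⟩ := h; exact ⟨e, h⟩

lemma CAdj.symm {S : Finset TriE} {ω : Config TriE} {F G : Face} (h : CAdj fe S ω F G) :
    CAdj fe S ω G F := by
  obtain ⟨e, he, h, h'⟩ := h; exact ⟨e, he, h, h'.symm⟩

lemma rtg_symm {S : Finset TriE} {ω : Config TriE} {F G : Face}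
    (h : Relation.ReflTransGen (CAdj fe S ω) F G) : Relation.ReflTransGen (CAdj fe S ω) G F := by
  induction h with
  | refl => exact .refl
  | tail _ h2 ih => exact .head h2.symm ih

/-- The initial piece of a path up to the first time it is at distance `r`. -/
lemma exists_trunc {R : Face → Face → Prop} {ω : Config TriE} (hR : ∀ x y, R x y → DA ω x y)
    {F G : Face} {r : ℕ} (h : Relation.ReflTransGen R F G) (hG : r ≤ dF (cF F) G) :
    ∃ x, dF (cF F) x = r ∧ Relation.ReflTransGen
      (fun x y => R x y ∧ dF (cF F) x ≤ r ∧ dF (cF F) y ≤ r) F x := by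
  suffices (∃ x, dF (cF F) x = r ∧ Relation.ReflTransGen
      (fun x y => R x y ∧ dF (cF F) x ≤ r ∧ dF (cF F) y ≤ r) F x) ∨
      (dF (cF F) G < r ∧ Relation.ReflTransGen
      (fun x y => R x y ∧ dF (cF F) x ≤ r ∧ dF (cF F) y ≤ r) F G) by
    rcases this with h | h
    · exact h
    · omega
  clear hG
  induction h with
  | refl =>
    have h0 : dF (cF F) F = 0 := dV_self _
    rcases Nat.eq_zero_or_pos r with hr | hr
    · exact .inl ⟨F, by rw [h0, hr]; rfl, .refl⟩
    · exact .inr ⟨by omega, .refl⟩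
  | @tail x y hx hxy ih =>
    rcases ih with ih | ⟨ih, ih'⟩
    · exact .inl ih
    · have := dF_step (v := cF F) (hR _ _ hxy)
      have hy := ih'.tail ⟨hxy, ih.le, show dF (cF F) y ≤ r by omega⟩
      rcases lt_or_eq_of_le (show dF (cF F) y ≤ r by omega) with h | h
      · exact .inr ⟨h, hy⟩
      · exact .inl ⟨y, h, hy⟩

lemma mem_Arm_of_path {ω : Config TriE} {F G : Face} {r : ℕ}
    (h : Relation.ReflTransGen (DA ω) F G) (hG : r ≤ dF (cF F) G) : ω ∈ Arm F r := by
  obtain ⟨x, hx, hp⟩ := exists_trunc (fun _ _ h => h) h hG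
  refine ⟨x, hp.lift id ?_, hx⟩
  rintro x y ⟨⟨e, he, h⟩, h1, h2⟩
  refine ⟨e, mem_FE.2 ?_, he, h⟩
  rcases h with h | h <;> rw [h]
  exacts [⟨h1, h2⟩, ⟨h2, h1⟩]

lemma Arm.anti {F : Face} {r : ℕ} {ω ω' : Config TriE} (h : ω ∈ Arm F r)
    (hω : ∀ e ∈ FE F r, ω e = false → ω' e = false) : ω' ∈ Arm F r := by
  obtain ⟨G, hG, hd⟩ := h
  refine ⟨G, hG.lift id ?_, hd⟩
  rintro x y ⟨e, he, h, h'⟩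
  exact ⟨e, he, hω e he h, h'⟩

lemma supp_Arm (F : Face) (r : ℕ) : Supp (Arm F r) (FE F r) :=
  fun _ _ h hA => Arm.anti hA fun e he hf => by rw [← h e he, hf]

lemma antitone_ind_Arm (F : Face) (r : ℕ) : Antitone (ind (Arm F r)) := by
  intro ω ω' h
  by_cases hA : ω' ∈ Arm F r
  · have : ω ∈ Arm F r :=
      Arm.anti hA fun e _ he => by have := h e; rw [he] at this; exact le_bot_iff.1 this
    rw [ind_of_mem hA, ind_of_mem this]
  · rw [ind_of_notMem hA]
    exact (ind_mem_Icc _ _).1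

variable {p : TriE → ℝ} {P : Measure (Config TriE)}

/-- Arms do not cross rings. -/
lemma RingBound.arm (hp : ∀ e, p e ∈ Icc (0 : ℝ) 1) (hP : IsBernoulliProduct p P) {N₀ m : ℤ}
    {c : ℝ} (hc1 : c ≤ 1) (h : RingBound P N₀ c) (hm : N₀ ≤ m) (hm2 : 2 ≤ m) (F : Face)
    {r J : ℕ} (hr : 4 * (m * 16 ^ J) ≤ r) : P (Arm F r) ≤ ENNReal.ofReal ((1 - c) ^ J) := by
  refine (measure_mono ?_).trans (prob_noRing hp hP hc1 h hm (by omega) (cF F) J)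
  rintro ω ⟨G, hG, hd⟩ j hj hring
  have h1 : m ≤ m * 16 ^ j := le_mul_of_one_le_right (by omega) (one_le_pow₀ (by norm_num))
  have h2 : m * 16 ^ j < m * 16 ^ J :=
    mul_lt_mul_of_pos_left (pow_lt_pow_right₀ (by norm_num) hj) (by omega)
  have h0 : dF (cF F) F = 0 := dV_self _
  have hpath : PathIn (DA ω) univ F G :=
    ⟨trivial, hG.lift id fun _ _ h => ⟨h.dual, trivial⟩⟩
  exact ring_blocks (by omega) hring hpath (by omega) (by omega)

end Arms

section Decay

lemma influence_eq {E : Type} [DecidableEq E] (q : E → ℝ) (hq : ∀ e, q e ∈ Icc (0 : ℝ) 1)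
    {F : Finset E} {e : E} (he : e ∈ F) {g : Config E → ℝ} (hg : Antitone g) (ω : Config E) :
    Ex q F (fun ω => |g ω - ave q e g ω|) ω = -(2 * (q e * (1 - q e))) * Ex q F (fun ω =>
      g (Function.update ω e true) - g (Function.update ω e false)) ω := by
  rw [← Ex_ave_of_mem q he, ← Ex_const_mul]
  congr 1
  funext ω'
  have h1 : g (Function.update ω' e true) ≤ g (Function.update ω' e false) :=
    hg (by rw [update_le_update_iff]; simp)
  have hq0 := (hq e).1
  have hq1 : 0 ≤ 1 - q e := by linarith [(hq e).2]
  simp only [ave, Function.update_idem]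
  rw [abs_of_nonpos (by nlinarith), abs_of_nonneg (by nlinarith)]
  ring

/-- Bound on the probability that the exploration from distance `k` reaches distance `d`. -/
noncomputable def wt (R : ℕ) (ε : ℝ) (d k : ℤ) : ℝ := if |k - d| < R then 1 else ε

lemma wt_nonneg (R : ℕ) {ε : ℝ} (hε : 0 ≤ ε) (d k : ℤ) : 0 ≤ wt R ε d k := by
  rw [wt]; split_ifs <;> linarith

lemma sum_wt_le (R : ℕ) {ε : ℝ} (hε : 0 ≤ ε) (d : ℤ) (N : ℕ) :
    ∑ k ∈ Finset.range (N + 1), wt R ε d k ≤ 2 * R + (N + 1) * ε := by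
  have h1 : ∀ k ∈ Finset.range (N + 1), wt R ε d k ≤
      (if |(k : ℤ) - d| < R then (1 : ℝ) else 0) + ε := by
    intro k _
    rw [wt]; split_ifs <;> linarith
  refine (Finset.sum_le_sum h1).trans ?_
  rw [Finset.sum_add_distrib, Finset.sum_const, Finset.card_range, nsmul_eq_mul,
    ← Finset.sum_filter, Finset.sum_const, nsmul_eq_mul, mul_one]
  push_cast
  gcongr
  have : ((Finset.range (N + 1)).filter fun k : ℕ => |(k : ℤ) - d| < R).card ≤
      (Finset.Ioo (d - R) (d + R)).card := by
    refine Finset.card_le_card_of_injOn (fun k : ℕ => (k : ℤ)) ?_ (fun a _ b _ h => by simpa using h)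
    intro k hk
    have hk' := (Finset.mem_filter.1 hk).2
    rw [abs_lt] at hk'
    simp only [Finset.coe_Ioo, mem_Ioo]
    omega
  have hc : (Finset.Ioo (d - R) (d + R)).card ≤ 2 * R := by rw [Int.card_Ioo]; omega
  exact_mod_cast this.trans hc

variable {p : TriE → ℝ} {P : Measure (Config TriE)}

/-- Faces at distance `k` from `F`. -/
def sph (F : Face) (k : ℕ) : Set Face := {G | dF (cF F) G = k}

lemma prob_reach (hP : IsBernoulliProduct p P) {R : ℕ} {ε : ℝ}
    (hβ : ∀ F (r : ℕ), R ≤ r → P (Arm F r) ≤ ENNReal.ofReal ε) (S : Finset TriE) (F f : Face)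
    (k : ℕ) : P {ω | f ∈ Reach fe S ω (sph F k)} ≤ ENNReal.ofReal (wt R ε (dF (cF F) f) k) := by
  have := hP.1
  rw [wt]
  split_ifs with h
  · simpa using prob_le_one
  refine (measure_mono ?_).trans (hβ f (|(k : ℤ) - dF (cF F) f|).natAbs (by omega))
  rintro ω ⟨a, ha, hp⟩
  refine mem_Arm_of_path (G := a) ((rtg_symm hp).lift id fun _ _ => CAdj.dual) ?_
  have h1 := dV_triangle (cF F) (cF f) (cF a)
  have h2 := dV_triangle (cF F) (cF a) (cF f)
  have h3 := dV_comm (cF a) (cF f)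
  have ha' : dV (cF F) (cF a) = k := ha
  change _ ≤ dV (cF f) (cF a)
  change ¬ |(k : ℤ) - dV (cF F) (cF f)| < R at h
  change ((|(k : ℤ) - dV (cF F) (cF f)|).natAbs : ℤ) ≤ _
  rw [Int.natCast_natAbs, abs_abs, abs_le]
  omega

lemma supp_touched (S : Finset TriE) (A : Set Face) (e : TriE) : Supp (Touched fe S A e) S := by
  have key : ∀ ω ω' : Config TriE, (∀ e ∈ S, ω e = ω' e) → Reach fe S ω A ⊆ Reach fe S ω' A := by
    rintro ω ω' h v ⟨a, ha, hv⟩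
    refine ⟨a, ha, hv.lift id ?_⟩
    rintro x y ⟨e, he, h1, h2⟩
    exact ⟨e, he, by rw [← h e he, h1], h2⟩
  intro ω ω' h h1
  exact h1.imp (fun h2 => key ω ω' h h2) (fun h2 => key ω ω' h h2)

lemma antitone_touched (S : Finset TriE) (A : Set Face) (e : TriE) :
    Antitone (ind (Touched fe S A e)) := by
  intro ω ω' h
  by_cases hA : ω' ∈ Touched fe S A e
  · have key : Reach fe S ω' A ⊆ Reach fe S ω A := by
      rintro v ⟨a, ha, hv⟩
      refine ⟨a, ha, hv.lift id ?_⟩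
      rintro x y ⟨e, he, h1, h2⟩
      exact ⟨e, he, by have := h e; rw [h1] at this; exact le_bot_iff.1 this, h2⟩
    have : ω ∈ Touched fe S A e := hA.imp (fun h2 => key h2) (fun h2 => key h2)
    rw [ind_of_mem hA, ind_of_mem this]
  · rw [ind_of_notMem hA]
    exact (ind_mem_Icc _ _).1

lemma revealment (hp : ∀ e, p e ∈ Icc (0 : ℝ) 1) (hP : IsBernoulliProduct p P) {R : ℕ} {ε : ℝ}
    (hε : 0 ≤ ε) (hβ : ∀ F (r : ℕ), R ≤ r → P (Arm F r) ≤ ENNReal.ofReal ε) (S : Finset TriE)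
    (F : Face) (k : ℕ) (e : TriE) (ω : Config TriE) :
    Ex p S (ind (Touched fe S (sph F k) e)) ω ≤
      wt R ε (dF (cF F) (fe e).1) k + wt R ε (dF (cF F) (fe e).2) k := by
  have h1 := wt_nonneg R hε (dF (cF F) (fe e).1) k
  have h2 := wt_nonneg R hε (dF (cF F) (fe e).2) k
  rw [← ENNReal.ofReal_le_ofReal_iff (by positivity), ← prob_eq hp hP (supp_touched _ _ _),
    ENNReal.ofReal_add h1 h2]
  refine le_trans (measure_union_le _ _) (add_le_add (prob_reach hP hβ S F _ k)
    (prob_reach hP hβ S F _ k))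

lemma arm_of_touched {F : Face} {N k : ℕ} (hk : k ≤ N) {ω ω' : Config TriE}
    (h : ∀ e ∈ FE F N, ω ∈ Touched fe (FE F N) (sph F k) e → ω e = ω' e) (hA : ω ∈ Arm F N) :
    ω' ∈ Arm F N := by
  obtain ⟨G, hG, hd⟩ := hA
  obtain ⟨x, hx, hFx⟩ := exists_trunc (fun _ _ => CAdj.dual) (r := k) hG (by omega)
  have hFx' : Relation.ReflTransGen (CAdj fe (FE F N) ω) F x := hFx.lift id fun _ _ h => h.1
  have hF : F ∈ Reach fe (FE F N) ω (sph F k) := ⟨x, hx, rtg_symm hFx'⟩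
  have key : G ∈ Reach fe (FE F N) ω (sph F k) ∧
      Relation.ReflTransGen (CAdj fe (FE F N) ω') F G := by
    clear hd hFx hFx'
    induction hG with
    | refl => exact ⟨hF, .refl⟩
    | tail _ hxy ih =>
      refine ⟨Reach_step ih.1 hxy, ih.2.tail ?_⟩
      obtain ⟨e, he, hc, h'⟩ := hxy
      refine ⟨e, he, ?_, h'⟩
      rw [← h e he ?_, hc]
      rcases h' with h' | h'
      · left; rw [h']; exact ih.1
      · right; rw [h']; exact ih.1
  exact ⟨G, key.2, hd⟩

lemma arm_determined {F : Face} {N k : ℕ} (hk : k ≤ N) {ω ω' : Config TriE}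
    (h : ∀ e ∈ FE F N, ω ∈ Touched fe (FE F N) (sph F k) e → ω e = ω' e) :
    ind (Arm F N) ω = ind (Arm F N) ω' := by
  have hsub : Reach fe (FE F N) ω' (sph F k) ⊆ Reach fe (FE F N) ω (sph F k) := by
    refine Reach_subset (subset_Reach _ _ _ _) ?_
    rintro u v hu ⟨e, he, hc, h'⟩
    refine Reach_step hu ⟨e, he, ?_, h'⟩
    rw [h e he ?_, hc]
    rcases h' with h' | h'
    · left; rw [h']; exact hu
    · right; rw [h']; exact hu
  by_cases hA : ω ∈ Arm F N
  · rw [ind_of_mem hA, ind_of_mem (arm_of_touched hk h hA)]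
  · rw [ind_of_notMem hA, ind_of_notMem]
    exact fun hA' => hA (arm_of_touched hk (fun e he ht => (h e he
      (ht.imp (fun h2 => hsub h2) (fun h2 => hsub h2))).symm) hA')

/-- The variance of the arm event is controlled by its total influence. -/
lemma osss_arm (hp : ∀ e, p e ∈ Icc (0 : ℝ) 1) (hP : IsBernoulliProduct p P) {R N : ℕ} {ε : ℝ}
    (hε : 0 ≤ ε) (hβ : ∀ F (r : ℕ), R ≤ r → P (Arm F r) ≤ ENNReal.ofReal ε)
    (hN : 2 * R ≤ ε * (N + 1)) {q : TriE → ℝ} (hpq : ∀ e, p e ≤ q e)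
    (hq : ∀ e, q e ∈ Icc (0 : ℝ) 1) (F : Face) (ω : Config TriE) :
    Ex q (FE F N) (ind (Arm F N)) ω * (1 - Ex q (FE F N) (ind (Arm F N)) ω) ≤
      4 * ε * ∑ e ∈ FE F N, Ex q (FE F N) (fun ω => |ind (Arm F N) ω - ave q e (ind (Arm F N)) ω|) ω
    := by
  set S := FE F N
  set g := ind (Arm F N)
  set h := Ex q S g ω
  set I : TriE → ℝ := fun e => Ex q S (fun ω => |g ω - ave q e g ω|) ω
  have hI : ∀ e, 0 ≤ I e := fun e => Ex_nonneg hq S (fun _ => abs_nonneg _) ω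
  have hsq : (fun ω => g ω * g ω) = g := by
    funext ω
    rw [← ind_inter, inter_self]
  have hone : ∀ k ∈ Finset.range (N + 1), h * (1 - h) ≤ ∑ e ∈ S,
      (wt R ε (dF (cF F) (fe e).1) k + wt R ε (dF (cF F) (fe e).2) k) * I e := by
    intro k hk
    have ho := osss hq fe S.card S rfl (sph F k) g g ω (ind_mem_Icc _)
      (fun ω ω' h _ => arm_determined (Nat.lt_succ_iff.1 (Finset.mem_range.1 hk)) h)
    rw [hsq] at ho
    refine (le_trans (le_of_eq (by ring)) (le_abs_self _)).trans (ho.trans ?_)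
    refine Finset.sum_le_sum fun e he => mul_le_mul_of_nonneg_right ?_ (hI e)
    exact (Ex_anti_param hp hpq hq S (antitone_touched _ _ _) ω).trans
      (revealment hp hP hε hβ S F k e ω)
  have hsum := Finset.sum_le_sum hone
  rw [Finset.sum_const, Finset.card_range, nsmul_eq_mul, Finset.sum_comm] at hsum
  have hN1 : (0 : ℝ) < N + 1 := by positivity
  have hle : ∑ e ∈ S, ∑ k ∈ Finset.range (N + 1),
      (wt R ε (dF (cF F) (fe e).1) k + wt R ε (dF (cF F) (fe e).2) k) * I e ≤
      ∑ e ∈ S, ((N + 1) * (4 * ε)) * I e := by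
    refine Finset.sum_le_sum fun e _ => ?_
    rw [← Finset.sum_mul]
    refine mul_le_mul_of_nonneg_right ?_ (hI e)
    rw [Finset.sum_add_distrib]
    have h1 := sum_wt_le R hε (dF (cF F) (fe e).1) N
    have h2 := sum_wt_le R hε (dF (cF F) (fe e).2) N
    nlinarith
  have := hsum.trans hle
  rw [← Finset.mul_sum] at this
  push_cast at this
  refine le_of_mul_le_mul_left ?_ hN1
  linarith

/-- The enhanced intensities. -/
noncomputable def enh (p : TriE → ℝ) (ν : ℝ) : TriE → ℝ :=
  fun e => if p e = 0 then 0 else min (p e + ν) 1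

lemma enh_ge (hp : ∀ e, p e ∈ Icc (0 : ℝ) 1) {ν : ℝ} (hν : 0 < ν) (e : TriE) :
    p e ≤ enh p ν e := by
  rw [enh]
  split_ifs with h
  · exact h.le
  · exact le_min (by linarith) (hp e).2

lemma enh_mem (hp : ∀ e, p e ∈ Icc (0 : ℝ) 1) {ν : ℝ} (hν : 0 < ν) (e : TriE) :
    enh p ν e ∈ Icc (0 : ℝ) 1 := by
  refine ⟨(hp e).1.trans (enh_ge hp hν e), ?_⟩
  rw [enh]
  split_ifs with h
  · exact zero_le_one
  · exact min_le_right _ _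

/-- Interpolation between the original and the enhanced intensities. -/
noncomputable def interp (p : TriE → ℝ) (ν t : ℝ) : TriE → ℝ :=
  fun e => p e + t * (enh p ν e - p e)

lemma interp_infl (hp : ∀ e, p e ∈ Icc (0 : ℝ) 1) {ν : ℝ} (hν : 0 < ν) (hν1 : ν ≤ 1) {t : ℝ}
    (ht : t ∈ Icc (0 : ℝ) 1) (e : TriE) :
    ν * (interp p ν t e * (1 - interp p ν t e)) ≤ enh p ν e - p e := by
  have h0 := enh_ge hp hν e
  have h1 := (enh_mem hp hν e).2
  have h2 := hp e
  by_cases h : p e = 0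
  · simp [interp, enh, h]
  have h3 : ν * (1 - p e) ≤ enh p ν e - p e := by
    rw [enh, if_neg h]
    rcases min_cases (p e + ν) 1 with ⟨h, _⟩ | ⟨h, _⟩ <;> rw [h] <;> nlinarith [h2.1, h2.2]
  have h4 : p e ≤ interp p ν t e := by
    rw [interp]; nlinarith [ht.1]
  have h5 : interp p ν t e ≤ 1 := by
    rw [interp]; nlinarith [ht.2]
  refine le_trans (mul_le_mul_of_nonneg_left ?_ hν.le) h3
  nlinarith [h2.1]

/-- Exponential gain from the enhancement. -/
lemma arm_enh (hp : ∀ e, p e ∈ Icc (0 : ℝ) 1) (hP : IsBernoulliProduct p P) {R N : ℕ} {ε c ν : ℝ}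
    (hε : 0 < ε) (hβ : ∀ F (r : ℕ), R ≤ r → P (Arm F r) ≤ ENNReal.ofReal ε)
    (hN : 2 * R ≤ ε * (N + 1)) (hν : 0 < ν) (hν1 : ν ≤ 1) (F : Face)
    (hc1 : c ≤ 1) (h0 : P (Arm F N) ≤ ENNReal.ofReal (1 - c)) (ω : Config TriE) :
    Ex (enh p ν) (FE F N) (ind (Arm F N)) ω ≤ Real.exp (-(ν * c / (8 * ε))) := by
  set S := FE F N
  set g := ind (Arm F N)
  set h : ℝ → ℝ := fun t => Ex (interp p ν t) S g ω
  have hq : ∀ t ∈ Icc (0 : ℝ) 1, ∀ e, p e ≤ interp p ν t e ∧ interp p ν t e ∈ Icc (0 : ℝ) 1 := by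
    intro t ht e
    have h1 := enh_ge hp hν e
    have h2 := (enh_mem hp hν e).2
    have h3 := hp e
    have : p e ≤ interp p ν t e := by rw [interp]; nlinarith [ht.1]
    exact ⟨this, h3.1.trans this, by rw [interp]; nlinarith [ht.2]⟩
  have hder : ∀ t, HasDerivAt h (∑ e ∈ S, (enh p ν e - p e) * Ex (interp p ν t) S (fun ω =>
      g (Function.update ω e true) - g (Function.update ω e false)) ω) t := by
    intro t
    refine hasDerivAt_Ex S g (interp p ν) _ t (fun e => ?_) ω
    simpa [interp] using ((hasDerivAt_id t).mul_const (enh p ν e - p e)).const_add (p e)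
  set lam := ν * c / (8 * ε)
  have hdle : ∀ t ∈ Icc (0 : ℝ) 1, ∑ e ∈ S, (enh p ν e - p e) * Ex (interp p ν t) S (fun ω =>
      g (Function.update ω e true) - g (Function.update ω e false)) ω ≤ - lam * h t := by
    intro t ht
    have ho := osss_arm hp hP hε.le hβ hN (fun e => (hq t ht e).1) (fun e => (hq t ht e).2) F ω
    have hh0 : 0 ≤ h t := Ex_nonneg (fun e => (hq t ht e).2) S (fun ω => (ind_mem_Icc _ ω).1) ω
    have hh1 : h t ≤ 1 - c := by
      refine (Ex_anti_param hp (fun e => (hq t ht e).1) (fun e => (hq t ht e).2) S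
        (antitone_ind_Arm F N) ω).trans ?_
      rwa [prob_eq hp hP (supp_Arm F N) ω, ENNReal.ofReal_le_ofReal_iff (by linarith)] at h0
    have hterm : ∀ e ∈ S, (enh p ν e - p e) * Ex (interp p ν t) S (fun ω =>
      g (Function.update ω e true) - g (Function.update ω e false)) ω ≤
        -(ν / 2) * Ex (interp p ν t) S (fun ω => |g ω - ave (interp p ν t) e g ω|) ω := by
      intro e he
      rw [influence_eq _ (fun e => (hq t ht e).2) he (antitone_ind_Arm F N)]
      have hneg : Ex (interp p ν t) S (fun ω =>
          g (Function.update ω e true) - g (Function.update ω e false)) ω ≤ 0 := by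
        have := Ex_mono (fun e => (hq t ht e).2) S (f := fun ω =>
          g (Function.update ω e true) - g (Function.update ω e false)) (g := fun _ => 0)
          (fun ω => sub_nonpos.2 (antitone_ind_Arm F N (by rw [update_le_update_iff]; simp))) ω
        rwa [Ex_const] at this
      have := mul_le_mul_of_nonpos_right (interp_infl hp hν hν1 ht e) hneg
      linarith
    refine (Finset.sum_le_sum hterm).trans ?_
    rw [← Finset.mul_sum]
    change h t * (1 - h t) ≤ _ at ho
    set infl := ∑ e ∈ S, Ex (interp p ν t) S (fun ω => |g ω - ave (interp p ν t) e g ω|) ω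
    have h1 : h t * c ≤ 4 * ε * infl := le_trans (by nlinarith) ho
    have h2 : lam * h t = ν / 2 * (h t * c / (4 * ε)) := by
      simp only [lam]; field_simp; ring
    have h3 : h t * c / (4 * ε) ≤ infl := by
      rw [div_le_iff₀ (by positivity)]; linarith
    have := mul_le_mul_of_nonneg_left h3 (show 0 ≤ ν / 2 by positivity)
    linarith
  have hanti : AntitoneOn (fun t => h t * Real.exp (lam * t)) (Icc 0 1) := by
    have hd : ∀ t, HasDerivAt (fun t => h t * Real.exp (lam * t)) _ t := fun t =>
      (hder t).mul (((hasDerivAt_id t).const_mul lam).exp)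
    refine antitoneOn_of_deriv_nonpos (convex_Icc 0 1)
      (fun t _ => (hd t).continuousAt.continuousWithinAt)
      (fun t _ => (hd t).differentiableAt.differentiableWithinAt) ?_
    intro t ht
    rw [interior_Icc] at ht
    rw [(hd t).deriv]
    have := hdle t ⟨ht.1.le, ht.2.le⟩
    have hexp := Real.exp_pos (lam * t)
    simp only [id, mul_one]
    nlinarith
  have h01 := hanti (by simp : (0 : ℝ) ∈ Icc 0 1) (by simp : (1 : ℝ) ∈ Icc 0 1) zero_le_one
  have hh0 : h 0 ≤ 1 := by
    have := Ex_mono (fun e => (hq 0 (by simp) e).2) S (f := g) (g := fun _ => 1)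
      (fun ω => (ind_mem_Icc _ ω).2) ω
    rwa [Ex_const] at this
  have hh1 : h 1 = Ex (enh p ν) S g ω := by
    have : interp p ν 1 = enh p ν := by funext e; simp [interp]
    simp only [h, this]
  simp only [mul_one, mul_zero, Real.exp_zero] at h01
  rw [← hh1, Real.exp_neg, ← one_div, le_div_iff₀ (Real.exp_pos _)]
  exact h01.trans hh0

end Decay

section ArmDecay

variable {p : TriE → ℝ} {P : Measure (Config TriE)}

lemma enh_min (hp : ∀ e, p e ∈ Icc (0 : ℝ) 1) (ν : ℝ) : enh p (min ν 1) = enh p ν := by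
  funext e
  have := (hp e).1
  simp only [enh]
  split_ifs with h
  · rfl
  · rcases min_cases ν 1 with ⟨h1, _⟩ | ⟨h1, _⟩ <;> rw [h1]
    rw [min_eq_right (by linarith), min_eq_right (by linarith)]

lemma exp_neg_le_factorial {x : ℝ} (hx : 0 < x) (k : ℕ) :
    Real.exp (-x) ≤ (k.factorial : ℝ) / x ^ k := by
  have h := Real.pow_div_factorial_le_exp x hx.le k
  rw [Real.exp_neg, ← one_div, div_le_div_iff₀ (Real.exp_pos _) (by positivity), one_mul]
  rwa [div_le_iff₀ (by positivity), mul_comm] at h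

lemma RingBound.arm_decay (hp : ∀ e, p e ∈ Icc (0 : ℝ) 1) (hP : IsBernoulliProduct p P) {N₀ : ℤ}
    {c ν : ℝ} (hc : 0 < c) (hc1 : c < 1) (h : RingBound P N₀ c) (hν : 0 < ν) (hν1 : ν ≤ 1) :
    ∃ C : ℝ, 0 < C ∧ ∀ Po, IsBernoulliProduct (enh p ν) Po → ∀ F (N : ℕ), 1 ≤ N →
      Po (Arm F N) ≤ ENNReal.ofReal (C / N ^ 2) := by
  set q := 1 - c
  have hq : 0 < q := by simp only [q]; linarith
  have hq1 : q < 1 := by simp only [q]; linarith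
  set m : ℕ := max N₀.toNat 2
  have hm0 : N₀ ≤ (m : ℤ) := by omega
  have hm2 : 2 ≤ m := le_max_right _ _
  obtain ⟨L, hL⟩ := exists_nat_ge (16 / q)
  have hLq : 16 ≤ L * q := by rwa [div_le_iff₀ hq] at hL
  have hL16 : 16 ≤ L := by
    have : (16 : ℝ) ≤ L := hLq.trans (mul_le_of_le_one_right (by positivity) hq1.le)
    exact_mod_cast this
  have hLpos : (0 : ℝ) < L := by positivity
  obtain ⟨k, hk⟩ := exists_pow_lt_of_lt_one (show (0 : ℝ) < 1 / L ^ 2 by positivity) hq1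
  set κ := ν * c / 8
  have hκ : 0 < κ := by positivity
  set K : ℕ := 8 * m
  have hK : 0 < K := by omega
  have hKr : (0 : ℝ) < K := by exact_mod_cast hK
  set B : ℝ := (k.factorial : ℝ) / κ ^ k
  have hB : 0 < B := by positivity
  refine ⟨(K * L) ^ 2 * (1 + B), by positivity, fun Po hPo F N hN => ?_⟩
  have hNr : (0 : ℝ) < N := by exact_mod_cast hN
  have := hPo.1
  rcases lt_or_ge N (K * L) with hlt | hge
  · refine prob_le_one.trans ?_
    rw [← ENNReal.ofReal_one]
    apply ENNReal.ofReal_le_ofReal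
    rw [le_div_iff₀ (by positivity), one_mul]
    have h1 : (N : ℝ) ≤ K * L := by exact_mod_cast hlt.le
    have h2 : (N : ℝ) ^ 2 ≤ (K * L) ^ 2 := by gcongr
    refine h2.trans (le_mul_of_one_le_right (by positivity) (by linarith))
  have hL1 : 1 < L := by omega
  have hdiv : L ≤ N / K := (Nat.le_div_iff_mul_le hK).2 (by rwa [mul_comm])
  set j := Nat.log L (N / K)
  have hj : 1 ≤ j := Nat.log_pos hL1 hdiv
  have hjN : K * L ^ j ≤ N := by
    have := Nat.pow_log_le_self L (x := N / K) (by omega)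
    rw [mul_comm]
    exact (Nat.le_div_iff_mul_le hK).1 this
  have hNj : N < K * L ^ (j + 1) := by
    have := Nat.lt_pow_succ_log_self hL1 (N / K)
    rw [mul_comm]
    exact (Nat.div_lt_iff_lt_mul hK).1 this
  have hjNr : (K : ℝ) * L ^ j ≤ N := by exact_mod_cast hjN
  have hNjr : (N : ℝ) ≤ K * L ^ (j + 1) := by exact_mod_cast hNj.le
  have ω : Config TriE := fun _ => true
  have hqj : 0 < q ^ j := by positivity
  have main := arm_enh hp hP (R := 4 * (m * 16 ^ j)) (N := N) (ε := q ^ j) (c := c) hqj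
    (fun F r hr => h.arm hp hP hc1.le hm0 (by exact_mod_cast hm2) F (by exact_mod_cast hr))
    (by
      have h16 : (16 : ℝ) ^ j ≤ (L * q) ^ j := by gcongr
      have h1 : (m : ℝ) * 16 ^ j ≤ m * (L * q) ^ j := by gcongr
      have h2 : q ^ j * (K * L ^ j) ≤ q ^ j * N := by gcongr
      have h3 : q ^ j * (K * L ^ j) = 8 * (m * (L * q) ^ j) := by
        simp only [K]; push_cast; rw [mul_pow]; ring
      push_cast
      nlinarith)
    hν hν1 F hc1.le
    (by
      have hlow : 4 * (m * 16 ^ 1) ≤ N := by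
        have : K * 16 ≤ K * L ^ j :=
          Nat.mul_le_mul_left _ (hL16.trans (Nat.le_self_pow (by omega) L))
        omega
      have := h.arm hp hP hc1.le hm0 (by exact_mod_cast hm2) F (r := N) (J := 1)
        (by exact_mod_cast hlow)
      simpa using this) ω
  rw [prob_eq (enh_mem hp hν) hPo (supp_Arm F N) ω]
  apply ENNReal.ofReal_le_ofReal
  refine main.trans ?_
  have hx : ν * c / (8 * q ^ j) = κ / q ^ j := by simp only [κ]; field_simp
  rw [hx]
  refine (exp_neg_le_factorial (div_pos hκ hqj) k).trans ?_
  have e1 : (k.factorial : ℝ) / (κ / q ^ j) ^ k = B * (q ^ k) ^ j := by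
    simp only [B]
    rw [div_pow, div_div_eq_mul_div, ← pow_mul, ← pow_mul, mul_comm j k]
    ring
  have e2 : (q ^ k) ^ j ≤ (1 / (L : ℝ) ^ 2) ^ j := by gcongr
  have e3 : (1 / (L : ℝ) ^ 2) ^ j = (K * L) ^ 2 / (K * L ^ (j + 1)) ^ 2 := by
    rw [div_pow, one_pow]
    field_simp
    ring
  have e4 : ((K : ℝ) * L) ^ 2 / (K * L ^ (j + 1)) ^ 2 ≤ (K * L) ^ 2 / N ^ 2 := by gcongr
  rw [e1]
  calc B * (q ^ k) ^ j ≤ B * ((K * L) ^ 2 / N ^ 2) := by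
        gcongr
        exact e2.trans (e3.le.trans e4)
    _ = (K * L) ^ 2 * B / N ^ 2 := by ring
    _ ≤ _ := by gcongr; linarith

end ArmDecay

section Koenig

variable {V : Type} {R : V → V → Prop}

lemma PathIn.leave {S : Set V} {x u : V} (h : PathIn R S x u) (hu : u ≠ x) :
    ∃ y, R x y ∧ PathIn R (S \ {x}) y u := by
  induction h using PathIn.ind with
  | base h => exact absurd rfl hu
  | step z w hz hzw hw ih =>
    by_cases hzx : z = x
    · subst hzx
      exact ⟨w, hzw, .refl ⟨hw, hu⟩⟩
    · obtain ⟨y, hy, hp⟩ := ih hzx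
      exact ⟨y, hy, hp.step hzw ⟨hw, hu⟩⟩

lemma exists_next (hfin : ∀ x, {y | R x y}.Finite) {S : Set V} {x : V}
    (h : {u | PathIn R S x u}.Infinite) :
    ∃ y, R x y ∧ {u | PathIn R (S \ {x}) y u}.Infinite := by
  by_contra! hcon
  refine h (((finite_singleton x).union ((hfin x).biUnion fun y hy =>
    hcon y hy)).subset ?_)
  intro u hu
  by_cases hux : u = x
  · exact .inl hux
  · obtain ⟨y, hy, hp⟩ := PathIn.leave hu hux
    exact .inr (mem_biUnion hy hp)

/-- König's lemma. -/
lemma exists_ray (hfin : ∀ x, {y | R x y}.Finite) {v : V}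
    (h : {u | PathIn R univ v u}.Infinite) :
    ∃ γ : ℕ → V, γ 0 = v ∧ Function.Injective γ ∧ ∀ n, R (γ n) (γ (n + 1)) := by
  let St := {s : Set V × V // {u | PathIn R s.1 s.2 u}.Infinite}
  choose nxt hR hinf using fun s : St => exists_next hfin s.2
  let σ : ℕ → St := fun n => Nat.rec ⟨(univ, v), h⟩ (fun _ s => ⟨(s.1.1 \ {s.1.2}, nxt s), hinf s⟩) n
  have hmem : ∀ n, (σ n).1.2 ∈ (σ n).1.1 := fun n => by
    obtain ⟨u, hu⟩ := (σ n).2.nonempty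
    exact hu.1
  have hsucc : ∀ n, (σ (n + 1)).1.1 = (σ n).1.1 \ {(σ n).1.2} := fun _ => rfl
  have hav : ∀ m k, (σ m).1.2 ∉ (σ (m + 1 + k)).1.1 := by
    intro m k
    induction k with
    | zero => simp [hsucc]
    | succ k ih => exact fun h => ih ((hsucc (m + 1 + k)).subset h).1
  have hne : ∀ m n, m < n → (σ m).1.2 ≠ (σ n).1.2 := by
    intro m n hmn heq
    obtain ⟨k, rfl⟩ := Nat.exists_eq_add_of_le (Nat.succ_le_of_lt hmn)
    exact hav m k (heq ▸ hmem _)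
  refine ⟨fun n => (σ n).1.2, rfl, fun m n hmn => ?_, fun n => hR (σ n)⟩
  rcases lt_trichotomy m n with h | h | h
  exacts [absurd hmn (hne _ _ h), h, absurd hmn.symm (hne _ _ h)]

lemma finite_TA (ω : Config TriE) (x : Vtx) : {y | TA ω x y}.Finite :=
  (finite_dV_le x 1).subset fun y hy => by
    have := dV_step (v := x) hy
    rw [dV_self] at this
    simpa using this

lemma exists_open_ray {ω : Config TriE} {v : Vtx} (h : (clus ω v).Infinite) :
    ∃ γ : ℕ → Vtx, γ 0 = v ∧ Function.Injective γ ∧ ∀ n, TA ω (γ n) (γ (n + 1)) :=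
  exists_ray (finite_TA ω) h

end Koenig

section Percolation

variable {Po : Measure (Config TriE)} {C : ℝ}

lemma clus_closed {ω : Config TriE} {v : Vtx} {e : TriE} (he : ω e = true) :
    (te e).1 ∈ clus ω v ↔ (te e).2 ∈ clus ω v :=
  ⟨fun h => PathIn.step h ⟨e, he, .inl rfl⟩ trivial, fun h => PathIn.step h ⟨e, he, .inr rfl⟩ trivial⟩

lemma prob_all_finite (h : ∀ F (N : ℕ), 1 ≤ N → Po (Arm F N) ≤ ENNReal.ofReal (C / N ^ 2))
    {M : ℕ} (hM : 1 ≤ M) (v : Vtx) :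
    Po {ω | ∀ i : ℕ, i ≤ M → (clus ω (v.1 + i, v.2)).Finite} ≤
      ∑' k : ℕ, ENNReal.ofReal (C / ((k + M : ℕ) : ℝ) ^ 2) := by
  have hsub : {ω | ∀ i : ℕ, i ≤ M → (clus ω (v.1 + i, v.2)).Finite} ⊆
      ⋃ k : ℕ, Arm (v.1 + (k + M : ℕ), v.2, true) (k + M) := by
    intro ω hω
    have hfin : (⋃ i ∈ Iic M, clus ω (v.1 + (i : ℕ), v.2)).Finite :=
      (finite_Iic M).biUnion hω
    obtain ⟨r, hr, G, hG, hd⟩ := peierls (ω := ω) (v := v) (M := M) hfin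
      (fun i hi => mem_biUnion (x := i) hi (PathIn.refl trivial))
      (fun e he => by simp only [mem_iUnion, clus_closed he])
    obtain ⟨k, rfl⟩ := Nat.exists_eq_add_of_le' hr
    refine mem_iUnion.2 ⟨k, mem_Arm_of_path (hG.2.lift id fun _ _ h => h.1) hd⟩
  refine (measure_mono hsub).trans ((measure_iUnion_le _).trans ?_)
  exact ENNReal.tsum_le_tsum fun k => h _ _ (by omega)

lemma tendsto_tail (C : ℝ) : Filter.Tendsto (fun M : ℕ =>
    ∑' k : ℕ, ENNReal.ofReal (C / ((k + M : ℕ) : ℝ) ^ 2)) Filter.atTop (nhds 0) := by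
  refine ENNReal.tendsto_sum_nat_add (fun k : ℕ => ENNReal.ofReal (C / (k : ℝ) ^ 2)) ?_
  have : Summable fun k : ℕ => C / (k : ℝ) ^ 2 := by
    simpa [div_eq_mul_inv] using (Real.summable_nat_pow_inv.2 one_lt_two).mul_left C
  exact this.tsum_ofReal_ne_top

lemma percolates (C : ℝ) : ∃ α : ℝ, 0 < α ∧ ∃ M : ℕ, ∀ Po : Measure (Config TriE),
    IsProbabilityMeasure Po →
    (∀ F (N : ℕ), 1 ≤ N → Po (Arm F N) ≤ ENNReal.ofReal (C / N ^ 2)) → ∀ v, ∃ w, dV v w ≤ M ∧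
      ENNReal.ofReal α < Po {ω | (clus ω w).Infinite} := by
  obtain ⟨M, hM1, hM⟩ := (((tendsto_tail C).eventually_le_const
    (u := ENNReal.ofReal (1 / 2)) (by simp)).and (Filter.eventually_ge_atTop 1)).exists
  refine ⟨1 / 2 / (M + 2), by positivity, M, fun Po hPo h v => ?_⟩
  by_contra! hcon
  have hcov : (univ : Set (Config TriE)) ⊆
      {ω | ∀ i : ℕ, i ≤ M → (clus ω (v.1 + i, v.2)).Finite} ∪
        ⋃ i ∈ Finset.range (M + 1), {ω | (clus ω (v.1 + (i : ℕ), v.2)).Infinite} := by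
    intro ω _
    by_cases hω : ∀ i : ℕ, i ≤ M → (clus ω (v.1 + i, v.2)).Finite
    · exact .inl hω
    · push Not at hω
      obtain ⟨i, hi, hinf⟩ := hω
      exact .inr (mem_biUnion (x := i) (by simp; omega) hinf)
  have h1 := (measure_mono (μ := Po) hcov).trans (measure_union_le _ _)
  rw [measure_univ] at h1
  have h2 := (measure_biUnion_finset_le (μ := Po) (Finset.range (M + 1))
    fun i => {ω | (clus ω (v.1 + (i : ℕ), v.2)).Infinite})
  have h3 : ∑ i ∈ Finset.range (M + 1), Po {ω | (clus ω (v.1 + (i : ℕ), v.2)).Infinite} ≤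
      ∑ i ∈ Finset.range (M + 1), ENNReal.ofReal (1 / 2 / (M + 2)) :=
    Finset.sum_le_sum fun i hi => hcon _ (by
      have := Finset.mem_range.1 hi
      simp only [dV]; omega)
  rw [Finset.sum_const, Finset.card_range, nsmul_eq_mul, ← ENNReal.ofReal_natCast,
    ← ENNReal.ofReal_mul (by positivity)] at h3
  have h4 := h1.trans (add_le_add ((prob_all_finite h hM v).trans hM1) (h2.trans h3))
  rw [← ENNReal.ofReal_add (by positivity) (by positivity), ← ENNReal.ofReal_one,
    ENNReal.ofReal_le_ofReal_iff (by positivity)] at h4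
  have : ((M + 1 : ℕ) : ℝ) * (1 / 2 / (M + 2)) < 1 / 2 := by
    rw [mul_div_assoc', div_lt_iff₀ (by positivity)]
    push_cast
    linarith
  linarith

lemma percolates_ae (h : ∀ F (N : ℕ), 1 ≤ N → Po (Arm F N) ≤ ENNReal.ofReal (C / N ^ 2)) :
    Po {ω | ∃ v, (clus ω v).Infinite}ᶜ = 0 := by
  refine le_antisymm (ge_of_tendsto (tendsto_tail C) ?_) bot_le
  filter_upwards [Filter.eventually_ge_atTop 1] with M hM
  refine (measure_mono ?_).trans (prob_all_finite h hM (0, 0))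
  intro ω hω i _
  by_contra hinf
  exact hω ⟨_, hinf⟩

end Percolation

section Supercritical

lemma prob_one_of_compl {Ω : Type} [MeasurableSpace Ω] {P : Measure Ω} [IsProbabilityMeasure P]
    {A : Set Ω} (h : P Aᶜ = 0) : P A = 1 := by
  refine le_antisymm prob_le_one ?_
  calc (1 : ENNReal) = P (A ∪ Aᶜ) := by rw [union_compl_self, measure_univ]
    _ ≤ P A := (measure_union_le _ _).trans (by rw [h, add_zero])

variable {p : TriE → ℝ} {P : Measure (Config TriE)}

lemma CrossBound.exists_ringBound (hp : ∀ e, p e ∈ Icc (0 : ℝ) 1) (hP : IsBernoulliProduct p P)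
    {N₀ : ℤ} {δ : ℝ} (hδ : 0 < δ) (h : CrossBound P N₀ δ) :
    ∃ N₁ : ℤ, 1 ≤ N₁ ∧ RingBound P N₁ (δ ^ 4) :=
  ⟨max N₀ 1, le_max_right _ _, fun m hm =>
    h.ringBound hp hP hδ.le m (le_trans (le_max_left _ _) hm)⟩

lemma CrossBound.percolation (hp : ∀ e, p e ∈ Icc (0 : ℝ) 1) (hP : IsBernoulliProduct p P)
    {N₀ : ℤ} {δ : ℝ} (hδ : 0 < δ) (hδ1 : δ < 1) (h : CrossBound P N₀ δ) {ν : ℝ} (hν : 0 < ν) :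
    ∃ α : ℝ, 0 < α ∧ ∃ M : ℕ, ∀ Po : Measure (Config TriE), IsBernoulliProduct (enh p ν) Po →
      (∀ v, ∃ w, dV v w ≤ M ∧ ENNReal.ofReal α < Po {ω | (clus ω w).Infinite}) ∧
      Po {ω | ∃ v, (clus ω v).Infinite ∧ ∀ u, (clus ω u).Infinite → clus ω u = clus ω v} = 1 := by
  obtain ⟨N₁, hN₁, hR⟩ := h.exists_ringBound hp hP hδ
  have hc1 : δ ^ 4 < 1 := pow_lt_one₀ hδ.le hδ1 (by norm_num)
  obtain ⟨C, -, hC⟩ := hR.arm_decay hp hP (by positivity) hc1 (lt_min hν one_pos) (min_le_right ν 1)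
  rw [enh_min hp] at hC
  obtain ⟨α, hα, M, hM⟩ := percolates C
  refine ⟨α, hα, M, fun Po hPo => ⟨hM Po hPo.1 (hC Po hPo), ?_⟩⟩
  have := hPo.1
  have h1 := percolates_ae (hC Po hPo)
  have h2 := (hR.mono hp (enh_mem hp hν) hP hPo (enh_ge hp hν) hN₁).unique (enh_mem hp hν) hPo
    (by positivity) hc1.le
  refine prob_one_of_compl ?_
  refine measure_mono_null ?_ (measure_union_null h1 h2)
  intro ω hω
  by_contra hcon
  rw [mem_union, not_or, mem_compl_iff, mem_compl_iff, not_not, not_not] at hcon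
  obtain ⟨⟨v, hv⟩, huniq⟩ := hcon
  refine hω ⟨v, hv, fun u hu => ?_⟩
  ext z
  exact ⟨fun hz => (huniq v u hv hu).trans hz, fun hz => (huniq u v hu hv).trans hz⟩

end Supercritical

section Transfer

variable {E : Type} {L : LatticeOn E}

/-- A realisation of a planar lattice as a sublattice of the triangular lattice with all its
vertices, up to bounded distortion of distances. -/
structure TriEmb (L : LatticeOn E) where
  pos : Vtx → Pt
  edge : E → TriE
  edge_inj : Function.Injective edge
  ends_eq : ∀ e, L.ends e = (pos (te (edge e)).1, pos (te (edge e)).2) ∨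
    L.ends e = (pos (te (edge e)).2, pos (te (edge e)).1)
  pos_mem : ∀ u, pos u ∈ vertexSet L
  edist_le : ∀ u v, edist2 (pos u) (pos v) ≤ 5 * dV u v
  le_edist : ∀ u v, (dV u v : ℝ) ≤ 4 * edist2 (pos u) (pos v)

namespace TriEmb

variable (T : TriEmb L)

lemma pos_inj : Function.Injective T.pos := by
  intro u v h
  have h1 := T.le_edist u v
  rw [h] at h1
  simp only [edist2, sub_self, ne_eq, OfNat.ofNat_ne_zero, not_false_eq_true, zero_pow, add_zero,
    Real.sqrt_zero, mul_zero] at h1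
  have h2 : dV u v ≤ 0 := by exact_mod_cast h1
  simp only [dV] at h2
  ext <;> omega

/-- The configuration of the triangular lattice induced by a configuration of a sublattice. -/
noncomputable def ext (ω : Config E) : Config TriE := Function.extend T.edge ω fun _ => false

lemma ext_edge (ω : Config E) (e : E) : T.ext ω (T.edge e) = ω e := T.edge_inj.extend_apply _ _ _

lemma ext_of_notMem (ω : Config E) {e : TriE} (he : e ∉ range T.edge) : T.ext ω e = false :=
  Function.extend_apply' _ _ _ he

lemma measurableEmbedding_ext : MeasurableEmbedding T.ext := by
  refine .of_measurable_inverse (g := fun ω' e => ω' (T.edge e)) ?_ ?_ ?_ fun ω => ?_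
  · refine measurable_pi_iff.2 fun e => ?_
    by_cases he : e ∈ range T.edge
    · obtain ⟨e, rfl⟩ := he
      simpa only [ext_edge] using measurable_pi_apply e
    · simp only [T.ext_of_notMem _ he, measurable_const]
  · have : range T.ext = ⋂ e ∈ (range T.edge)ᶜ, {ω | ω e = false} := by
      ext ω
      simp only [mem_iInter]
      constructor
      · rintro ⟨ω, rfl⟩ e he
        exact T.ext_of_notMem ω he
      · refine fun h => ⟨fun e => ω (T.edge e), funext fun e => ?_⟩
        by_cases he : e ∈ range T.edge
        · obtain ⟨e, rfl⟩ := he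
          rw [ext_edge]
        · rw [T.ext_of_notMem _ he]
          exact (h e he).symm
    rw [this]
    exact MeasurableSet.biInter (to_countable _) fun e _ =>
      (measurable_pi_apply (X := fun _ : TriE => Bool) e) (measurableSet_singleton false)
  · exact measurable_pi_iff.2 fun e => measurable_pi_apply _
  · funext e
    exact T.ext_edge ω e

lemma map_apply (P : Measure (Config E)) (A : Set (Config TriE)) :
    P.map T.ext A = P {ω | T.ext ω ∈ A} := T.measurableEmbedding_ext.map_apply P A

/-- Intensities extended by zero. -/
noncomputable def ext₀ (p : E → ℝ) : TriE → ℝ := Function.extend T.edge p fun _ => 0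

lemma ext₀_edge (p : E → ℝ) (e : E) : T.ext₀ p (T.edge e) = p e := T.edge_inj.extend_apply _ _ _

lemma ext₀_of_notMem (p : E → ℝ) {e : TriE} (he : e ∉ range T.edge) : T.ext₀ p e = 0 :=
  Function.extend_apply' _ _ _ he

lemma ext₀_mem {p : E → ℝ} (hp : ∀ e, p e ∈ Icc (0 : ℝ) 1) (e : TriE) :
    T.ext₀ p e ∈ Icc (0 : ℝ) 1 := by
  by_cases he : e ∈ range T.edge
  · obtain ⟨e, rfl⟩ := he
    rw [ext₀_edge]
    exact hp e
  · rw [T.ext₀_of_notMem _ he]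
    simp

lemma ext₀_enh (p : E → ℝ) (ν : ℝ) :
    T.ext₀ (fun e => if p e = 0 then 0 else min (p e + ν) 1) = enh (T.ext₀ p) ν := by
  funext e
  by_cases he : e ∈ range T.edge
  · obtain ⟨e, rfl⟩ := he
    simp only [ext₀_edge, enh]
  · simp only [T.ext₀_of_notMem _ he, enh, if_true]

lemma isBernoulliProduct {p : E → ℝ} {P : Measure (Config E)} (hP : IsBernoulliProduct p P) :
    IsBernoulliProduct (T.ext₀ p) (P.map T.ext) := by
  classical
  have := hP.1
  refine ⟨Measure.isProbabilityMeasure_map T.measurableEmbedding_ext.measurable.aemeasurable,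
    fun s f => ?_⟩
  rw [T.map_apply]
  by_cases h : ∃ e ∈ s, e ∉ range T.edge ∧ f e = true
  · obtain ⟨e, hes, he, hf⟩ := h
    rw [Finset.prod_eq_zero hes (by rw [T.ext₀_of_notMem _ he, hf]; simp)]
    convert measure_empty (μ := P)
    refine eq_empty_of_forall_notMem fun ω hω => ?_
    have := hω e hes
    rw [T.ext_of_notMem _ he, hf] at this
    exact absurd this (by simp)
  · push Not at h
    rw [← Finset.prod_preimage T.edge s T.edge_inj.injOn]
    · simp only [ext₀_edge]
      rw [← hP.2]
      congr 1
      ext ω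
      simp only [mem_ofPred_eq, Finset.mem_preimage]
      refine ⟨fun hω e he => (T.ext_edge ω e).symm.trans (hω _ he), fun hω e he => ?_⟩
      by_cases her : e ∈ range T.edge
      · obtain ⟨e, rfl⟩ := her
        exact (T.ext_edge ω e).trans (hω e he)
      · rw [T.ext_of_notMem _ her]
        exact (Bool.eq_false_iff.2 (h e he her)).symm
    · intro e he her
      rw [T.ext₀_of_notMem _ her, Bool.eq_false_iff.2 (h e he her)]
      simp

lemma openAdj_iff {ω : Config E} {x y : Pt} :
    openAdj L ω x y ↔ ∃ u v, T.pos u = x ∧ T.pos v = y ∧ TA (T.ext ω) u v := by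
  constructor
  · rintro ⟨e, he, h⟩
    have he' := (T.ext_edge ω e).trans he
    rcases T.ends_eq e with h' | h' <;> rw [h'] at h <;>
      rcases h with h | h <;> obtain ⟨h1, h2⟩ := Prod.ext_iff.1 h
    exacts [⟨_, _, h1, h2, _, he', .inl rfl⟩, ⟨_, _, h2, h1, _, he', .inr rfl⟩,
      ⟨_, _, h1, h2, _, he', .inr rfl⟩, ⟨_, _, h2, h1, _, he', .inl rfl⟩]
  · rintro ⟨u, v, rfl, rfl, e, he, h⟩
    have her : e ∈ range T.edge := by
      by_contra her
      rw [T.ext_of_notMem _ her] at he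
      exact absurd he (by simp)
    obtain ⟨e, rfl⟩ := her
    rw [ext_edge] at he
    refine ⟨e, he, ?_⟩
    rcases T.ends_eq e with h' | h' <;> rcases h with h | h <;> rw [h', h] <;> simp

lemma cluster_eq (ω : Config E) (u : Vtx) :
    cluster L ω (T.pos u) = T.pos '' clus (T.ext ω) u := by
  ext x
  constructor
  · intro h
    induction h with
    | refl => exact ⟨u, .refl trivial, rfl⟩
    | tail _ h ih =>
      obtain ⟨v, hv, rfl⟩ := ih
      obtain ⟨v', w, hv', rfl, hvw⟩ := T.openAdj_iff.1 h
      rw [T.pos_inj hv'] at hvw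
      exact ⟨w, PathIn.step hv hvw trivial, rfl⟩
  · rintro ⟨v, hv, rfl⟩
    exact hv.2.lift T.pos fun x y h => T.openAdj_iff.2 ⟨x, y, rfl, rfl, h.1⟩

lemma infinite_cluster_iff {ω : Config E} {u : Vtx} :
    (cluster L ω (T.pos u)).Infinite ↔ (clus (T.ext ω) u).Infinite := by
  rw [cluster_eq, infinite_image_iff T.pos_inj.injOn]

lemma exists_pos_eq {x : Pt} (hx : x ∈ vertexSet L) : ∃ u, T.pos u = x := by
  obtain ⟨e, he⟩ := mem_iUnion.1 hx
  rcases T.ends_eq e with h | h <;> rw [h] at he <;> rcases he with rfl | rfl <;> exact ⟨_, rfl⟩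

lemma connToInfinity {ω : Config E} {u : Vtx} (h : (clus (T.ext ω) u).Infinite) :
    ConnToInfinity L ω (T.pos u) := by
  obtain ⟨γ, h0, hi, hγ⟩ := exists_open_ray h
  exact ⟨fun n => T.pos (γ n), congrArg T.pos h0, T.pos_inj.comp hi,
    fun n => T.openAdj_iff.2 ⟨_, _, rfl, rfl, hγ n⟩⟩

lemma edist_le_of_dV {u v : Vtx} {M : ℕ} (h : dV u v ≤ M) :
    edist2 (T.pos u) (T.pos v) ≤ (5 * M : ℕ) := by
  have h' : (dV u v : ℝ) ≤ M := by exact_mod_cast h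
  push_cast
  linarith [T.edist_le u v]

theorem supercriticality
    (h : ∀ p : E → ℝ, (∀ e, p e ∈ Icc (0 : ℝ) 1) → ∀ P, IsBernoulliProduct p P →
      BoxCrossingProperty L P →
      ∃ (N₀ : ℤ) (δ : ℝ), 0 < δ ∧ δ < 1 ∧ CrossBound (P.map T.ext) N₀ δ) :
    SupercriticalityViaBXP L := by
  intro p hp P hP hbox
  obtain ⟨N₀, δ, hδ, hδ1, hC⟩ := h p hp P hP hbox
  refine ⟨?_, fun ν hν => ?_⟩
  · obtain ⟨a, ha, b, hb, M, hM⟩ := hC.radius (T.ext₀_mem hp) (T.isBernoulliProduct hP) hδ hδ1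
    refine ⟨a * 4 ^ (-b), by positivity, b, hb, 5 * M, fun x hx => ?_⟩
    obtain ⟨v, rfl⟩ := T.exists_pos_eq hx
    obtain ⟨w, hvw, hw⟩ := hM v
    refine ⟨T.pos w, T.pos_mem w, T.edist_le_of_dV hvw, fun k hk => ?_⟩
    have h1 := hw (4 * k) (by omega)
    rw [T.map_apply] at h1
    have h2 : a * 4 ^ (-b) * (k : ℝ) ^ (-b) = a * ((4 * k : ℕ) : ℝ) ^ (-b) := by
      push_cast
      rw [Real.mul_rpow (by norm_num) (by positivity), mul_assoc]
    rw [h2]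
    refine h1.trans (measure_mono ?_)
    rintro ω ⟨u, hu, hku⟩ x hx
    refine ⟨T.pos u, ?_, ?_⟩
    · rw [cluster_eq]
      exact mem_image_of_mem _ hu
    · have h3 := T.le_edist w u
      have h4 : ((4 * k : ℕ) : ℝ) ≤ dV w u := by exact_mod_cast hku
      push_cast at h4
      linarith
  · obtain ⟨α, hα, M, hM⟩ := hC.percolation (T.ext₀_mem hp) (T.isBernoulliProduct hP) hδ hδ1 hν
    refine ⟨α, hα, 5 * M, fun Po hPo => ?_⟩
    have hPo' := T.isBernoulliProduct hPo
    rw [ext₀_enh] at hPo'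
    have := hPo.1
    obtain ⟨h1, h2⟩ := hM _ hPo'
    refine ⟨fun x hx => ?_, le_antisymm prob_le_one ?_⟩
    · obtain ⟨v, rfl⟩ := T.exists_pos_eq hx
      obtain ⟨w, hvw, hw⟩ := h1 v
      rw [T.map_apply] at hw
      exact ⟨T.pos w, T.pos_mem w, T.edist_le_of_dV hvw,
        hw.trans_le (measure_mono fun ω hω => T.connToInfinity hω)⟩
    · rw [T.map_apply] at h2
      rw [← h2]
      refine measure_mono ?_
      rintro ω ⟨v, hv, huniq⟩
      refine ⟨T.pos v, T.pos_mem v, T.infinite_cluster_iff.2 hv, fun x hx hinf => ?_⟩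
      obtain ⟨u, rfl⟩ := T.exists_pos_eq hx
      rw [cluster_eq, cluster_eq, huniq u (T.infinite_cluster_iff.1 hinf)]

end TriEmb

end Transfer

section Discretisation

/-- Sup-distance at most one. -/
def Near (v : Vtx) (c : ℝ × ℝ) : Prop := |(v.1 : ℝ) - c.1| ≤ 1 ∧ |(v.2 : ℝ) - c.2| ≤ 1

lemma finite_edges_box (K : ℤ) :
    {e : TriE | (|(te e).1.1| ≤ K ∧ |(te e).1.2| ≤ K)}.Finite := by
  refine ((finite_Icc (-K - 1) (K + 1)).prod
    ((finite_Icc (-K - 1) (K + 1)).prod (finite_univ (α := Fin 3)))).subset ?_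
  intro e
  induction e using TriE.cases <;>
    simp only [mem_ofPred_eq, te_zero, te_one, te_two, mem_prod, mem_Icc, mem_univ, and_true,
      abs_le] <;> omega

variable {E : Type} {L : LatticeOn E}

/-- The closed segment of an edge. -/
def seg (L : LatticeOn E) (e : E) : Set Pt := segment ℝ (L.ends e).1 (L.ends e).2

lemma isClosed_seg (L : LatticeOn E) (e : E) : IsClosed (seg L e) := by
  rw [seg, segment_eq_image]
  exact (isCompact_Icc.image (by fun_prop)).isClosed

/-- Coordinates in the plane in which a lattice is drawn near the integer coordinates of
its vertices, without crossings. -/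
structure Chart (T : TriEmb L) where
  crd : Pt → ℝ × ℝ
  cont : Continuous crd
  near : ∀ e, ∀ z ∈ seg L e, Near (te (T.edge e)).1 (crd z) ∧ Near (te (T.edge e)).2 (crd z)
  planar : ∀ e f, ∀ z ∈ seg L e, z ∈ seg L f →
    ((te (T.edge e)).1 = (te (T.edge f)).1 ∨ (te (T.edge e)).1 = (te (T.edge f)).2) ∨
      ((te (T.edge e)).2 = (te (T.edge f)).1 ∨ (te (T.edge e)).2 = (te (T.edge f)).2)

variable {T : TriEmb L} (D : Chart T)

namespace Chart

lemma finite_edges (D : Chart T) {γ : ℝ → Pt} (hγ : ContinuousOn γ (Icc 0 1)) :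
    {e | ∃ t ∈ Icc (0 : ℝ) 1, γ t ∈ seg L e}.Finite := by
  have hc : IsCompact ((fun t => D.crd (γ t)) '' Icc (0 : ℝ) 1) :=
    isCompact_Icc.image_of_continuousOn (D.cont.comp_continuousOn hγ)
  obtain ⟨R, hR⟩ := hc.isBounded.exists_norm_le
  refine ((finite_edges_box (⌈R⌉ + 1)).preimage T.edge_inj.injOn).subset ?_
  rintro e ⟨t, ht, hte⟩
  have h1 := (D.near e _ hte).1
  have h2 := hR _ (mem_image_of_mem _ ht)
  rw [Prod.norm_def, max_le_iff, Real.norm_eq_abs, Real.norm_eq_abs] at h2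
  have h3 := Int.le_ceil R
  obtain ⟨⟨h4, h5⟩, h6, h7⟩ := And.intro (abs_le.1 h1.1) (abs_le.1 h1.2)
  obtain ⟨⟨h8, h9⟩, h10, h11⟩ := And.intro (abs_le.1 h2.1) (abs_le.1 h2.2)
  simp only [mem_preimage, mem_ofPred_eq]
  constructor <;> rw [abs_le] <;> constructor <;> rify <;> linarith

/-- A continuous crossing through open edges contains a discrete open path. -/
lemma exists_path {ω : Config E} {S A B : Set Pt} (h : CrossingIn L ω S A B) :
    ∃ u w, PathIn (TA (T.ext ω)) {v | ∃ z ∈ S, Near v (D.crd z)} u w ∧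
      (∃ z ∈ A, Near u (D.crd z)) ∧ ∃ z ∈ B, Near w (D.crd z) := by
  obtain ⟨γ, hγ, hA, hB, hS⟩ := h
  set R : Set Vtx := {v | ∃ z ∈ S, Near v (D.crd z)}
  have hedge : ∀ t ∈ Icc (0 : ℝ) 1, ∃ e, ω e = true ∧ γ t ∈ seg L e := fun t ht => by
    obtain ⟨e, he, hz⟩ := mem_iUnion₂.1 (hS t ht).2
    exact ⟨e, he, hz⟩
  obtain ⟨e₀, he₀, hz₀⟩ := hedge 0 (by simp)
  set u := (te (T.edge e₀)).1
  have hu : u ∈ R := ⟨_, (hS 0 (by simp)).1, (D.near e₀ _ hz₀).1⟩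
  set X : Set Vtx := {w | PathIn (TA (T.ext ω)) R u w}
  have hX : ∀ e, ω e = true → ∀ t ∈ Icc (0 : ℝ) 1, γ t ∈ seg L e →
      ((te (T.edge e)).1 ∈ X ↔ (te (T.edge e)).2 ∈ X) := by
    intro e he t ht hz
    have hn := D.near e _ hz
    have he' := (T.ext_edge ω e).trans he
    exact ⟨fun h => PathIn.step h ⟨_, he', .inl rfl⟩ ⟨_, (hS t ht).1, hn.2⟩,
      fun h => PathIn.step h ⟨_, he', .inr rfl⟩ ⟨_, (hS t ht).1, hn.1⟩⟩
  set F := {e | ∃ t ∈ Icc (0 : ℝ) 1, γ t ∈ seg L e}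
  have hF : F.Finite := D.finite_edges hγ
  have hclosed : ∀ Q : E → Prop,
      IsClosed (⋃ e ∈ F ∩ {e | ω e = true ∧ Q e}, Icc (0 : ℝ) 1 ∩ γ ⁻¹' seg L e) := fun Q =>
    (hF.inter_of_left _).isClosed_biUnion fun e _ =>
      hγ.preimage_isClosed_of_isClosed isClosed_Icc (isClosed_seg L e)
  set K : (E → Prop) → Set ℝ := fun Q =>
    ⋃ e ∈ F ∩ {e | ω e = true ∧ Q e}, Icc (0 : ℝ) 1 ∩ γ ⁻¹' seg L e
  have hK : ∀ Q t, t ∈ K Q ↔ t ∈ Icc (0 : ℝ) 1 ∧ ∃ e, ω e = true ∧ Q e ∧ γ t ∈ seg L e := by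
    intro Q t
    simp only [K, mem_iUnion, exists_prop]
    constructor
    · rintro ⟨e, ⟨-, he, hQ⟩, ht, hz⟩
      exact ⟨ht, e, he, hQ, hz⟩
    · rintro ⟨ht, e, he, hQ, hz⟩
      exact ⟨e, ⟨⟨t, ht, hz⟩, he, hQ⟩, ht, hz⟩
  have hall : ∀ t ∈ Icc (0 : ℝ) 1, ∀ e, ω e = true → γ t ∈ seg L e → (te (T.edge e)).1 ∈ X := by
    by_contra! hcon
    obtain ⟨t, ht, e, he, hz, hne⟩ := hcon
    obtain ⟨s, hs, hs1, hs2⟩ := isPreconnected_closed_iff.1 (isPreconnected_Icc (a := (0 : ℝ)) (b := 1))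
      (K fun e => (te (T.edge e)).1 ∈ X) (K fun e => (te (T.edge e)).1 ∉ X)
      (hclosed _) (hclosed _)
      (fun s hs => by
        obtain ⟨e, he, hz⟩ := hedge s hs
        by_cases h : (te (T.edge e)).1 ∈ X
        · exact .inl ((hK _ _).2 ⟨hs, e, he, h, hz⟩)
        · exact .inr ((hK _ _).2 ⟨hs, e, he, h, hz⟩))
      ⟨0, by simp, (hK _ _).2 ⟨by simp, e₀, he₀, PathIn.refl hu, hz₀⟩⟩
      ⟨t, ht, (hK _ _).2 ⟨ht, e, he, hne, hz⟩⟩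
    obtain ⟨-, f, hf, hfX, hzf⟩ := (hK _ _).1 hs1
    obtain ⟨-, g, hg, hgX, hzg⟩ := (hK _ _).1 hs2
    have hfX' := (hX f hf s hs hzf).1 hfX
    have hgX' := mt (hX g hg s hs hzg).2 hgX
    rcases D.planar f g _ hzf hzg with (h | h) | (h | h)
    exacts [hgX (h ▸ hfX), hgX' (h ▸ hfX), hgX (h ▸ hfX'), hgX' (h ▸ hfX')]
  obtain ⟨e₁, he₁, hz₁⟩ := hedge 1 (by simp)
  exact ⟨u, _, hall 1 (by simp) e₁ he₁ hz₁, ⟨_, hA, (D.near e₀ _ hz₀).1⟩,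
    ⟨_, hB, (D.near e₁ _ hz₁).1⟩⟩

/-- Boxes of aspect ratio `20` can be placed across all large horizontal and vertical strips
in the coordinates of the chart. -/
structure Boxes : Prop where
  hor : ∀ (N : ℝ), 10 ≤ N → ∀ x y : ℝ, ∃ f, IsRotTrans f ∧ ∀ z ∈ stdRect (20 * N) N,
    (D.crd (f z) ∈ Icc (x - 9 * N) (x + 19 * N) ×ˢ Icc (y + N / 10) (y + 19 / 10 * N)) ∧
    (z.1 = 0 → (D.crd (f z)).1 ≤ x - N / 10) ∧
    (z.1 = 20 * N → x + 10 * N + N / 10 ≤ (D.crd (f z)).1)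
  ver : ∀ (N : ℝ), 10 ≤ N → ∀ x y : ℝ, ∃ f, IsRotTrans f ∧ ∀ z ∈ stdRect (20 * N) N,
    (D.crd (f z) ∈ Icc (x + N / 10) (x + 19 / 10 * N) ×ˢ Icc (y - 9 * N) (y + 19 * N)) ∧
    (z.1 = 0 → (D.crd (f z)).2 ≤ y - N / 10) ∧
    (z.1 = 20 * N → y + 10 * N + N / 10 ≤ (D.crd (f z)).2)

lemma leftSide_subset {h l : ℝ} (hh : 0 ≤ h) : leftSide h l ⊆ stdRect h l := by
  rintro z ⟨h1, h2, h3⟩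
  exact ⟨h1.ge, h1.trans_le hh, h2, h3⟩

lemma rightSide_subset {h l : ℝ} (hh : 0 ≤ h) : rightSide h l ⊆ stdRect h l := by
  rintro z ⟨h1, h2, h3⟩
  exact ⟨h1.symm ▸ hh, h1.le, h2, h3⟩

variable {D}

lemma Boxes.crossBound (hD : D.Boxes) {P : Measure (Config E)} (hP : BoxCrossingProperty L P) :
    ∃ (N₀ : ℤ) (δ : ℝ), 0 < δ ∧ δ < 1 ∧ CrossBound (P.map T.ext) N₀ δ := by
  obtain ⟨δ, hδ, N₀, hN⟩ := hP 20 (by norm_num)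
  refine ⟨max N₀ 10, min δ (1 / 2), lt_min hδ (by norm_num),
    (min_le_right _ _).trans_lt (by norm_num), fun m hm x y => ?_⟩
  lift m to ℕ using by omega
  have h10 : (10 : ℝ) ≤ m := by
    have : (10 : ℤ) ≤ m := by omega
    exact_mod_cast this
  have hN' := hN m (by omega)
  have h20 : (0 : ℝ) ≤ 20 * m := by positivity
  rw [T.map_apply, T.map_apply]
  constructor
  · obtain ⟨f, hf, hfz⟩ := hD.hor m h10 x y
    refine (ENNReal.ofReal_le_ofReal (min_le_left _ _)).trans ((hN' f hf).trans (measure_mono ?_))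
    rintro ω ⟨hω, -⟩
    obtain ⟨u, w, hp, ⟨_, ⟨z, hz, rfl⟩, hu⟩, _, ⟨z', hz', rfl⟩, hw⟩ := D.exists_path hω
    refine ⟨u, w, hp.mono ?_, ?_, ?_⟩
    · rintro v ⟨_, ⟨z, hz, rfl⟩, hv1, hv2⟩
      obtain ⟨⟨⟨h1, h2⟩, h3, h4⟩, -, -⟩ := hfz z hz
      rw [abs_le] at hv1 hv2
      refine ⟨⟨?_, ?_⟩, ?_, ?_⟩ <;> rify <;> linarith
    · have h := (hfz z (leftSide_subset h20 hz)).2.1 hz.1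
      have hu' := abs_le.1 hu.1
      rify
      linarith
    · have h := (hfz z' (rightSide_subset h20 hz')).2.2 hz'.1
      have hw' := abs_le.1 hw.1
      rify
      linarith
  · obtain ⟨f, hf, hfz⟩ := hD.ver m h10 x y
    refine (ENNReal.ofReal_le_ofReal (min_le_left _ _)).trans ((hN' f hf).trans (measure_mono ?_))
    rintro ω ⟨hω, -⟩
    obtain ⟨u, w, hp, ⟨_, ⟨z, hz, rfl⟩, hu⟩, _, ⟨z', hz', rfl⟩, hw⟩ := D.exists_path hω
    refine ⟨u, w, hp.mono ?_, ?_, ?_⟩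
    · rintro v ⟨_, ⟨z, hz, rfl⟩, hv1, hv2⟩
      obtain ⟨⟨⟨h1, h2⟩, h3, h4⟩, -, -⟩ := hfz z hz
      rw [abs_le] at hv1 hv2
      refine ⟨⟨?_, ?_⟩, ?_, ?_⟩ <;> rify <;> linarith
    · have h := (hfz z (leftSide_subset h20 hz)).2.1 hz.1
      have hu' := abs_le.1 hu.2
      rify
      linarith
    · have h := (hfz z' (rightSide_subset h20 hz')).2.2 hz'.1
      have hw' := abs_le.1 hw.2
      rify
      linarith

lemma Boxes.supercriticality (hD : D.Boxes) : SupercriticalityViaBXP L :=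
  T.supercriticality fun _ _ _ _ hbox => hD.crossBound hbox

end Chart

end Discretisation

section Lattices

lemma edist2_le {u v : Pt} {a b : ℝ} (h1 : |u.1 - v.1| ≤ a) (h2 : |u.2 - v.2| ≤ b) :
    edist2 u v ≤ a + b := by
  have ha := (abs_nonneg _).trans h1
  have hb := (abs_nonneg _).trans h2
  refine Real.sqrt_le_iff.2 ⟨by positivity, ?_⟩
  nlinarith [sq_le_sq' (neg_le_of_abs_le h1) (le_of_abs_le h1),
    sq_le_sq' (neg_le_of_abs_le h2) (le_of_abs_le h2), mul_nonneg ha hb]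

lemma le_edist2 (u v : Pt) : |u.1 - v.1| ≤ edist2 u v ∧ |u.2 - v.2| ≤ edist2 u v :=
  ⟨Real.abs_le_sqrt (by nlinarith [sq_nonneg (u.2 - v.2)]),
    Real.abs_le_sqrt (by nlinarith [sq_nonneg (u.1 - v.1)])⟩

lemma abs_le_dV (u v : Vtx) : |(u.1 : ℝ) - v.1| ≤ dV u v ∧ |(u.2 : ℝ) - v.2| ≤ dV u v := by
  have h : |u.1 - v.1| ≤ dV u v ∧ |u.2 - v.2| ≤ dV u v := by
    simp only [dV, abs_le]; omega
  constructor
  · have := h.1; rify at this; exact this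
  · have := h.2; rify at this; exact this

lemma dV_le {u v : Vtx} {r : ℝ} (h1 : |(u.1 : ℝ) - v.1| ≤ r) (h2 : |(u.2 : ℝ) - v.2| ≤ r) :
    (dV u v : ℝ) ≤ r := by
  rw [abs_le] at h1 h2
  simp only [dV, Int.cast_max, Int.cast_sub, max_le_iff]
  refine ⟨⟨?_, ?_⟩, ?_, ?_⟩ <;> linarith

lemma mem_seg_iff {E : Type} {L : LatticeOn E} {e : E} {z : Pt} : z ∈ seg L e ↔
    ∃ s ∈ Icc (0 : ℝ) 1, z.1 = (1 - s) * (L.ends e).1.1 + s * (L.ends e).2.1 ∧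
      z.2 = (1 - s) * (L.ends e).1.2 + s * (L.ends e).2.2 := by
  rw [seg, segment_eq_image]
  constructor
  · rintro ⟨s, hs, rfl⟩
    exact ⟨s, hs, rfl, rfl⟩
  · rintro ⟨s, hs, h1, h2⟩
    exact ⟨s, hs, Prod.ext h1.symm h2.symm⟩

/-- The segment of an edge of the triangular lattice in integer coordinates. -/
def TriSeg (e : TriE) : Set (ℝ × ℝ) :=
  if e.2.2 = 0 then {z | e.1 ≤ z.1 ∧ z.1 ≤ e.1 + 1 ∧ z.2 = e.2.1}
  else if e.2.2 = 1 then {z | e.1 ≤ z.1 ∧ z.1 ≤ e.1 + 1 ∧ z.1 + z.2 = e.1 + e.2.1 + 1}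
  else {z | z.1 = e.1 ∧ e.2.1 ≤ z.2 ∧ z.2 ≤ e.2.1 + 1}

lemma mem_TriSeg_zero {a b : ℤ} {z : ℝ × ℝ} :
    z ∈ TriSeg (a, b, 0) ↔ a ≤ z.1 ∧ z.1 ≤ a + 1 ∧ z.2 = b := Iff.rfl
lemma mem_TriSeg_one {a b : ℤ} {z : ℝ × ℝ} :
    z ∈ TriSeg (a, b, 1) ↔ a ≤ z.1 ∧ z.1 ≤ a + 1 ∧ z.1 + z.2 = a + b + 1 := Iff.rfl
lemma mem_TriSeg_two {a b : ℤ} {z : ℝ × ℝ} :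
    z ∈ TriSeg (a, b, 2) ↔ z.1 = a ∧ b ≤ z.2 ∧ z.2 ≤ b + 1 := Iff.rfl

lemma TriSeg.near {e : TriE} {z : ℝ × ℝ} (h : z ∈ TriSeg e) :
    Near (te e).1 z ∧ Near (te e).2 z := by
  induction e using TriE.cases <;>
    simp only [mem_TriSeg_zero, mem_TriSeg_one, mem_TriSeg_two] at h <;>
    obtain ⟨h1, h2, h3⟩ := h <;>
    simp only [te_zero, te_one, te_two, Near, abs_le] <;> push_cast <;>
    refine ⟨⟨⟨?_, ?_⟩, ?_, ?_⟩, ⟨?_, ?_⟩, ?_, ?_⟩ <;> linarith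

lemma TriSeg.planar {e f : TriE} {z : ℝ × ℝ} (h : z ∈ TriSeg e) (h' : z ∈ TriSeg f) :
    ((te e).1 = (te f).1 ∨ (te e).1 = (te f).2) ∨ ((te e).2 = (te f).1 ∨ (te e).2 = (te f).2) := by
  obtain ⟨x, y⟩ := z
  induction e using TriE.cases with | _ a b <;> induction f using TriE.cases with | _ c d <;>
    simp only [mem_TriSeg_zero, mem_TriSeg_one, mem_TriSeg_two] at h h' <;>
    simp only [te_zero, te_one, te_two, Prod.mk.injEq]
  · have : b = d ∧ a ≤ c + 1 ∧ c ≤ a + 1 := by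
      refine ⟨?_, ?_, ?_⟩ <;> rify <;> linarith
    omega
  · have : d ≤ b ∧ b ≤ d + 1 ∧ a + b ≤ c + d + 1 ∧ c + d ≤ a + b := by
      refine ⟨?_, ?_, ?_, ?_⟩ <;> rify <;> linarith
    omega
  · have : d ≤ b ∧ b ≤ d + 1 ∧ a ≤ c ∧ c ≤ a + 1 := by
      refine ⟨?_, ?_, ?_, ?_⟩ <;> rify <;> linarith
    omega
  · have : b ≤ d ∧ d ≤ b + 1 ∧ c + d ≤ a + b + 1 ∧ a + b ≤ c + d := by
      refine ⟨?_, ?_, ?_, ?_⟩ <;> rify <;> linarith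
    omega
  · have : a + b = c + d ∧ a ≤ c + 1 ∧ c ≤ a + 1 := by
      refine ⟨?_, ?_, ?_⟩ <;> rify <;> linarith
    omega
  · have : a ≤ c ∧ c ≤ a + 1 ∧ c + d ≤ a + b + 1 ∧ a + b ≤ c + d := by
      refine ⟨?_, ?_, ?_, ?_⟩ <;> rify <;> linarith
    omega
  · have : b ≤ d ∧ d ≤ b + 1 ∧ c ≤ a ∧ a ≤ c + 1 := by
      refine ⟨?_, ?_, ?_, ?_⟩ <;> rify <;> linarith
    omega
  · have : c ≤ a ∧ a ≤ c + 1 ∧ a + b ≤ c + d + 1 ∧ c + d ≤ a + b := by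
      refine ⟨?_, ?_, ?_, ?_⟩ <;> rify <;> linarith
    omega
  · have : a = c ∧ b ≤ d + 1 ∧ d ≤ b + 1 := by
      refine ⟨?_, ?_, ?_⟩ <;> rify <;> linarith
    omega

end Lattices

section SquareTriangular

lemma mem_vertexSet_left {E : Type} (L : LatticeOn E) (e : E) : (L.ends e).1 ∈ vertexSet L :=
  mem_iUnion.2 ⟨e, .inl rfl⟩

lemma mem_vertexSet_right {E : Type} (L : LatticeOn E) (e : E) : (L.ends e).2 ∈ vertexSet L :=
  mem_iUnion.2 ⟨e, .inr rfl⟩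

/-- The square lattice as a sublattice of the triangular lattice. -/
noncomputable def sqEmb : TriEmb sqLattice where
  pos u := (u.1, u.2)
  edge e := (e.1, e.2.1, if e.2.2 then 0 else 2)
  edge_inj := by
    rintro ⟨a, b, _ | _⟩ ⟨c, d, _ | _⟩ h <;> simp_all
  ends_eq := by
    rintro ⟨a, b, _ | _⟩ <;> left <;> simp [sqLattice]
  pos_mem u := mem_vertexSet_left sqLattice (u.1, u.2, false)
  edist_le u v := by
    obtain ⟨h1, h2⟩ := abs_le_dV u v
    have := edist2_le (u := (u.1, u.2)) (v := (v.1, v.2)) h1 h2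
    linarith [(abs_nonneg _).trans h1]
  le_edist u v := by
    obtain ⟨h1, h2⟩ := le_edist2 (u.1, u.2) (v.1, v.2)
    have := dV_le h1 h2
    linarith [(abs_nonneg _).trans h1]

lemma sq_mem_TriSeg {e : SqE} {z : Pt} (hz : z ∈ seg sqLattice e) : z ∈ TriSeg (sqEmb.edge e) := by
  obtain ⟨s, ⟨h0, h1⟩, hx, hy⟩ := mem_seg_iff.1 hz
  obtain ⟨a, b, _ | _⟩ := e <;> simp only [sqLattice, if_true, Bool.false_eq_true, if_false] at hx hy
  · refine mem_TriSeg_two.2 ⟨?_, ?_, ?_⟩ <;> simp only <;> linarith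
  · refine mem_TriSeg_zero.2 ⟨?_, ?_, ?_⟩ <;> simp only <;> linarith

/-- The standard coordinates on the square lattice. -/
def sqChart : Chart sqEmb where
  crd z := z
  cont := continuous_id
  near _ _ hz := TriSeg.near (sq_mem_TriSeg hz)
  planar _ _ _ hz hz' := TriSeg.planar (sq_mem_TriSeg hz) (sq_mem_TriSeg hz')

lemma sqBoxes : sqChart.Boxes where
  hor N hN x y := by
    refine ⟨_, ⟨0, (x - 5 * N, y + N / 2), rfl⟩, ?_⟩
    rintro z ⟨h1, h2, h3, h4⟩
    simp only [sqChart, rot, Real.cos_zero, Real.sin_zero, mem_prod, mem_Icc, Prod.fst_add,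
      Prod.snd_add]
    refine ⟨⟨⟨?_, ?_⟩, ?_, ?_⟩, fun h => ?_, fun h => ?_⟩ <;> linarith
  ver N hN x y := by
    refine ⟨_, ⟨Real.pi / 2, (x + 3 / 2 * N, y - 5 * N), rfl⟩, ?_⟩
    rintro z ⟨h1, h2, h3, h4⟩
    simp only [sqChart, rot, Real.cos_pi_div_two, Real.sin_pi_div_two, mem_prod, mem_Icc,
      Prod.fst_add, Prod.snd_add]
    refine ⟨⟨⟨?_, ?_⟩, ?_, ?_⟩, fun h => ?_, fun h => ?_⟩ <;> linarith

lemma sqrt_three_mul_self : √3 * √3 = (3 : ℝ) := Real.mul_self_sqrt (by norm_num)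

lemma sqrt_three_bounds : 1.73 ≤ √3 ∧ √3 ≤ (1.74 : ℝ) :=
  ⟨Real.le_sqrt_of_sq_le (by norm_num), Real.sqrt_le_iff.2 ⟨by norm_num, by norm_num⟩⟩

lemma abs_le_of_sqrt_three_mul {a x r : ℝ} (h : √3 * a = x) (hx : |x| ≤ r) : |a| ≤ r := by
  have h1 := sqrt_three_bounds.1
  have : |x| = √3 * |a| := by rw [← h, abs_mul, abs_of_pos (by linarith)]
  nlinarith [abs_nonneg a]

/-- The triangular lattice. -/
noncomputable def triEmb : TriEmb triLattice where
  pos u := tv u.1 u.2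
  edge e := e
  edge_inj := Function.injective_id
  ends_eq e := by
    induction e using TriE.cases <;> left <;> rfl
  pos_mem u := mem_vertexSet_left triLattice (u.1, u.2, 0)
  edist_le u v := by
    obtain ⟨h1, h2⟩ := abs_le_dV u v
    have hs := sqrt_three_bounds
    have hd := (abs_nonneg _).trans h1
    rw [abs_le] at h1 h2
    have := edist2_le (u := tv u.1 u.2) (v := tv v.1 v.2) (a := 3 * dV u v) (b := 2 * dV u v) ?_ ?_
    · linarith
    · simp only [tv, ← mul_sub, abs_mul, abs_of_nonneg (Real.sqrt_nonneg 3)]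
      have : |(u.1 + u.2 / 2 - (v.1 + v.2 / 2) : ℝ)| ≤ 3 / 2 * dV u v := by
        rw [abs_le]; constructor <;> linarith
      nlinarith [abs_nonneg (u.1 + u.2 / 2 - (v.1 + v.2 / 2) : ℝ)]
    · simp only [tv, abs_le]
      constructor <;> linarith
  le_edist u v := by
    obtain ⟨h1, h2⟩ := le_edist2 (tv u.1 u.2) (tv v.1 v.2)
    have hd := (abs_nonneg _).trans h1
    have h3 := abs_le_of_sqrt_three_mul (a := u.1 + u.2 / 2 - (v.1 + v.2 / 2))
      (by simp only [tv]; ring) h1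
    change |3 / 2 * (u.2 : ℝ) - 3 / 2 * v.2| ≤ _ at h2
    rw [abs_le] at h2 h3
    refine dV_le (abs_le.2 ⟨?_, ?_⟩) (abs_le.2 ⟨?_, ?_⟩) <;> linarith

lemma tri_mem_TriSeg {e : TriE} {z : Pt} (hz : z ∈ seg triLattice e) :
    ((√3 * z.1 - z.2) / 3, 2 / 3 * z.2) ∈ TriSeg e := by
  obtain ⟨s, ⟨h0, h1⟩, hx, hy⟩ := mem_seg_iff.1 hz
  have h3 := sqrt_three_mul_self
  have he : triLattice.ends e = (tv (te e).1.1 (te e).1.2, tv (te e).2.1 (te e).2.2) := by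
    induction e using TriE.cases <;> rfl
  rw [he] at hx hy
  simp only [tv] at hx hy
  have hz1 : (√3 * z.1 - z.2) / 3 = (1 - s) * (te e).1.1 + s * (te e).2.1 := by
    rw [hx, hy]
    linear_combination ((1 - s) * ((te e).1.1 + (te e).1.2 / 2) +
      s * ((te e).2.1 + (te e).2.2 / 2)) / 3 * h3
  have hz2 : 2 / 3 * z.2 = (1 - s) * (te e).1.2 + s * (te e).2.2 := by
    rw [hy]
    ring
  rw [hz1, hz2]
  clear he hx hy hz1 hz2
  induction e using TriE.cases with
  | h0 a b => exact mem_TriSeg_zero.2 (by simp only [te_zero]; push_cast; refine ⟨?_, ?_, ?_⟩ <;> linarith)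
  | h1 a b => exact mem_TriSeg_one.2 (by simp only [te_one]; push_cast; refine ⟨?_, ?_, ?_⟩ <;> linarith)
  | h2 a b => exact mem_TriSeg_two.2 (by simp only [te_two]; push_cast; refine ⟨?_, ?_, ?_⟩ <;> linarith)

/-- Oblique coordinates on the triangular lattice. -/
noncomputable def triChart : Chart triEmb where
  crd z := ((√3 * z.1 - z.2) / 3, 2 / 3 * z.2)
  cont := by fun_prop
  near _ _ hz := TriSeg.near (tri_mem_TriSeg hz)
  planar _ _ _ hz hz' := TriSeg.planar (tri_mem_TriSeg hz) (tri_mem_TriSeg hz')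

lemma triBoxes : triChart.Boxes where
  hor N hN x y := by
    refine ⟨_, ⟨0, (√3 * (x - N / 2 + (y + N / 2) / 2), 3 / 2 * (y + N / 2)), rfl⟩, ?_⟩
    rintro z ⟨h1, h2, h3, h4⟩
    obtain ⟨hs1, hs2⟩ := sqrt_three_bounds
    have hss := sqrt_three_mul_self
    have hx : (triChart.crd (rot 0 z + (√3 * (x - N / 2 + (y + N / 2) / 2), 3 / 2 * (y + N / 2)))) =
        (x - N / 2 + √3 * z.1 / 3 - z.2 / 3, y + N / 2 + 2 / 3 * z.2) := by
      simp only [triChart, rot, Real.cos_zero, Real.sin_zero, Prod.fst_add, Prod.snd_add,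
        Prod.mk.injEq]
      constructor
      · linear_combination (x - N / 2 + (y + N / 2) / 2) / 3 * hss
      · ring
    rw [hx]
    simp only [mem_prod, mem_Icc]
    refine ⟨⟨⟨?_, ?_⟩, ?_, ?_⟩, fun h => ?_, fun h => ?_⟩
    all_goals nlinarith
  ver N hN x y := by
    refine ⟨_, ⟨Real.pi / 3, (√3 * (x + 3 / 2 * N + (y - N) / 2), 3 / 2 * (y - N)), rfl⟩, ?_⟩
    rintro z ⟨h1, h2, h3, h4⟩
    obtain ⟨hs1, hs2⟩ := sqrt_three_bounds
    have hss := sqrt_three_mul_self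
    have hx : (triChart.crd (rot (Real.pi / 3) z +
        (√3 * (x + 3 / 2 * N + (y - N) / 2), 3 / 2 * (y - N)))) =
        (x + 3 / 2 * N - 2 / 3 * z.2, y - N + √3 * z.1 / 3 + z.2 / 3) := by
      simp only [triChart, rot, Real.cos_pi_div_three, Real.sin_pi_div_three, Prod.fst_add,
        Prod.snd_add, Prod.mk.injEq]
      constructor
      · linear_combination (x + 3 / 2 * N + (y - N) / 2 - z.2 / 2) / 3 * hss
      · ring
    rw [hx]
    simp only [mem_prod, mem_Icc]
    refine ⟨⟨⟨?_, ?_⟩, ?_, ?_⟩, fun h => ?_, fun h => ?_⟩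
    all_goals nlinarith

end SquareTriangular

section Hexagonal

/-- Vertices of the hexagonal lattice indexed by column and row. -/
noncomputable def hexPos (u : Vtx) : Pt :=
  (√3 * ((u.1 + 1) / 2), if (u.1 - u.2) % 2 = 0 then 3 / 2 * u.2 + 1 / 2 else 3 / 2 * u.2 + 1)

/-- The brick-wall representation of the edges of the hexagonal lattice. -/
def hexEdge (e : TriE) : TriE :=
  if e.2.2 = 0 then (2 * e.1 + e.2.1, e.2.1 - 1, 2)
  else if e.2.2 = 1 then (2 * e.1 + e.2.1, e.2.1, 0)
  else (2 * e.1 + e.2.1 - 1, e.2.1, 0)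

lemma hexEdge_zero (a b : ℤ) : hexEdge (a, b, 0) = (2 * a + b, b - 1, 2) := rfl
lemma hexEdge_one (a b : ℤ) : hexEdge (a, b, 1) = (2 * a + b, b, 0) := rfl
lemma hexEdge_two (a b : ℤ) : hexEdge (a, b, 2) = (2 * a + b - 1, b, 0) := rfl

lemma hup_eq (a b : ℤ) : hup a b = hexPos (2 * a + b, b) := by
  have : (2 * a + b - b) % 2 = 0 := by omega
  simp only [hup, hexPos, this, if_true, Prod.mk.injEq, and_true]
  push_cast
  ring

lemma hdown_eq (a b : ℤ) : hdown a b = hexPos (2 * a + b, b - 1) := by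
  have : ¬ (2 * a + b - (b - 1)) % 2 = 0 := by omega
  simp only [hdown, hexPos, this, if_false, Prod.mk.injEq]
  push_cast
  constructor <;> ring

lemma hex_ends_zero (a b : ℤ) : hexLattice.ends (a, b, 0) = (hdown a b, hup a b) := rfl
lemma hex_ends_one (a b : ℤ) : hexLattice.ends (a, b, 1) = (hup a b, hdown a (b + 1)) := rfl
lemma hex_ends_two (a b : ℤ) : hexLattice.ends (a, b, 2) = (hup a b, hdown (a - 1) (b + 1)) := rfl

lemma hexPos_snd (u : Vtx) :
    3 / 2 * (u.2 : ℝ) + 1 / 2 ≤ (hexPos u).2 ∧ (hexPos u).2 ≤ 3 / 2 * (u.2 : ℝ) + 1 := by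
  simp only [hexPos]
  split_ifs <;> constructor <;> linarith

/-- The hexagonal lattice as a brick-wall sublattice of the triangular lattice. -/
noncomputable def hexEmb : TriEmb hexLattice where
  pos := hexPos
  edge := hexEdge
  edge_inj e f h := by
    induction e using TriE.cases <;> induction f using TriE.cases <;>
      simp only [hexEdge_zero, hexEdge_one, hexEdge_two, Prod.mk.injEq, Fin.reduceEq, and_true,
        and_false] at h ⊢ <;> omega
  ends_eq e := by
    induction e using TriE.cases with
    | h0 a b =>
      left
      simp only [hex_ends_zero, hexEdge_zero, te_two, hup_eq, hdown_eq, sub_add_cancel]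
    | h1 a b =>
      left
      simp only [hex_ends_one, hexEdge_one, te_zero, hup_eq, hdown_eq, add_sub_cancel_right,
        add_assoc]
    | h2 a b =>
      right
      simp only [hex_ends_two, hexEdge_two, te_zero, hup_eq, hdown_eq, add_sub_cancel_right,
        sub_add_cancel, Prod.mk.injEq, true_and]
      congr 2
      ring
  pos_mem u := by
    rcases Int.emod_two_eq_zero_or_one (u.1 - u.2) with h | h
    · have := mem_vertexSet_right hexLattice ((u.1 - u.2) / 2, u.2, 0)
      rw [hex_ends_zero, hup_eq] at this
      convert this using 2
      ext <;> simp only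
      omega
    · have := mem_vertexSet_left hexLattice ((u.1 - u.2) / 2, u.2 + 1, 0)
      rw [hex_ends_zero, hdown_eq] at this
      convert this using 2
      ext <;> simp only <;> omega
  edist_le u v := by
    obtain ⟨h1, h2⟩ := abs_le_dV u v
    have hs := sqrt_three_bounds
    have hd := (abs_nonneg _).trans h1
    by_cases huv : u = v
    · subst huv
      simp only [edist2, sub_self, ne_eq, OfNat.ofNat_ne_zero, not_false_eq_true, zero_pow,
        add_zero, Real.sqrt_zero]
      positivity
    have hd1 : (1 : ℝ) ≤ dV u v := by
      have : (1 : ℤ) ≤ dV u v := by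
        by_contra hlt
        refine huv ?_
        simp only [dV] at hlt
        ext <;> omega
      exact_mod_cast this
    obtain ⟨h3, h4⟩ := hexPos_snd u
    obtain ⟨h5, h6⟩ := hexPos_snd v
    have := edist2_le (u := hexPos u) (v := hexPos v) (a := dV u v) (b := 2 * dV u v) ?_ ?_
    · linarith
    · have h7 : (hexPos u).1 - (hexPos v).1 = √3 / 2 * (u.1 - v.1) := by simp only [hexPos]; ring
      rw [h7, abs_mul, abs_of_pos (by linarith)]
      nlinarith [abs_nonneg ((u.1 : ℝ) - v.1)]
    · rw [abs_le] at h2 ⊢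
      constructor <;> linarith
  le_edist u v := by
    obtain ⟨h1, h2⟩ := le_edist2 (hexPos u) (hexPos v)
    have hd := (abs_nonneg _).trans h1
    have h3 := abs_le_of_sqrt_three_mul (a := (u.1 - v.1) / 2) (by simp only [hexPos]; ring) h1
    obtain ⟨h4, h5⟩ := hexPos_snd u
    obtain ⟨h6, h7⟩ := hexPos_snd v
    refine dV_le ?_ ?_
    · rw [abs_le] at h3 ⊢
      constructor <;> linarith
    · rcases eq_or_ne u.2 v.2 with h | h
      · rw [h, sub_self, abs_zero]
        positivity
      · rw [abs_le] at h2 ⊢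
        rcases lt_or_gt_of_ne h with h | h
        · have : (u.2 : ℝ) + 1 ≤ v.2 := by exact_mod_cast h
          constructor <;> linarith
        · have : (v.2 : ℝ) + 1 ≤ u.2 := by exact_mod_cast h
          constructor <;> linarith

/-- The segment of an edge of the hexagonal lattice in brick-wall coordinates. -/
def HexSeg (e : TriE) : Set (ℝ × ℝ) :=
  if e.2.2 = 0 then {z | z.1 = 2 * e.1 + e.2.1 ∧ e.2.1 - 5 / 6 ≤ z.2 ∧ z.2 ≤ e.2.1 - 1 / 6}
  else if e.2.2 = 1 then {z | 2 * e.1 + e.2.1 ≤ z.1 ∧ z.1 ≤ 2 * e.1 + e.2.1 + 1 ∧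
    3 * z.2 = 3 * e.2.1 - 1 / 2 + (z.1 - (2 * e.1 + e.2.1))}
  else {z | 2 * e.1 + e.2.1 - 1 ≤ z.1 ∧ z.1 ≤ 2 * e.1 + e.2.1 ∧
    3 * z.2 = 3 * e.2.1 - 1 / 2 + (2 * e.1 + e.2.1 - z.1)}

lemma mem_HexSeg_zero {a b : ℤ} {z : ℝ × ℝ} : z ∈ HexSeg (a, b, 0) ↔
    z.1 = 2 * a + b ∧ b - 5 / 6 ≤ z.2 ∧ z.2 ≤ b - 1 / 6 := Iff.rfl
lemma mem_HexSeg_one {a b : ℤ} {z : ℝ × ℝ} : z ∈ HexSeg (a, b, 1) ↔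
    2 * a + b ≤ z.1 ∧ z.1 ≤ 2 * a + b + 1 ∧ 3 * z.2 = 3 * b - 1 / 2 + (z.1 - (2 * a + b)) := Iff.rfl
lemma mem_HexSeg_two {a b : ℤ} {z : ℝ × ℝ} : z ∈ HexSeg (a, b, 2) ↔
    2 * a + b - 1 ≤ z.1 ∧ z.1 ≤ 2 * a + b ∧ 3 * z.2 = 3 * b - 1 / 2 + (2 * a + b - z.1) := Iff.rfl

lemma HexSeg.near {e : TriE} {z : ℝ × ℝ} (h : z ∈ HexSeg e) :
    Near (te (hexEdge e)).1 z ∧ Near (te (hexEdge e)).2 z := by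
  induction e using TriE.cases <;>
    simp only [mem_HexSeg_zero, mem_HexSeg_one, mem_HexSeg_two] at h <;>
    obtain ⟨h1, h2, h3⟩ := h <;>
    simp only [hexEdge_zero, hexEdge_one, hexEdge_two, te_zero, te_two, Near, abs_le] <;>
    push_cast <;> refine ⟨⟨⟨?_, ?_⟩, ?_, ?_⟩, ⟨?_, ?_⟩, ?_, ?_⟩ <;> linarith

lemma HexSeg.planar {e f : TriE} {z : ℝ × ℝ} (h : z ∈ HexSeg e) (h' : z ∈ HexSeg f) :
    ((te (hexEdge e)).1 = (te (hexEdge f)).1 ∨ (te (hexEdge e)).1 = (te (hexEdge f)).2) ∨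
      ((te (hexEdge e)).2 = (te (hexEdge f)).1 ∨ (te (hexEdge e)).2 = (te (hexEdge f)).2) := by
  obtain ⟨x, y⟩ := z
  induction e using TriE.cases with | _ a b <;> induction f using TriE.cases with | _ c d <;>
    simp only [mem_HexSeg_zero, mem_HexSeg_one, mem_HexSeg_two] at h h' <;>
    simp only [hexEdge_zero, hexEdge_one, hexEdge_two, te_zero, te_two, Prod.mk.injEq]
  · have h1 : 2 * a + b = 2 * c + d := by rify; linarith
    have h2 : (b : ℝ) < d + 1 := by linarith
    have h3 : (d : ℝ) < b + 1 := by linarith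
    norm_cast at h2 h3
    omega
  · have : d ≤ b ∧ b ≤ d + 1 ∧ 2 * c + d ≤ 2 * a + b ∧ 2 * a + b ≤ 2 * c + d + 1 ∧
        2 * a + b - (2 * c + d) ≤ 3 * (b - d) ∧
        3 * (b - d) - 2 ≤ 2 * a + b - (2 * c + d) := by
      refine ⟨?_, ?_, ?_, ?_, ?_, ?_⟩ <;> rify <;> linarith
    omega
  · have : d ≤ b ∧ b ≤ d + 1 ∧ 2 * a + b ≤ 2 * c + d ∧ 2 * c + d ≤ 2 * a + b + 1 ∧
        2 * c + d - (2 * a + b) ≤ 3 * (b - d) ∧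
        3 * (b - d) - 2 ≤ 2 * c + d - (2 * a + b) := by
      refine ⟨?_, ?_, ?_, ?_, ?_, ?_⟩ <;> rify <;> linarith
    omega
  · have : b ≤ d ∧ d ≤ b + 1 ∧ 2 * a + b ≤ 2 * c + d ∧ 2 * c + d ≤ 2 * a + b + 1 ∧
        2 * c + d - (2 * a + b) ≤ 3 * (d - b) ∧
        3 * (d - b) - 2 ≤ 2 * c + d - (2 * a + b) := by
      refine ⟨?_, ?_, ?_, ?_, ?_, ?_⟩ <;> rify <;> linarith
    omega
  · have : 3 * (b - d) = 2 * a + b - (2 * c + d) ∧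
        2 * a + b ≤ 2 * c + d + 1 ∧ 2 * c + d ≤ 2 * a + b + 1 := by
      refine ⟨?_, ?_, ?_⟩ <;> rify <;> linarith
    omega
  · have : 2 * (2 * a + b) ≤ 3 * (d - b) + (2 * a + b) + (2 * c + d) ∧
        3 * (d - b) + (2 * a + b) + (2 * c + d) ≤ 2 * (2 * a + b) + 2 ∧
        2 * (2 * c + d) - 2 ≤ 3 * (d - b) + (2 * a + b) + (2 * c + d) ∧
        3 * (d - b) + (2 * a + b) + (2 * c + d) ≤ 2 * (2 * c + d) := by
      refine ⟨?_, ?_, ?_, ?_⟩ <;> rify <;> linarith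
    omega
  · have : b ≤ d ∧ d ≤ b + 1 ∧ 2 * c + d ≤ 2 * a + b ∧ 2 * a + b ≤ 2 * c + d + 1 ∧
        2 * a + b - (2 * c + d) ≤ 3 * (d - b) ∧
        3 * (d - b) - 2 ≤ 2 * a + b - (2 * c + d) := by
      refine ⟨?_, ?_, ?_, ?_, ?_, ?_⟩ <;> rify <;> linarith
    omega
  · have : 2 * (2 * c + d) ≤ 3 * (b - d) + (2 * c + d) + (2 * a + b) ∧
        3 * (b - d) + (2 * c + d) + (2 * a + b) ≤ 2 * (2 * c + d) + 2 ∧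
        2 * (2 * a + b) - 2 ≤ 3 * (b - d) + (2 * c + d) + (2 * a + b) ∧
        3 * (b - d) + (2 * c + d) + (2 * a + b) ≤ 2 * (2 * a + b) := by
      refine ⟨?_, ?_, ?_, ?_⟩ <;> rify <;> linarith
    omega
  · have : 3 * (b - d) = 2 * c + d - (2 * a + b) ∧
        2 * a + b ≤ 2 * c + d + 1 ∧ 2 * c + d ≤ 2 * a + b + 1 := by
      refine ⟨?_, ?_, ?_⟩ <;> rify <;> linarith
    omega

lemma hex_mem_HexSeg {e : TriE} {z : Pt} (hz : z ∈ seg hexLattice e) :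
    (2 * √3 / 3 * z.1 - 1, 2 / 3 * z.2 - 1 / 2) ∈ HexSeg e := by
  obtain ⟨s, ⟨h0, h1⟩, hx, hy⟩ := mem_seg_iff.1 hz
  have h3 := sqrt_three_mul_self
  induction e using TriE.cases with
  | h0 a b =>
    simp only [hex_ends_zero, hup, hdown] at hx hy
    have hz1 : 2 * √3 / 3 * z.1 - 1 = 2 * a + b := by
      rw [hx]
      linear_combination (2 * (a + (b + 1) / 2) / 3 : ℝ) * h3
    refine mem_HexSeg_zero.2 ⟨hz1, ?_, ?_⟩ <;> simp only [hy] <;> linarith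
  | h1 a b =>
    simp only [hex_ends_one, hup, hdown] at hx hy
    push_cast at hx hy
    have hz1 : 2 * √3 / 3 * z.1 - 1 = 2 * a + b + s := by
      rw [hx]
      linear_combination (2 * (a + (b + 1) / 2 + s / 2) / 3 : ℝ) * h3
    refine mem_HexSeg_one.2 ⟨?_, ?_, ?_⟩ <;> simp only [hy, hz1] <;> linarith
  | h2 a b =>
    simp only [hex_ends_two, hup, hdown] at hx hy
    push_cast at hx hy
    have hz1 : 2 * √3 / 3 * z.1 - 1 = 2 * a + b - s := by
      rw [hx]
      linear_combination (2 * (a + (b + 1) / 2 - s / 2) / 3 : ℝ) * h3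
    refine mem_HexSeg_two.2 ⟨?_, ?_, ?_⟩ <;> simp only [hy, hz1] <;> linarith

/-- Brick-wall coordinates on the hexagonal lattice. -/
noncomputable def hexChart : Chart hexEmb where
  crd z := (2 * √3 / 3 * z.1 - 1, 2 / 3 * z.2 - 1 / 2)
  cont := by fun_prop
  near _ _ hz := HexSeg.near (hex_mem_HexSeg hz)
  planar _ _ _ hz hz' := HexSeg.planar (hex_mem_HexSeg hz) (hex_mem_HexSeg hz')

lemma hexBoxes : hexChart.Boxes where
  hor N hN x y := by
    refine ⟨_, ⟨0, (√3 * ((x - 6 * N + 1) / 2), 3 / 2 * (y + N / 2 + 1 / 2)), rfl⟩, ?_⟩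
    rintro z ⟨h1, h2, h3, h4⟩
    obtain ⟨hs1, hs2⟩ := sqrt_three_bounds
    have hss := sqrt_three_mul_self
    have hx : (hexChart.crd
        (rot 0 z + (√3 * ((x - 6 * N + 1) / 2), 3 / 2 * (y + N / 2 + 1 / 2)))) =
        (x - 6 * N + 2 * √3 * z.1 / 3, y + N / 2 + 2 / 3 * z.2) := by
      simp only [hexChart, rot, Real.cos_zero, Real.sin_zero, Prod.fst_add, Prod.snd_add,
        Prod.mk.injEq]
      constructor
      · linear_combination (x - 6 * N + 1) / 3 * hss
      · ring
    rw [hx]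
    simp only [mem_prod, mem_Icc]
    refine ⟨⟨⟨?_, ?_⟩, ?_, ?_⟩, fun h => ?_, fun h => ?_⟩
    all_goals nlinarith
  ver N hN x y := by
    refine ⟨_, ⟨Real.pi / 2, (√3 * ((x + 3 / 2 * N + 1) / 2), 3 / 2 * (y - N + 1 / 2)), rfl⟩, ?_⟩
    rintro z ⟨h1, h2, h3, h4⟩
    obtain ⟨hs1, hs2⟩ := sqrt_three_bounds
    have hss := sqrt_three_mul_self
    have hx : (hexChart.crd (rot (Real.pi / 2) z +
        (√3 * ((x + 3 / 2 * N + 1) / 2), 3 / 2 * (y - N + 1 / 2)))) =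
        (x + 3 / 2 * N - 2 * √3 / 3 * z.2, y - N + 2 / 3 * z.1) := by
      simp only [hexChart, rot, Real.cos_pi_div_two, Real.sin_pi_div_two, Prod.fst_add,
        Prod.snd_add, Prod.mk.injEq]
      constructor
      · linear_combination (x + 3 / 2 * N + 1) / 3 * hss
      · ring
    rw [hx]
    simp only [mem_prod, mem_Icc]
    refine ⟨⟨⟨?_, ?_⟩, ?_, ?_⟩, fun h => ?_, fun h => ?_⟩
    all_goals nlinarith

end Hexagonal

/-- For each of the square, triangular and hexagonal lattices:
if `P_p` has the box-crossing property then (a) near every vertex there is a vertex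
whose cluster radius has a uniform polynomial lower bound, and (b) for every `ν > 0`,
under `\overline{P}_{p+ν}` there is, near every vertex, a vertex percolating with
uniformly positive probability, and a.s. a unique infinite open cluster. -/
theorem supercriticality_via_box_crossing :
    SupercriticalityViaBXP sqLattice ∧
    SupercriticalityViaBXP triLattice ∧
    SupercriticalityViaBXP hexLattice :=
  ⟨sqBoxes.supercriticality, triBoxes.supercriticality, hexBoxes.supercriticality⟩

end Perc
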